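/- If κ is a Ramsey cardinal, then every A ⊆ κ is contained in an ω-special weak κ-model M for which there is a weakly amenable ω₁-intersecting M-ultrafilter on κ. -/

import Mathlib

noncomputable section

namespace MPaper

open ZFSet

attribute [local instance] Classical.propDecidable

/-! ### Basic set-theoretic vocabulary over `ZFSet` -/

/-- The (external) cardinality of a ZFC set. -/
def zcard (x : ZFSet) : Cardinal := Cardinal.mk x.toSet

/-- `x` is a von Neumann ordinal: a transitive set of transitive sets. -/
def IsOrd (x : ZFSet) : Prop := x.IsTransitive ∧ ∀ y ∈ x, ZFSet.IsTransitive y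

/-- `κ` is a cardinal: an ordinal not equinumerous with any of its members. -/
def IsCard (κ : ZFSet) : Prop := IsOrd κ ∧ ∀ α ∈ κ, zcard α < zcard κ

/-- The ordinal `κ⁺`, the cardinal successor of `κ`. -/
def cardSuccOrd (κ : ZFSet) : Ordinal := (Order.succ (zcard κ)).ord

/-- `f` is a set-coded function with domain `d` (a set of Kuratowski pairs). -/
def IsZFunc (d f : ZFSet) : Prop :=
  (∀ p ∈ f, ∃ a ∈ d, ∃ b, p = ZFSet.pair a b) ∧ ∀ a ∈ d, ∃! b, ZFSet.pair a b ∈ f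

/-- Application of a set-coded function. -/
def fapp (f a : ZFSet) : ZFSet :=
  ⋃₀ (ZFSet.sep (fun b => ZFSet.pair a b ∈ f) (⋃₀ (⋃₀ f)))

/-- `f` maps `d` into `y`. -/
def MapsInto (f d y : ZFSet) : Prop := ∀ a ∈ d, fapp f a ∈ y

/-- `f` maps `d` onto `y`. -/
def SurjOnto (f d y : ZFSet) : Prop := MapsInto f d y ∧ ∀ b ∈ y, ∃ a ∈ d, fapp f a = b

/-- `f` is injective on `d`. -/
def InjOnZ (f d : ZFSet) : Prop := ∀ a ∈ d, ∀ b ∈ d, fapp f a = fapp f b → a = b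

/-- `f` is a bijection from `d` onto `y`. -/
def IsBij (f d y : ZFSet) : Prop := IsZFunc d f ∧ SurjOnto f d y ∧ InjOnZ f d

/-- The tail `κ ∖ α = {ξ ∈ κ | α ≤ ξ}` (for ordinals `α ∈ κ`). -/
def tailSet (κ α : ZFSet) : ZFSet := ZFSet.sep (fun ξ => ξ ∉ α) κ

/-- The relative complement `κ ∖ A`. -/
def compl (κ A : ZFSet) : ZFSet := ZFSet.sep (fun ξ => ξ ∉ A) κ

/-! ### First-order satisfaction in ∈-structures -/

/-- First order formulas in the language of set theory, with variables indexed by `ℕ`. -/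
inductive Fml : Type
  | mem : ℕ → ℕ → Fml
  | eq : ℕ → ℕ → Fml
  | impl : Fml → Fml → Fml
  | neg : Fml → Fml
  | all : ℕ → Fml → Fml

/-- Tarskian satisfaction of a formula in the ∈-structure with domain `D`. -/
def Sat (D : Set ZFSet) : Fml → (ℕ → ZFSet) → Prop
  | .mem i j, v => v i ∈ v j
  | .eq i j, v => v i = v j
  | .impl φ ψ, v => Sat D φ v → Sat D ψ v
  | .neg φ, v => ¬ Sat D φ v
  | .all n φ, v => ∀ x ∈ D, Sat D φ (Function.update v n x)

/-- `D` is an elementary substructure of `E` (as ∈-structures). -/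
def ElemSub (D E : Set ZFSet) : Prop :=
  D ⊆ E ∧ ∀ (φ : Fml) (v : ℕ → ZFSet), (∀ n, v n ∈ D) → (Sat D φ v ↔ Sat E φ v)

/-- `r` is a well-ordering of `x` (coded as a set of Kuratowski pairs). -/
def IsWellOrderOn (x r : ZFSet) : Prop :=
  (∀ p ∈ r, ∃ a ∈ x, ∃ b ∈ x, p = ZFSet.pair a b) ∧
  (∀ a ∈ x, ∀ b ∈ x, a = b ∨ ZFSet.pair a b ∈ r ∨ ZFSet.pair b a ∈ r) ∧
  (∀ a ∈ x, ∀ b ∈ x, ∀ c ∈ x,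
    ZFSet.pair a b ∈ r → ZFSet.pair b c ∈ r → ZFSet.pair a c ∈ r) ∧
  (∀ a ∈ x, ZFSet.pair a a ∉ r) ∧
  (∀ S : Set ZFSet, S ⊆ x.toSet → S.Nonempty → ∃ a ∈ S, ∀ b ∈ S, ZFSet.pair b a ∉ r)

/-- A transitive model of `ZFC⁻` (ZFC minus power set): a transitive set closed under
pairing and union, containing `ω`, satisfying the separation and collection schemes for
first-order formulas, and choice in the guise of the well-ordering principle.
(Extensionality and foundation hold automatically in transitive sets.) -/
def IsTransModel (M : ZFSet) : Prop :=
  M.IsTransitive ∧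
  ZFSet.omega ∈ M ∧
  (∀ x ∈ M, ∀ y ∈ M, ({x, y} : ZFSet) ∈ M) ∧
  (∀ x ∈ M, (⋃₀ x : ZFSet) ∈ M) ∧
  (∀ (φ : Fml) (v : ℕ → ZFSet), (∀ n, v n ∈ M) → ∀ a ∈ M,
    ∃ b ∈ M, ∀ x, x ∈ b ↔ x ∈ a ∧ Sat M.toSet φ (Function.update v 0 x)) ∧
  (∀ (φ : Fml) (v : ℕ → ZFSet), (∀ n, v n ∈ M) → ∀ a ∈ M,
    (∀ x ∈ a, ∃ y ∈ M, Sat M.toSet φ (Function.update (Function.update v 0 x) 1 y)) →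
    ∃ b ∈ M, ∀ x ∈ a, ∃ y ∈ b, Sat M.toSet φ (Function.update (Function.update v 0 x) 1 y)) ∧
  (∀ x ∈ M, ∃ r ∈ M, IsWellOrderOn x r)

/-! ### Weak κ-models, κ-models, M-ultrafilters -/

/-- A weak `κ`-model: a transitive model of ZFC⁻ of size `κ` with `κ ∈ M`. -/
def IsWeakModel (κ M : ZFSet) : Prop :=
  IsTransModel M ∧ κ ∈ M ∧ zcard M = zcard κ

/-- `M` is closed under `<κ`-sequences (of its elements). -/
def SeqClosed (κ M : ZFSet) : Prop :=
  ∀ γ ∈ κ, ∀ f : ZFSet, IsZFunc γ f → (∀ a ∈ γ, fapp f a ∈ M) → f ∈ M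

/-- A `κ`-model: a weak `κ`-model closed under `<κ`-sequences. -/
def IsKappaModel (κ M : ZFSet) : Prop := IsWeakModel κ M ∧ SeqClosed κ M

/-- `U` is an `M`-ultrafilter on `κ`: `⟨M, ∈, U⟩` thinks `U` is a normal ultrafilter on `κ`
containing all tail sets. -/
def IsMUltrafilter (κ M U : ZFSet) : Prop :=
  (∀ A ∈ U, A ∈ M ∧ A ⊆ κ) ∧
  (∀ α ∈ κ, tailSet κ α ∈ U) ∧
  (∅ : ZFSet) ∉ U ∧
  (∀ A ∈ U, ∀ B ∈ U, A ∩ B ∈ U) ∧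
  (∀ A ∈ U, ∀ B, B ∈ M → B ⊆ κ → A ⊆ B → B ∈ U) ∧
  (∀ B, B ∈ M → B ⊆ κ → B ∈ U ∨ compl κ B ∈ U) ∧
  (∀ f ∈ M, IsZFunc κ f → ZFSet.sep (fun ξ => fapp f ξ ∈ ξ) κ ∈ U →
    ∃ γ ∈ κ, ZFSet.sep (fun ξ => fapp f ξ = γ) κ ∈ U)

/-- `U` is weakly amenable for `M`: for every `X ∈ M` of size at most `κ` in `M`,
the intersection `X ∩ U` belongs to `M`. -/
def WeaklyAmenable (κ M U : ZFSet) : Prop :=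
  ∀ X ∈ M, (∃ f ∈ M.toSet, IsZFunc κ f ∧ ∀ y ∈ X, ∃ ξ ∈ κ, fapp f ξ = y) →
    X ∩ U ∈ M

/-- `U` is `ω₁`-intersecting: every countable collection of its members has a common element. -/
def OmegaOneIntersecting (U : ZFSet) : Prop :=
  ∀ s : ℕ → ZFSet, (∀ n, s n ∈ U) → ∃ x, ∀ n, x ∈ s n

/-- `M` contains (its version of) `V_κ`, i.e. the set of all sets of rank `< κ`. -/
def HasVkappa (κ M : ZFSet) : Prop :=
  ∃ v ∈ M.toSet, ∀ x, x ∈ v ↔ ZFSet.rank x < ZFSet.rank κ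

/-! ### Small universe measures and the associated models `M_U`, `N_U` -/

/-- `M` is the minimal model associated to `U` (the collection of Mostowski collapses of
well-founded relations on `κ` coded by sets in `U` and their complements): a weak `κ`-model
with `V_κ ∈ M` for which `U` is an `M`-ultrafilter, contained in every transitive
ZFC⁻-model `M'` with `κ ∈ M'` for which `U` is an `M'`-ultrafilter. -/
def IsMUModel (κ U M : ZFSet) : Prop :=
  IsWeakModel κ M ∧ HasVkappa κ M ∧ IsMUltrafilter κ M U ∧
  ∀ M', IsTransModel M' → κ ∈ M' → IsMUltrafilter κ M' U → M ⊆ M'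

/-- A small universe measure on `κ`: a set `U` of subsets of `κ` of size `κ` whose associated
minimal model `M_U` exists (is a weak `κ`-model with `V_κ ∈ M_U` and `U` an `M_U`-ultrafilter). -/
def IsSUMeasure (κ U : ZFSet) : Prop :=
  zcard U = zcard κ ∧ (∀ A ∈ U, A ⊆ κ) ∧ ∃ M, IsMUModel κ U M

/-- The minimal model `M_U` associated to a small universe measure `U`. -/
def MU (κ U : ZFSet) : ZFSet :=
  if h : ∃ M, IsMUModel κ U M then h.choose else ∅

/-- `j : M → N` is (up to isomorphism) the ultrapower embedding of `M` by the
`M`-ultrafilter `U` on `κ`, with `N` transitive (so the ultrapower is well-founded):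
`j` is elementary, every element of `N` has the form `j(f)(κ)` for `f : κ → M` in `M`,
and `U` is the `M`-ultrafilter derived from `j` with seed `κ`. -/
def IsUltrapowerEmb (κ M U N : ZFSet) (j : ZFSet → ZFSet) : Prop :=
  N.IsTransitive ∧
  (∀ x ∈ M, j x ∈ N) ∧
  (∀ (φ : Fml) (v : ℕ → ZFSet), (∀ n, v n ∈ M) →
    (Sat M.toSet φ v ↔ Sat N.toSet φ (fun n => j (v n)))) ∧
  (∀ a ∈ N, ∃ f ∈ M.toSet, IsZFunc κ f ∧ MapsInto f κ M ∧ fapp (j f) κ = a) ∧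
  (∀ A ∈ M, A ⊆ κ → (A ∈ U ↔ κ ∈ j A))

/-- The ultrapower of `M_U` by `U` is well-founded. -/
def UltrapowerWF (κ U : ZFSet) : Prop :=
  ∃ (N : ZFSet) (j : ZFSet → ZFSet), IsUltrapowerEmb κ (MU κ U) U N j

/-- A choice of transitive collapse of the ultrapower of `M_U` by `U`, with its embedding. -/
def upData (κ U : ZFSet) : ZFSet × (ZFSet → ZFSet) :=
  if h : ∃ p : ZFSet × (ZFSet → ZFSet), IsUltrapowerEmb κ (MU κ U) U p.1 p.2
  then h.choose else (∅, id)

/-- `N_U`: the transitive collapse of the ultrapower of `M_U` by `U` (when well-founded). -/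
def NU (κ U : ZFSet) : ZFSet := (upData κ U).1

/-- The ultrapower embedding `j_U : M_U → N_U`. -/
def jU (κ U : ZFSet) : ZFSet → ZFSet := (upData κ U).2

/-- `M_U⋆ = V_{j(κ)}^{N_U}`, the rank-initial segment of `N_U` below `j_U(κ)`. -/
def MUstar (κ U : ZFSet) : ZFSet :=
  ZFSet.sep (fun x => ZFSet.rank x < ZFSet.rank (jU κ U κ)) (NU κ U)

/-! ### Hereditary size, `H_{κ⁺}`, elementarity -/

/-- `x` has hereditary size at most `κ`. -/
def HeredLE (κ : ZFSet) : ZFSet → Prop :=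
  WellFounded.fix ZFSet.mem_wf
    (fun x ih => zcard x ≤ zcard κ ∧ ∀ y, ∀ h : y ∈ x, ih y h)

/-- The class `H_{κ⁺}` of sets of hereditary size at most `κ`. -/
def Hclass (κ : ZFSet) : Set ZFSet := { x | HeredLE κ x }

/-! ### The measures witnessing Ramsey and Ramsey-like cardinals -/

/-- A Ramsey measure on `κ`: a weakly amenable `ω₁`-intersecting small universe measure. -/
def IsRamseyMeasure (κ U : ZFSet) : Prop :=
  IsSUMeasure κ U ∧ WeaklyAmenable κ (MU κ U) U ∧ OmegaOneIntersecting U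

/-- A strong Ramsey measure on `κ`: a weakly amenable small universe measure whose
minimal model `M_U` is a `κ`-model. -/
def IsStrongRamseyMeasure (κ U : ZFSet) : Prop :=
  IsSUMeasure κ U ∧ WeaklyAmenable κ (MU κ U) U ∧ SeqClosed κ (MU κ U)

/-- A super Ramsey measure on `κ`: a strong Ramsey measure with `M_U ≺ H_{κ⁺}`. -/
def IsSuperRamseyMeasure (κ U : ZFSet) : Prop :=
  IsStrongRamseyMeasure κ U ∧ ElemSub (MU κ U).toSet (Hclass κ)

/-- `I` certifies `U`: `I` is an unbounded subset of `κ` and the sets in `U` are exactly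
the subsets of `κ` in `M_U` containing a tail of `I`. -/
def Certifies (κ U : ZFSet) (I : Set ZFSet) : Prop :=
  (∀ ξ ∈ I, ξ ∈ κ) ∧ (∀ α ∈ κ, ∃ ξ ∈ I, ξ ∉ α) ∧
  ∀ X ∈ (MU κ U).toSet, X ⊆ κ →
    (X ∈ U ↔ ∃ α ∈ κ.toSet, ∀ ξ ∈ I, ξ ∉ α → ξ ∈ X)

/-- A certified Ramsey measure on `κ`: a weakly amenable small universe measure which is
certified by some unbounded `I ⊆ κ`. -/
def IsCertifiedRamseyMeasure (κ U : ZFSet) : Prop :=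
  IsSUMeasure κ U ∧ WeaklyAmenable κ (MU κ U) U ∧ ∃ I : Set ZFSet, Certifies κ U I

/-! ### Relativized (internal) versions of the measure predicates -/

/-- `ω₁`-intersecting from the point of view of the transitive model `N`: every
`ω`-sequence of members of `U` lying in `N` has a common element. -/
def OmegaOneIntersectingIn (N U : ZFSet) : Prop :=
  ∀ f ∈ N.toSet, IsZFunc ZFSet.omega f → (∀ n ∈ ZFSet.omega, fapp f n ∈ U) →
    ∃ x, ∀ n ∈ ZFSet.omega, x ∈ fapp f n

/-- `N ⊨ U is a Ramsey measure on κ`, for a transitive ZFC⁻-model `N`: all components are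
absolute except `ω₁`-intersectingness, which is evaluated using sequences in `N`. -/
def RamseyMeasureIn (N κ U : ZFSet) : Prop :=
  U ∈ N ∧ IsSUMeasure κ U ∧ WeaklyAmenable κ (MU κ U) U ∧ OmegaOneIntersectingIn N U

/-- `N ⊨ U is a strong Ramsey measure on κ`: closure of `M_U` under `<κ`-sequences is
evaluated using the sequences lying in `N`. -/
def StrongRamseyMeasureIn (N κ U : ZFSet) : Prop :=
  U ∈ N ∧ IsSUMeasure κ U ∧ WeaklyAmenable κ (MU κ U) U ∧
  ∀ f ∈ N.toSet, ∀ γ ∈ κ, IsZFunc γ f → (∀ a ∈ γ, fapp f a ∈ MU κ U) → f ∈ MU κ U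

/-- The class `H_{κ⁺}` as computed in `N`. -/
def HclassIn (N κ : ZFSet) : Set ZFSet := { x | x ∈ N ∧ HeredLE κ x }

/-- `N ⊨ U is a super Ramsey measure on κ`. -/
def SuperRamseyMeasureIn (N κ U : ZFSet) : Prop :=
  StrongRamseyMeasureIn N κ U ∧ ElemSub (MU κ U).toSet (HclassIn N κ)

/-- `N ⊨ U is a certified Ramsey measure on κ` (the certifying set is required to lie in `N`). -/
def CertifiedRamseyMeasureIn (N κ U : ZFSet) : Prop :=
  U ∈ N ∧ IsSUMeasure κ U ∧ WeaklyAmenable κ (MU κ U) U ∧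
  ∃ I ∈ N.toSet, Certifies κ U I.toSet

/-! ### Goodness, witness collections, and the M-order -/

/-- `U` is `A`-good: `A ∈ M_U`. -/
def AGood (κ A U : ZFSet) : Prop := A ∈ MU κ U

/-- A witness collection of `Pm`-measures on `κ`: a collection of `Pm`-measures containing
an `A`-good one for every `A ⊆ κ`. -/
def IsWitness (Pm : ZFSet → ZFSet → Prop) (κ : ZFSet) (𝒰 : Set ZFSet) : Prop :=
  (∀ U ∈ 𝒰, Pm κ U) ∧ ∀ A : ZFSet, A ⊆ κ → ∃ U ∈ 𝒰, AGood κ A U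

/-- The M-order on witness collections of `Pm`-measures on `κ`; `PmIn N κ U` is the
relativization `N ⊨ U is a Pm-measure on κ`.  `MOrder Pm PmIn κ 𝒰 𝒲` says `𝒰 ◁ 𝒲`. -/
def MOrder (Pm : ZFSet → ZFSet → Prop) (PmIn : ZFSet → ZFSet → ZFSet → Prop)
    (κ : ZFSet) (𝒰 𝒲 : Set ZFSet) : Prop :=
  IsWitness Pm κ 𝒰 ∧ IsWitness Pm κ 𝒲 ∧
  (∀ W ∈ 𝒲, ∀ A ∈ (NU κ W).toSet, A ⊆ κ →
    ∃ U ∈ 𝒰, U ∈ NU κ W ∧ AGood κ A U ∧ PmIn (NU κ W) κ U) ∧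
  (∀ U ∈ 𝒰, ∃ W ∈ 𝒲, U ∈ NU κ W)

/-! ### Ranks -/

/-- The rank of a point in an arbitrary binary relation (`0` at non-accessible points). -/
def relRank {X : Type*} (r : X → X → Prop) (x : X) : Ordinal :=
  if h : Acc r x then h.rank else 0

/-- The M-rank `o_Pm(κ)`: the strict supremum of the M-ranks of all witness collections of
`Pm`-measures on `κ` (and `0` if there are none). -/
def oRank (Pm : ZFSet → ZFSet → Prop) (PmIn : ZFSet → ZFSet → ZFSet → Prop)
    (κ : ZFSet) : Ordinal :=
  sSup { o : Ordinal |
    ∃ 𝒰 : Set ZFSet, IsWitness Pm κ 𝒰 ∧ o = relRank (MOrder Pm PmIn κ) 𝒰 + 1 }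

/-- `N ⊨ o_Pm(κ) ≥ α`, defined by the recursion: for every `A ⊆ κ` in `N` and every `β < α`
there is an `A`-good `Pm`-measure `W` in `N` (in the sense of `N`) whose ultrapower satisfies
`o_Pm(κ) ≥ β`. -/
def oGEin (PmIn : ZFSet → ZFSet → ZFSet → Prop) (κ : ZFSet) : Ordinal → ZFSet → Prop :=
  WellFounded.fix wellFounded_lt fun α ih N =>
    ∀ A ∈ N.toSet, A ⊆ κ → ∀ β, ∀ h : β < α,
      ∃ W ∈ N.toSet, PmIn N κ W ∧ AGood κ A W ∧ ih β h (NU κ W)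

/-- `N ⊨ o_Pm(κ) = α`. -/
def oEQin (PmIn : ZFSet → ZFSet → ZFSet → Prop) (κ : ZFSet) (α : Ordinal) (N : ZFSet) : Prop :=
  oGEin PmIn κ α N ∧ ¬ oGEin PmIn κ (α + 1) N

/-! ### The M-order and M-rank relativized to a model `ℳ` -/

/-- A witness collection (coded as a set) of `Pm`-measures in the sense of the model `ℳ`. -/
def IsWitnessIn (PmIn : ZFSet → ZFSet → ZFSet → Prop) (ℳ κ 𝒰 : ZFSet) : Prop :=
  𝒰 ∈ ℳ ∧ (∀ U ∈ 𝒰, PmIn ℳ κ U) ∧ ∀ A ∈ ℳ.toSet, A ⊆ κ → ∃ U ∈ 𝒰.toSet, AGood κ A U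

/-- The M-order on witness collections as computed in `ℳ`. -/
def MOrderIn (PmIn : ZFSet → ZFSet → ZFSet → Prop) (ℳ κ : ZFSet) (𝒰 𝒲 : ZFSet) : Prop :=
  IsWitnessIn PmIn ℳ κ 𝒰 ∧ IsWitnessIn PmIn ℳ κ 𝒲 ∧
  (∀ W ∈ 𝒲, ∀ A ∈ (NU κ W).toSet, A ⊆ κ →
    ∃ U ∈ 𝒰.toSet, U ∈ NU κ W ∧ AGood κ A U ∧ PmIn (NU κ W) κ U) ∧
  (∀ U ∈ 𝒰, ∃ W ∈ 𝒲.toSet, U ∈ NU κ W)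

/-- The M-rank `o_Pm(κ)` as computed in `ℳ`. -/
def oRankIn (PmIn : ZFSet → ZFSet → ZFSet → Prop) (ℳ κ : ZFSet) : Ordinal :=
  sSup { o : Ordinal |
    ∃ 𝒰 : ZFSet, IsWitnessIn PmIn ℳ κ 𝒰 ∧ o = relRank (MOrderIn PmIn ℳ κ) 𝒰 + 1 }

/-! ### Practical models, cover and approximation properties -/

/-- `ℳ` is practical for `κ`: a transitive ZFC⁻-model containing `κ` in which
`V_{κ+3}` exists. -/
def Practical (κ ℳ : ZFSet) : Prop :=
  IsTransModel ℳ ∧ κ ∈ ℳ ∧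
  ∃ v ∈ ℳ.toSet, ∀ x, x ∈ v ↔ (x ∈ ℳ ∧ ZFSet.rank x < ZFSet.rank κ + 3)

/-- `x` has size less than `δ` as witnessed inside the class `D`:
some `f ∈ D` injects `x` into an ordinal `γ ∈ δ`. -/
def SizeLTin (D : Set ZFSet) (x δ : ZFSet) : Prop :=
  ∃ γ ∈ δ.toSet, ∃ f ∈ D, IsZFunc x f ∧ MapsInto f x γ ∧ InjOnZ f x

/-- The pair `D ⊆ D'` has the `δ`-cover property. -/
def CoverProperty (δ : ZFSet) (D D' : Set ZFSet) : Prop :=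
  ∀ X ∈ D', X.toSet ⊆ D → SizeLTin D' X δ →
    ∃ Y ∈ D, X ⊆ Y ∧ SizeLTin D Y δ

/-- The pair `D ⊆ D'` has the `δ`-approximation property. -/
def ApproxProperty (δ : ZFSet) (D D' : Set ZFSet) : Prop :=
  ∀ X ∈ D', X.toSet ⊆ D → (∀ x ∈ D, SizeLTin D x δ → X ∩ x ∈ D) → X ∈ D

/-- `δ` is a cardinal from the point of view of the class `D`. -/
def IsCardIn (D : Set ZFSet) (δ : ZFSet) : Prop :=
  IsOrd δ ∧ δ ∈ D ∧ ∀ γ ∈ δ, ¬ ∃ f ∈ D, IsZFunc γ f ∧ SurjOnto f γ δ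

/-- `δ` is a regular (infinite) cardinal from the point of view of the class `D`. -/
def IsRegularIn (D : Set ZFSet) (δ : ZFSet) : Prop :=
  IsCardIn D δ ∧ ZFSet.omega ⊆ δ ∧
  ∀ γ ∈ δ, ∀ f ∈ D, IsZFunc γ f → MapsInto f γ δ →
    ∃ β ∈ δ, ∀ a ∈ γ, fapp f a ∈ β

/-- `H_λ` as computed in the model `V`: the members of `V` having, in `V`,
a transitive superset of size `< λ`. -/
def HIn (V lam : ZFSet) : Set ZFSet :=
  { x | x ∈ V ∧ ∃ t ∈ V.toSet, x ⊆ t ∧ t.IsTransitive ∧ SizeLTin V.toSet t lam }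

/-- `V` and `V'` have the same ordinals. -/
def SameOrdinals (D D' : Set ZFSet) : Prop :=
  ∀ α, IsOrd α → (α ∈ D ↔ α ∈ D')

/-- Every `ω`-sequence of elements of `ℳ` lying in `ℳ'` is an element of `ℳ`. -/
def OmegaSeqClosedPair (ℳ ℳ' : ZFSet) : Prop :=
  ∀ f ∈ ℳ'.toSet, IsZFunc ZFSet.omega f → (∀ n ∈ ZFSet.omega, fapp f n ∈ ℳ) → f ∈ ℳ

/-! ### Large cardinal properties -/

/-- `κ` is Ramsey: every `A ⊆ κ` belongs to a weak `κ`-model `M` carrying a weakly amenable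
`ω₁`-intersecting `M`-ultrafilter on `κ`. -/
def IsRamseyCard (κ : ZFSet) : Prop :=
  IsCard κ ∧ ∀ A : ZFSet, A ⊆ κ →
    ∃ M, IsWeakModel κ M ∧ A ∈ M ∧
      ∃ U, IsMUltrafilter κ M U ∧ WeaklyAmenable κ M U ∧ OmegaOneIntersecting U

/-- `κ` is strongly Ramsey: the model `M` can moreover be taken to be a `κ`-model. -/
def IsStronglyRamseyCard (κ : ZFSet) : Prop :=
  IsCard κ ∧ ∀ A : ZFSet, A ⊆ κ →
    ∃ M, IsKappaModel κ M ∧ A ∈ M ∧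
      ∃ U, IsMUltrafilter κ M U ∧ WeaklyAmenable κ M U ∧ OmegaOneIntersecting U

/-- `κ` is super Ramsey: the model `M` can moreover be taken to be a `κ`-model
elementary in `H_{κ⁺}`. -/
def IsSuperRamseyCard (κ : ZFSet) : Prop :=
  IsCard κ ∧ ∀ A : ZFSet, A ⊆ κ →
    ∃ M, IsKappaModel κ M ∧ ElemSub M.toSet (Hclass κ) ∧ A ∈ M ∧
      ∃ U, IsMUltrafilter κ M U ∧ WeaklyAmenable κ M U ∧ OmegaOneIntersecting U

/-- `κ` is weakly super Ramsey: the model `M` is a weak `κ`-model elementary in `H_{κ⁺}`. -/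
def IsWeaklySuperRamseyCard (κ : ZFSet) : Prop :=
  IsCard κ ∧ ∀ A : ZFSet, A ⊆ κ →
    ∃ M, IsWeakModel κ M ∧ ElemSub M.toSet (Hclass κ) ∧ A ∈ M ∧
      ∃ U, IsMUltrafilter κ M U ∧ WeaklyAmenable κ M U ∧ OmegaOneIntersecting U

/-- `κ` is measurable: there is a `κ`-complete nonprincipal ultrafilter on (all) subsets
of `κ`. -/
def IsMeasurableCard (κ : ZFSet) : Prop :=
  IsCard κ ∧ ZFSet.omega ∈ κ ∧
  ∃ 𝒰 : Set ZFSet,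
    (∀ A ∈ 𝒰, A ⊆ κ) ∧ (∅ : ZFSet) ∉ 𝒰 ∧ κ ∈ 𝒰 ∧
    (∀ A ∈ 𝒰, ∀ B : ZFSet, B ⊆ κ → A ⊆ B → B ∈ 𝒰) ∧
    (∀ A : ZFSet, A ⊆ κ → (A ∈ 𝒰 ∨ compl κ A ∈ 𝒰)) ∧
    (∀ γ ∈ κ.toSet, ∀ s : ZFSet → ZFSet, (∀ i ∈ γ, s i ∈ 𝒰) →
      ZFSet.sep (fun ξ => ∀ i ∈ γ, ξ ∈ s i) κ ∈ 𝒰)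

/-! ### Relativized large-cardinal properties -/

/-- `N ⊨ κ is Ramsey` (for a transitive model `N`): the witnessing models and ultrafilters
lie in `N`, smallness of the models is witnessed in `N`, and `ω₁`-intersectingness is
evaluated using the sequences in `N`. -/
def RamseyCardIn (N κ : ZFSet) : Prop :=
  ∀ A ∈ N.toSet, A ⊆ κ →
    ∃ M ∈ N.toSet, A ∈ M ∧ IsTransModel M ∧ κ ∈ M ∧
      (∃ f ∈ N.toSet, IsZFunc κ f ∧ SurjOnto f κ M) ∧
      ∃ U ∈ N.toSet, IsMUltrafilter κ M U ∧ WeaklyAmenable κ M U ∧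
        OmegaOneIntersectingIn N U

/-- `N ⊨ κ is strongly Ramsey`. -/
def StronglyRamseyCardIn (N κ : ZFSet) : Prop :=
  ∀ A ∈ N.toSet, A ⊆ κ →
    ∃ M ∈ N.toSet, A ∈ M ∧ IsTransModel M ∧ κ ∈ M ∧
      (∃ f ∈ N.toSet, IsZFunc κ f ∧ SurjOnto f κ M) ∧
      (∀ f ∈ N.toSet, ∀ γ ∈ κ, IsZFunc γ f → (∀ a ∈ γ, fapp f a ∈ M) → f ∈ M) ∧
      ∃ U ∈ N.toSet, IsMUltrafilter κ M U ∧ WeaklyAmenable κ M U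

/-- `N ⊨ κ is super Ramsey`. -/
def SuperRamseyCardIn (N κ : ZFSet) : Prop :=
  ∀ A ∈ N.toSet, A ⊆ κ →
    ∃ M ∈ N.toSet, A ∈ M ∧ IsTransModel M ∧ κ ∈ M ∧
      (∃ f ∈ N.toSet, IsZFunc κ f ∧ SurjOnto f κ M) ∧
      (∀ f ∈ N.toSet, ∀ γ ∈ κ, IsZFunc γ f → (∀ a ∈ γ, fapp f a ∈ M) → f ∈ M) ∧
      ElemSub M.toSet (HclassIn N κ) ∧
      ∃ U ∈ N.toSet, IsMUltrafilter κ M U ∧ WeaklyAmenable κ M U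

/-! ### ω-special models -/

/-- A weak `κ`-model `M` is `ω`-special: it is the union of a chain
`M₀ ≺ M₁ ≺ ⋯` of elementary substructures of `M` with each `Mₙ ∈ M` and `|Mₙ|^M = κ`. -/
def OmegaSpecial (κ M : ZFSet) : Prop :=
  ∃ s : ℕ → ZFSet,
    (∀ n, s n ∈ M) ∧
    (∀ n, (s n).toSet ⊆ (s (n + 1)).toSet) ∧
    (∀ n, ElemSub (s n).toSet M.toSet) ∧
    (∀ n, ∃ f ∈ M.toSet, IsBij f κ (s n)) ∧
    (∀ x, x ∈ M ↔ ∃ n, x ∈ s n)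

/-! ### Iterated ultrapowers and α-iterability -/

/-- `U` is an `α`-iterable `M`-ultrafilter on `κ`: there is a coherent system of transitive
models `Mod β` (`β ≤ α`), with commuting elementary embeddings `e β γ : Mod β → Mod γ`,
critical sequence `cr β` and ultrafilter sequence `Us β`, starting at `(M, κ, U)`, where each
successor step is given by an ultrapower and each limit step is a (collapsed) direct limit. -/
def IsAlphaIterable (κ M U : ZFSet) (α : Ordinal) : Prop :=
  ∃ (Mod : Ordinal → ZFSet) (cr : Ordinal → ZFSet) (Us : Ordinal → ZFSet)
    (e : Ordinal → Ordinal → ZFSet → ZFSet),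
    Mod 0 = M ∧ cr 0 = κ ∧ Us 0 = U ∧
    (∀ β ≤ α, (Mod β).IsTransitive) ∧
    (∀ β ≤ α, ∀ x ∈ Mod β, e β β x = x) ∧
    (∀ β γ ρ : Ordinal, β ≤ γ → γ ≤ ρ → ρ ≤ α →
      ∀ x ∈ Mod β, e γ ρ (e β γ x) = e β ρ x) ∧
    (∀ β γ : Ordinal, β ≤ γ → γ ≤ α →
      (∀ x ∈ Mod β, e β γ x ∈ Mod γ) ∧
      ∀ (φ : Fml) (v : ℕ → ZFSet), (∀ n, v n ∈ Mod β) →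
        (Sat (Mod β).toSet φ v ↔ Sat (Mod γ).toSet φ (fun n => e β γ (v n)))) ∧
    (∀ β : Ordinal, β + 1 ≤ α →
      IsUltrapowerEmb (cr β) (Mod β) (Us β) (Mod (β + 1)) (e β (β + 1)) ∧
      cr (β + 1) = e β (β + 1) (cr β) ∧
      (∀ A, A ∈ Us (β + 1) ↔
        ∃ X ∈ (Mod β).toSet, X ∩ Us β ∈ Mod β ∧ A ∈ e β (β + 1) (X ∩ Us β))) ∧
    (∀ lam : Ordinal, lam ≤ α → lam ≠ 0 → (∀ β < lam, β + 1 < lam) →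
      (∀ x ∈ Mod lam, ∃ β < lam, ∃ y ∈ (Mod β).toSet, e β lam y = x) ∧
      cr lam = e 0 lam κ ∧
      (∀ A, A ∈ Us lam ↔ ∃ β < lam, ∃ B, B ∈ Us β ∧ e β lam B = A))

/-- `N ⊨ κ is α-iterable`: every `A ⊆ κ` in `N` belongs to a weak `κ`-model `M ∈ N` for
which there is a weakly amenable `α`-iterable `M`-ultrafilter `U ∈ N` on `κ`. -/
def AlphaIterableCardIn (N κ : ZFSet) (α : Ordinal) : Prop :=
  ∀ A ∈ N.toSet, A ⊆ κ →
    ∃ M ∈ N.toSet, A ∈ M ∧ IsTransModel M ∧ κ ∈ M ∧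
      (∃ f ∈ N.toSet, IsZFunc κ f ∧ SurjOnto f κ M) ∧
      ∃ U ∈ N.toSet, IsMUltrafilter κ M U ∧ WeaklyAmenable κ M U ∧
        IsAlphaIterable κ M U α

/-! ### Forcing -/

/-- `R` codes a partial order (of forcing conditions) on `P`: `pair p q ∈ R` means `p ≤ q`. -/
def IsPoset (P R : ZFSet) : Prop :=
  (∀ p ∈ R, ∃ a ∈ P, ∃ b ∈ P, p = ZFSet.pair a b) ∧
  (∀ p ∈ P, ZFSet.pair p p ∈ R) ∧
  (∀ p ∈ P, ∀ q ∈ P, ∀ r ∈ P,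
    ZFSet.pair p q ∈ R → ZFSet.pair q r ∈ R → ZFSet.pair p r ∈ R)

/-- `G` is an `ℳ`-generic filter on the poset `(P, R)`. -/
def IsGenericFilter (ℳ P R : ZFSet) (G : Set ZFSet) : Prop :=
  G ⊆ P.toSet ∧ G.Nonempty ∧
  (∀ p ∈ G, ∀ q ∈ G, ∃ r ∈ G, ZFSet.pair r p ∈ R ∧ ZFSet.pair r q ∈ R) ∧
  (∀ p ∈ G, ∀ q ∈ P.toSet, ZFSet.pair p q ∈ R → q ∈ G) ∧
  ∀ Dset ∈ ℳ.toSet, Dset ⊆ P →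
    (∀ p ∈ P.toSet, ∃ q ∈ Dset.toSet, ZFSet.pair q p ∈ R) →
    ∃ q ∈ G, q ∈ Dset

/-- `ℳ'` is the generic extension `ℳ[G]`: the least transitive ZFC⁻-model containing `ℳ`
and (a set coding) `G`, with the same ordinals as `ℳ`. -/
def IsGenericExt (ℳ ℳ' : ZFSet) (G : Set ZFSet) : Prop :=
  IsTransModel ℳ' ∧ ℳ ⊆ ℳ' ∧ (∃ g ∈ ℳ'.toSet, g.toSet = G) ∧
  SameOrdinals ℳ.toSet ℳ'.toSet ∧
  ∀ N', IsTransModel N' → ℳ ⊆ N' → (∃ g ∈ N'.toSet, g.toSet = G) → ℳ' ⊆ N'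

/-- `f ∈ D` is a cofinal map from `γ` into the ordinal `α`. -/
def CofinalMapIn (D : Set ZFSet) (γ α f : ZFSet) : Prop :=
  f ∈ D ∧ IsZFunc γ f ∧ MapsInto f γ α ∧
  ∀ b ∈ α, ∃ a ∈ γ, b ∈ fapp f a ∨ b = fapp f a

/-- `γ` is the cofinality of the ordinal `α` as computed in `D`. -/
def IsCofIn (D : Set ZFSet) (α γ : ZFSet) : Prop :=
  IsOrd γ ∧ (∃ f, CofinalMapIn D γ α f) ∧ ∀ γ' ∈ γ, ¬ ∃ f, CofinalMapIn D γ' α f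

/-- The pair `ℳ ⊆ ℳ'` preserves all cofinalities. -/
def PreservesCofinalities (ℳ ℳ' : ZFSet) : Prop :=
  ∀ α ∈ ℳ.toSet, IsOrd α → ∀ γ, (IsCofIn ℳ.toSet α γ ↔ IsCofIn ℳ'.toSet α γ)

/-! ### Formula engine -/
set_option linter.unusedSectionVars false
universe u

def Fml.rename (σ : ℕ → ℕ) : Fml → Fml
  | .mem i j => .mem (σ i) (σ j)
  | .eq i j => .eq (σ i) (σ j)
  | .impl φ ψ => .impl (φ.rename σ) (ψ.rename σ)
  | .neg φ => .neg (φ.rename σ)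
  | .all n φ => .all (σ n) (φ.rename σ)

theorem sat_rename (D : Set ZFSet.{u}) (σ : ℕ → ℕ) (hσ : Function.Injective σ) (φ : Fml) :
    ∀ v, Sat D (φ.rename σ) v ↔ Sat D φ (v ∘ σ) := by
  induction φ with
  | mem i j => intro v; exact Iff.rfl
  | eq i j => intro v; exact Iff.rfl
  | impl φ ψ h1 h2 => intro v; simp only [Fml.rename, Sat, h1, h2]
  | neg φ h => intro v; simp only [Fml.rename, Sat, h]
  | all n φ h =>
    intro v
    simp only [Fml.rename, Sat, h, Function.update_comp_eq_of_injective v hσ]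

theorem sat_support (φ : Fml) : ∃ m : ℕ, ∀ (D : Set ZFSet.{u}) (v w : ℕ → ZFSet.{u}),
    (∀ i < m, v i = w i) → (Sat D φ v ↔ Sat D φ w) := by
  induction φ with
  | mem i j =>
    refine ⟨i + j + 1, fun D v w h => ?_⟩
    simp only [Sat]; rw [h i (by omega), h j (by omega)]
  | eq i j =>
    refine ⟨i + j + 1, fun D v w h => ?_⟩
    simp only [Sat]; rw [h i (by omega), h j (by omega)]
  | impl φ ψ h1 h2 =>
    obtain ⟨m1, h1⟩ := h1
    obtain ⟨m2, h2⟩ := h2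
    refine ⟨m1 + m2, fun D v w h => ?_⟩
    simp only [Sat]
    rw [h1 D v w (fun i hi => h i (by omega)), h2 D v w (fun i hi => h i (by omega))]
  | neg φ h1 =>
    obtain ⟨m1, h1⟩ := h1
    refine ⟨m1, fun D v w h => ?_⟩
    simp only [Sat]
    rw [h1 D v w h]
  | all n φ h1 =>
    obtain ⟨m1, h1⟩ := h1
    refine ⟨m1, fun D v w h => ?_⟩
    simp only [Sat]
    refine forall₂_congr fun x hx => h1 _ _ _ fun i hi => ?_
    by_cases hin : i = n
    · subst hin; simp
    · simp [hin, h i hi]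

/-- Tarski–Vaught test. -/
theorem elemSub_of_tv {D E : Set ZFSet.{u}} (hDE : D ⊆ E)
    (tv : ∀ (φ : Fml) (v : ℕ → ZFSet), (∀ n, v n ∈ D) → ∀ n,
      (∃ x ∈ E, ¬ Sat E φ (Function.update v n x)) →
      ∃ x ∈ D, ¬ Sat E φ (Function.update v n x)) : ElemSub D E := by
  refine ⟨hDE, fun φ => ?_⟩
  induction φ with
  | mem i j => intro v hv; exact Iff.rfl
  | eq i j => intro v hv; exact Iff.rfl
  | impl φ ψ h1 h2 => intro v hv; simp only [Sat, h1 v hv, h2 v hv]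
  | neg φ h => intro v hv; simp only [Sat, h v hv]
  | all n φ h =>
    intro v hv
    have hu : ∀ x ∈ D, ∀ m, Function.update v n x m ∈ D := by
      intro x hx m
      by_cases hm : m = n
      · subst hm; simpa using hx
      · simpa [hm] using hv m
    simp only [Sat]
    constructor
    · intro H
      by_contra hc
      push Not at hc
      obtain ⟨x, hx, hxs⟩ := tv φ v hv n hc
      exact hxs ((h _ (hu x hx)).1 (H x hx))
    · intro H x hx
      exact (h _ (hu x hx)).2 (H x (hDE hx))

def mrg (v w : ℕ → ZFSet.{u}) : ℕ → ZFSet.{u} :=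
  fun n => if n % 2 = 0 then v (n / 2) else w (n / 2)

theorem mrg_even (v w : ℕ → ZFSet.{u}) (n : ℕ) : mrg v w (2 * n) = v n := by
  simp [mrg]

theorem mrg_odd (v w : ℕ → ZFSet.{u}) (n : ℕ) : mrg v w (2 * n + 1) = w n := by
  have h1 : (2 * n + 1) % 2 = 1 := by omega
  have h2 : (2 * n + 1) / 2 = n := by omega
  simp [mrg, h1, h2]

theorem mrg_ext {f : ℕ → ZFSet.{u}} {v w : ℕ → ZFSet.{u}} (h0 : ∀ n, f (2 * n) = v n)
    (h1 : ∀ n, f (2 * n + 1) = w n) : f = mrg v w := by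
  funext n
  rcases Nat.even_or_odd' n with ⟨k, rfl | rfl⟩
  · rw [h0, mrg_even]
  · rw [h1, mrg_odd]

/-- `cons x v` -/
def vcons (x : ZFSet.{u}) (v : ℕ → ZFSet.{u}) : ℕ → ZFSet.{u}
  | 0 => x
  | n + 1 => v n

class Ctx (𝒞 : Set (Set ZFSet.{u})) (C : Set ZFSet.{u}) : Prop where
  trans : ∀ D ∈ 𝒞, ∀ x ∈ D, ∀ y ∈ x, y ∈ D
  sub : ∀ D ∈ 𝒞, C ⊆ D
  ne : ∅ ∈ C

def Dfn (𝒞 : Set (Set ZFSet.{u})) (C : Set ZFSet.{u})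
    (P : Set ZFSet.{u} → (ℕ → ZFSet.{u}) → Prop) : Prop :=
  ∃ (φ : Fml) (w : ℕ → ZFSet.{u}), (∀ n, w n ∈ C) ∧
    ∀ D ∈ 𝒞, ∀ v : ℕ → ZFSet.{u}, (∀ n, v n ∈ D) → (P D v ↔ Sat D φ (mrg v w))

section engine
variable {𝒞 : Set (Set ZFSet.{u})} {C : Set ZFSet.{u}}

theorem Dfn.congr {P Q : Set ZFSet.{u} → (ℕ → ZFSet.{u}) → Prop} (hQ : Dfn 𝒞 C Q)
    (h : ∀ D ∈ 𝒞, ∀ v : ℕ → ZFSet.{u}, (∀ n, v n ∈ D) → (P D v ↔ Q D v)) : Dfn 𝒞 C P := by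
  obtain ⟨φ, w, hw, hφ⟩ := hQ
  exact ⟨φ, w, hw, fun D hD v hv => (h D hD v hv).trans (hφ D hD v hv)⟩

theorem Dfn.neg {P : Set ZFSet.{u} → (ℕ → ZFSet.{u}) → Prop} (hP : Dfn 𝒞 C P) :
    Dfn 𝒞 C (fun D v => ¬ P D v) := by
  obtain ⟨φ, w, hw, hφ⟩ := hP
  exact ⟨.neg φ, w, hw, fun D hD v hv => not_congr (hφ D hD v hv)⟩

theorem Dfn.imp {P Q : Set ZFSet.{u} → (ℕ → ZFSet.{u}) → Prop} (hP : Dfn 𝒞 C P)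
    (hQ : Dfn 𝒞 C Q) : Dfn 𝒞 C (fun D v => P D v → Q D v) := by
  obtain ⟨φ, w, hw, hφ⟩ := hP
  obtain ⟨ψ, z, hz, hψ⟩ := hQ
  let σ : ℕ → ℕ := fun n => if n % 2 = 0 then n else 2 * n - 1
  let τ : ℕ → ℕ := fun n => if n % 2 = 0 then n else 2 * n + 1
  have hσ : Function.Injective σ := by
    intro a b h; simp only [σ] at h; split_ifs at h <;> omega
  have hτ : Function.Injective τ := by
    intro a b h; simp only [τ] at h; split_ifs at h <;> omega
  refine ⟨.impl (φ.rename σ) (ψ.rename τ), mrg w z, fun n => ?_, fun D hD v hv => ?_⟩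
  · unfold mrg; split_ifs
    · exact hw _
    · exact hz _
  · simp only [Sat]
    rw [sat_rename _ _ hσ, sat_rename _ _ hτ, hφ D hD v hv, hψ D hD v hv]
    have e1 : mrg v (mrg w z) ∘ σ = mrg v w := by
      apply mrg_ext
      · intro n; simp [σ, mrg_even]
      · intro n
        have : σ (2 * n + 1) = 2 * (2 * n) + 1 := by simp only [σ]; split_ifs <;> omega
        simp only [Function.comp, this, mrg_odd, mrg_even]
    have e2 : mrg v (mrg w z) ∘ τ = mrg v z := by
      apply mrg_ext
      · intro n; simp [τ, mrg_even]
      · intro n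
        have : τ (2 * n + 1) = 2 * (2 * n + 1) + 1 := by simp only [τ]; split_ifs <;> omega
        simp only [Function.comp, this, mrg_odd]
    rw [e1, e2]

theorem Dfn.and {P Q : Set ZFSet.{u} → (ℕ → ZFSet.{u}) → Prop} (hP : Dfn 𝒞 C P)
    (hQ : Dfn 𝒞 C Q) : Dfn 𝒞 C (fun D v => P D v ∧ Q D v) :=
  (hP.imp hQ.neg).neg.congr fun D _ v _ => by tauto

theorem Dfn.or {P Q : Set ZFSet.{u} → (ℕ → ZFSet.{u}) → Prop} (hP : Dfn 𝒞 C P)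
    (hQ : Dfn 𝒞 C Q) : Dfn 𝒞 C (fun D v => P D v ∨ Q D v) :=
  (hP.neg.imp hQ).congr fun D _ v _ => by tauto

theorem Dfn.iff {P Q : Set ZFSet.{u} → (ℕ → ZFSet.{u}) → Prop} (hP : Dfn 𝒞 C P)
    (hQ : Dfn 𝒞 C Q) : Dfn 𝒞 C (fun D v => P D v ↔ Q D v) :=
  ((hP.imp hQ).and (hQ.imp hP)).congr fun D _ v _ => by tauto

theorem Dfn.all {P : Set ZFSet.{u} → (ℕ → ZFSet.{u}) → ZFSet.{u} → Prop}
    (hP : Dfn 𝒞 C (fun D v => P D (fun n => v (n + 1)) (v 0))) :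
    Dfn 𝒞 C (fun D v => ∀ x ∈ D, P D v x) := by
  obtain ⟨φ, w, hw, hφ⟩ := hP
  let σ : ℕ → ℕ := fun n => if n = 0 then 3 else if n % 2 = 0 then n - 2 else 2 * n - 1
  have hσ : Function.Injective σ := by
    intro a b h; simp only [σ] at h; split_ifs at h <;> omega
  refine ⟨.all 3 (φ.rename σ), mrg w w, fun n => ?_, fun D hD v hv => ?_⟩
  · unfold mrg; split_ifs <;> exact hw _
  · simp only [Sat]
    refine forall₂_congr fun x hx => ?_
    rw [sat_rename _ _ hσ]
    have e1 : Function.update (mrg v (mrg w w)) 3 x ∘ σ = mrg (vcons x v) w := by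
      apply mrg_ext
      · intro n
        rcases n with _ | n
        · simp [σ, vcons]
        · have : σ (2 * (n + 1)) = 2 * n := by
            change (if _ then _ else if _ then _ else _) = _
            rw [if_neg (by omega), if_pos (by omega)]; omega
          simp only [Function.comp, this, vcons]
          rw [Function.update_of_ne (by omega), mrg_even]
      · intro n
        have : σ (2 * n + 1) = 2 * (2 * n) + 1 := by
          change (if _ then _ else if _ then _ else _) = _
          rw [if_neg (by omega), if_neg (by omega)]; omega
        simp only [Function.comp, this]
        rw [Function.update_of_ne (by omega), mrg_odd, mrg_even]
    rw [e1]
    exact hφ D hD (vcons x v) (by rintro (_ | n); exacts [hx, hv n])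

theorem Dfn.ex {P : Set ZFSet.{u} → (ℕ → ZFSet.{u}) → ZFSet.{u} → Prop}
    (hP : Dfn 𝒞 C (fun D v => P D (fun n => v (n + 1)) (v 0))) :
    Dfn 𝒞 C (fun D v => ∃ x ∈ D, P D v x) :=
  (Dfn.all (P := fun D v x => ¬ P D v x) hP.neg).neg.congr fun D _ v _ => by push Not; rfl

theorem Dfn.reidx {P : Set ZFSet.{u} → (ℕ → ZFSet.{u}) → Prop} (hP : Dfn 𝒞 C P)
    (τ : ℕ → ℕ) (hτ : Function.Injective τ) : Dfn 𝒞 C (fun D v => P D (fun n => v (τ n))) := by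
  obtain ⟨φ, w, hw, hφ⟩ := hP
  let σ : ℕ → ℕ := fun n => if n % 2 = 0 then 2 * τ (n / 2) else n
  have hσ : Function.Injective σ := by
    intro a b h; simp only [σ] at h; split_ifs at h
    · have := @hτ (a / 2) (b / 2) (by omega)
      omega
    · omega
    · omega
    · omega
  refine ⟨φ.rename σ, w, hw, fun D hD v hv => ?_⟩
  rw [sat_rename _ _ hσ]
  refine (hφ D hD _ (fun n => hv _)).trans ?_
  have : mrg v w ∘ σ = mrg (fun n => v (τ n)) w := by
    apply mrg_ext
    · intro n; simp [σ, mrg_even]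
    · intro n
      have : σ (2 * n + 1) = 2 * n + 1 := by simp only [σ]; split_ifs <;> omega
      simp only [Function.comp, this, mrg_odd]
  rw [this]

def DTm (𝒞 : Set (Set ZFSet.{u})) (C : Set ZFSet.{u})
    (t : Set ZFSet.{u} → (ℕ → ZFSet.{u}) → ZFSet.{u}) : Prop :=
  Dfn 𝒞 C (fun D v => v 0 ∈ t D (fun n => v (n + 1))) ∧
    ∀ D ∈ 𝒞, ∀ v : ℕ → ZFSet.{u}, (∀ n, v n ∈ D) → ∀ x ∈ t D v, x ∈ D

theorem DTm.shift {t : Set ZFSet.{u} → (ℕ → ZFSet.{u}) → ZFSet.{u}} (h : DTm 𝒞 C t) :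
    DTm 𝒞 C (fun D v => t D (fun n => v (n + 1))) := by
  refine ⟨?_, fun D hD v hv => h.2 D hD _ (fun n => hv _)⟩
  exact h.1.reidx (fun n => if n = 0 then 0 else n + 1)
    (by intro a b h; simp only at h; split_ifs at h <;> omega)

variable [hc : Ctx 𝒞 C]

theorem Dfn.prop (p : Prop) : Dfn 𝒞 C (fun _ _ => p) := by
  have h0 : Dfn 𝒞 C (fun _ _ => True) :=
    ⟨.eq 0 0, fun _ => ∅, fun _ => hc.ne, fun D _ v _ => by simp [Sat]⟩
  by_cases h : p
  · simpa [h] using h0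
  · simpa [h] using h0.neg

theorem DTm.var (n : ℕ) : DTm 𝒞 C (fun _ v => v n) := by
  refine ⟨⟨.mem 0 (2 * (n + 1)), fun _ => ∅, fun _ => hc.ne, fun D _ v _ => ?_⟩,
    fun D hD v hv => hc.trans D hD _ (hv n)⟩
  simp only [Sat, mrg_even]
  rw [show (0 : ℕ) = 2 * 0 from rfl, mrg_even]

theorem DTm.const {c : ZFSet.{u}} (h : c ∈ C) : DTm 𝒞 C (fun _ _ => c) := by
  refine ⟨⟨.mem 0 (2 * 0 + 1), fun _ => c, fun _ => h, fun D _ v _ => ?_⟩,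
    fun D hD v hv => hc.trans D hD _ (hc.sub D hD h)⟩
  simp only [Sat, mrg_odd]
  rw [show (0 : ℕ) = 2 * 0 from rfl, mrg_even]

section terms
variable {s t t' t'' : Set ZFSet.{u} → (ℕ → ZFSet.{u}) → ZFSet.{u}}

theorem Dfn.eq (ht : DTm 𝒞 C t) (hs : DTm 𝒞 C s) : Dfn 𝒞 C (fun D v => t D v = s D v) := by
  refine (Dfn.all (P := fun D v x => x ∈ t D v ↔ x ∈ s D v) (ht.1.iff hs.1)).congr
    fun D hD v hv => ⟨fun h => by simp [h], fun h => ?_⟩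
  ext x
  exact ⟨fun hx => (h x (ht.2 D hD v hv x hx)).1 hx, fun hx => (h x (hs.2 D hD v hv x hx)).2 hx⟩

theorem Dfn.mem (ht : DTm 𝒞 C t) (hs : DTm 𝒞 C s) : Dfn 𝒞 C (fun D v => t D v ∈ s D v) := by
  refine (Dfn.ex (P := fun D v x => x = t D v ∧ x ∈ s D v)
    ((Dfn.eq (DTm.var 0) ht.shift).and hs.1)).congr
    fun D hD v hv => ⟨fun h => ⟨_, hs.2 D hD v hv _ h, rfl, h⟩, ?_⟩
  rintro ⟨x, _, rfl, h⟩; exact h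

theorem Dfn.ball {P : Set ZFSet.{u} → (ℕ → ZFSet.{u}) → ZFSet.{u} → Prop} (ht : DTm 𝒞 C t)
    (hP : Dfn 𝒞 C (fun D v => P D (fun n => v (n + 1)) (v 0))) :
    Dfn 𝒞 C (fun D v => ∀ x ∈ t D v, P D v x) :=
  (Dfn.all (P := fun D v x => x ∈ t D v → P D v x) (ht.1.imp hP)).congr
    fun D hD v hv => ⟨fun h x _ => h x, fun h x hx => h x (ht.2 D hD v hv x hx) hx⟩

theorem Dfn.bex {P : Set ZFSet.{u} → (ℕ → ZFSet.{u}) → ZFSet.{u} → Prop} (ht : DTm 𝒞 C t)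
    (hP : Dfn 𝒞 C (fun D v => P D (fun n => v (n + 1)) (v 0))) :
    Dfn 𝒞 C (fun D v => ∃ x ∈ t D v, P D v x) :=
  (Dfn.ex (P := fun D v x => x ∈ t D v ∧ P D v x) (ht.1.and hP)).congr
    fun D hD v hv => ⟨fun ⟨x, hx, h⟩ => ⟨x, ht.2 D hD v hv x hx, hx, h⟩,
      fun ⟨x, _, hx, h⟩ => ⟨x, hx, h⟩⟩

theorem Dfn.subset (ht : DTm 𝒞 C t) (hs : DTm 𝒞 C s) :
    Dfn 𝒞 C (fun D v => t D v ⊆ s D v) :=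
  (Dfn.ball (P := fun D v x => x ∈ s D v) ht hs.1).congr fun _ _ _ _ => Iff.rfl

theorem Dfn.eqUpair (hs : DTm 𝒞 C s) (ht : DTm 𝒞 C t) (ht' : DTm 𝒞 C t') :
    Dfn 𝒞 C (fun D v => s D v = {t D v, t' D v}) := by
  refine (((Dfn.mem ht hs).and (Dfn.mem ht' hs)).and
    (Dfn.ball (P := fun D v x => x = t D v ∨ x = t' D v) hs
      ((Dfn.eq (DTm.var 0) ht.shift).or (Dfn.eq (DTm.var 0) ht'.shift)))).congr
    fun D hD v hv => ?_
  constructor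
  · intro h; rw [h]; simp
  · rintro ⟨⟨h1, h2⟩, h3⟩
    ext x
    rw [ZFSet.mem_pair]
    exact ⟨h3 x, by rintro (rfl | rfl) <;> assumption⟩

theorem Dfn.eqPair (hs : DTm 𝒞 C s) (ht : DTm 𝒞 C t) (ht' : DTm 𝒞 C t') :
    Dfn 𝒞 C (fun D v => s D v = ZFSet.pair (t D v) (t' D v)) := by
  have A := (Dfn.eqUpair (DTm.var 0) ht.shift ht.shift)
  have B := (Dfn.eqUpair (DTm.var 0) ht.shift ht'.shift)
  refine (((Dfn.bex (P := fun D v x => x = {t D v, t D v}) hs A).and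
    (Dfn.bex (P := fun D v x => x = {t D v, t' D v}) hs B)).and
    (Dfn.ball (P := fun D v x => x = {t D v, t D v} ∨ x = {t D v, t' D v}) hs (A.or B))).congr
    fun D hD v hv => ?_
  have hp : ∀ a b : ZFSet.{u}, ZFSet.pair a b = {{a, a}, {a, b}} := by
    intro a b
    have : ({a, a} : ZFSet.{u}) = {a} := by ext x; simp
    rw [this]; rfl
  rw [hp]
  constructor
  · intro h; rw [h]; simp
  · rintro ⟨⟨⟨x, h1, rfl⟩, ⟨y, h2, rfl⟩⟩, h3⟩
    ext x
    rw [ZFSet.mem_pair]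
    exact ⟨h3 x, by rintro (rfl | rfl) <;> assumption⟩

theorem Dfn.memPair (ht : DTm 𝒞 C t) (ht' : DTm 𝒞 C t') (hs : DTm 𝒞 C s) :
    Dfn 𝒞 C (fun D v => ZFSet.pair (t D v) (t' D v) ∈ s D v) :=
  (Dfn.bex (P := fun D v x => x = ZFSet.pair (t D v) (t' D v)) hs
    (Dfn.eqPair (DTm.var 0) ht.shift ht'.shift)).congr
    fun D hD v hv => ⟨fun h => ⟨_, h, rfl⟩, by rintro ⟨x, h, rfl⟩; exact h⟩

theorem DTm.sUnion (ht : DTm 𝒞 C t) : DTm 𝒞 C (fun D v => (⋃₀ (t D v) : ZFSet.{u})) := by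
  refine ⟨?_, fun D hD v hv x hx => ?_⟩
  · refine (Dfn.bex (P := fun D v x => v 0 ∈ x) ht.shift (Dfn.mem (DTm.var 1) (DTm.var 0))).congr
      fun D hD v hv => ?_
    simp only [ZFSet.mem_sUnion]
  · rw [ZFSet.mem_sUnion] at hx
    obtain ⟨y, hy, hx⟩ := hx
    exact hc.trans D hD y (ht.2 D hD v hv y hy) x hx

theorem DTm.sep {P : Set ZFSet.{u} → (ℕ → ZFSet.{u}) → ZFSet.{u} → Prop} (ht : DTm 𝒞 C t)
    (hP : Dfn 𝒞 C (fun D v => P D (fun n => v (n + 1)) (v 0))) :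
    DTm 𝒞 C (fun D v => ZFSet.sep (fun x => P D v x) (t D v)) := by
  refine ⟨(ht.1.and hP).congr fun D hD v hv => by simp only [ZFSet.mem_sep], 
    fun D hD v hv x hx => ht.2 D hD v hv x (ZFSet.mem_sep.1 hx).1⟩

theorem DTm.inter (ht : DTm 𝒞 C t) (hs : DTm 𝒞 C s) : DTm 𝒞 C (fun D v => t D v ∩ s D v) := by
  refine ⟨(ht.1.and hs.1).congr fun D hD v hv => by simp only [ZFSet.mem_inter], 
    fun D hD v hv x hx => ht.2 D hD v hv x (ZFSet.mem_inter.1 hx).1⟩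

theorem DTm.union (ht : DTm 𝒞 C t) (hs : DTm 𝒞 C s) : DTm 𝒞 C (fun D v => t D v ∪ s D v) := by
  refine ⟨(ht.1.or hs.1).congr fun D hD v hv => by simp only [ZFSet.mem_union], 
    fun D hD v hv x hx => (ZFSet.mem_union.1 hx).elim (ht.2 D hD v hv x) (hs.2 D hD v hv x)⟩

theorem DTm.fapp (ht : DTm 𝒞 C t) (hs : DTm 𝒞 C s) :
    DTm 𝒞 C (fun D v => fapp (t D v) (s D v)) := by
  unfold MPaper.fapp
  exact DTm.sUnion (DTm.sep (P := fun D v b => ZFSet.pair (s D v) b ∈ t D v) ht.sUnion.sUnion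
    (Dfn.memPair hs.shift (DTm.var 0) ht.shift))

theorem DTm.dom : DTm 𝒞 C (fun _ _ => (∅ : ZFSet.{u})) := DTm.const hc.ne

end terms

theorem dtm_update {t : ℕ → Set ZFSet.{u} → (ℕ → ZFSet.{u}) → ZFSet.{u}}
    (ht : ∀ n, DTm 𝒞 C (t n)) (n : ℕ) (m : ℕ) :
    DTm 𝒞 C ((Function.update (fun k D v => t k D (fun i => v (i + 1))) n
      (fun _ v => v 0) : ℕ → Set ZFSet.{u} → (ℕ → ZFSet.{u}) → ZFSet.{u}) m) := by
  by_cases h : m = n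
  · subst h; simp only [Function.update_self]; exact DTm.var 0
  · simp only [Function.update_of_ne h]; exact (ht m).shift

theorem upd_eval (t : ℕ → Set ZFSet.{u} → (ℕ → ZFSet.{u}) → ZFSet.{u}) (n : ℕ)
    (D : Set ZFSet.{u}) (v : ℕ → ZFSet.{u}) :
    (fun m => (Function.update (fun k D v => t k D (fun i => v (i + 1))) n
      (fun _ v => v 0) : ℕ → Set ZFSet.{u} → (ℕ → ZFSet.{u}) → ZFSet.{u}) m D v) =
    Function.update (fun k => t k D (fun i => v (i + 1))) n (v 0) := by
  funext m
  by_cases h : m = n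
  · subst h; simp
  · simp [h]

theorem Dfn.sat (φ : Fml) : ∀ t : ℕ → Set ZFSet.{u} → (ℕ → ZFSet.{u}) → ZFSet.{u},
    (∀ n, DTm 𝒞 C (t n)) → Dfn 𝒞 C (fun D v => Sat D φ (fun n => t n D v)) := by
  induction φ with
  | mem i j => intro t ht; exact Dfn.mem (ht i) (ht j)
  | eq i j => intro t ht; exact Dfn.eq (ht i) (ht j)
  | impl φ ψ h1 h2 => intro t ht; exact (h1 t ht).imp (h2 t ht)
  | neg φ h => intro t ht; exact (h t ht).neg
  | all n φ h =>
    intro t ht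
    refine Dfn.all (P := fun D v x => Sat D φ (Function.update (fun n => t n D v) n x)) ?_
    refine (h _ (dtm_update ht n)).congr fun D hD v hv => ?_
    rw [upd_eval]

theorem Dfn.satIn {s : Set ZFSet.{u} → (ℕ → ZFSet.{u}) → ZFSet.{u}} (hs : DTm 𝒞 C s) (φ : Fml)
    {t : ℕ → Set ZFSet.{u} → (ℕ → ZFSet.{u}) → ZFSet.{u}}
    (ht : ∀ n, DTm 𝒞 C (t n)) : Dfn 𝒞 C (fun D v => Sat (s D v).toSet φ (fun n => t n D v)) := by
  induction φ generalizing s t with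
  | mem i j => exact Dfn.mem (ht i) (ht j)
  | eq i j => exact Dfn.eq (ht i) (ht j)
  | impl φ ψ h1 h2 => exact (h1 hs ht).imp (h2 hs ht)
  | neg φ h => exact (h hs ht).neg
  | all n φ h =>
    refine Dfn.ball
      (P := fun D v x => Sat (s D v).toSet φ (Function.update (fun n => t n D v) n x)) hs ?_
    refine (h hs.shift (dtm_update ht n)).congr fun D hD v hv => ?_
    rw [upd_eval]

theorem Dfn.subst {P : Set ZFSet.{u} → (ℕ → ZFSet.{u}) → Prop} (hP : Dfn 𝒞 C P)
    {t : ℕ → Set ZFSet.{u} → (ℕ → ZFSet.{u}) → ZFSet.{u}} (ht : ∀ n, DTm 𝒞 C (t n))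
    (hD : ∀ D ∈ 𝒞, ∀ v : ℕ → ZFSet.{u}, (∀ n, v n ∈ D) → ∀ n, t n D v ∈ D) :
    Dfn 𝒞 C (fun D v => P D (fun n => t n D v)) := by
  obtain ⟨φ, w, hw, hφ⟩ := hP
  refine (Dfn.sat φ (fun n => if n % 2 = 0 then t (n / 2) else fun _ _ => w (n / 2))
    (fun n => ?_)).congr fun D hD' v hv => ?_
  · split_ifs
    · exact ht _
    · exact DTm.const (hw _)
  · rw [hφ D hD' _ (hD D hD' v hv)]
    have : mrg (fun n => t n D v) w = (fun n => (if n % 2 = 0 then t (n / 2) else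
        fun _ _ => w (n / 2) : Set ZFSet.{u} → (ℕ → ZFSet.{u}) → ZFSet.{u}) D v) := by
      funext n; unfold mrg; split_ifs <;> rfl
    rw [this]

end engine

/-! ### Working inside a transitive model -/

class TM (M : ZFSet.{u}) : Prop where
  out : IsTransModel M

theorem empty_mem_omega : (∅ : ZFSet.{u}) ∈ ZFSet.omega := ZFSet.omega_zero

section inM
variable {M : ZFSet.{u}} [hM : TM M]

theorem M_trans {x y : ZFSet.{u}} (hx : x ∈ M) (hy : y ∈ x) : y ∈ M := hM.out.1 x hx hy

theorem M_omega : ZFSet.omega ∈ M := hM.out.2.1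

theorem M_empty : (∅ : ZFSet.{u}) ∈ M := M_trans M_omega empty_mem_omega

instance ctxM : Ctx {M.toSet} M.toSet where
  trans := by rintro D rfl x hx y hy; exact M_trans (M := M) hx hy
  sub := by rintro D rfl; exact subset_rfl
  ne := M_empty (M := M)

end inM

/-- Definability over `M` with parameters. -/
abbrev MD (M : ZFSet.{u}) (P : Set ZFSet.{u} → (ℕ → ZFSet.{u}) → Prop) : Prop :=
  Dfn {M.toSet} M.toSet P

/-- Definable class terms over `M` with parameters. -/
abbrev MT (M : ZFSet.{u}) (t : Set ZFSet.{u} → (ℕ → ZFSet.{u}) → ZFSet.{u}) : Prop :=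
  DTm {M.toSet} M.toSet t

theorem DTm.constM {M : ZFSet.{u}} [TM M] {c : ZFSet.{u}} (h : c ∈ M) :
    DTm {M.toSet} M.toSet (fun _ _ => c) := DTm.const h

theorem Dfn.exM {M : ZFSet.{u}} {P : Set ZFSet.{u} → (ℕ → ZFSet.{u}) → ZFSet.{u} → Prop}
    (hP : MD M (fun D v => P D (fun n => v (n + 1)) (v 0))) :
    MD M (fun D v => ∃ x ∈ M, P D v x) :=
  (Dfn.ex hP).congr (by rintro D rfl v hv; exact Iff.rfl)

theorem Dfn.allM {M : ZFSet.{u}} {P : Set ZFSet.{u} → (ℕ → ZFSet.{u}) → ZFSet.{u} → Prop}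
    (hP : MD M (fun D v => P D (fun n => v (n + 1)) (v 0))) :
    MD M (fun D v => ∀ x ∈ M, P D v x) :=
  (Dfn.all hP).congr (by rintro D rfl v hv; exact Iff.rfl)

theorem dfnAuto {p : Prop} (h : p := by
  repeat' first
    | assumption
    | exact DTm.dom
    | exact DTm.var _
    | exact DTm.constM (by assumption)
    | apply DTm.fapp
    | apply DTm.union
    | apply DTm.inter
    | apply DTm.sUnion
    | apply DTm.sep
    | exact Dfn.prop _
    | apply Dfn.exM
    | apply Dfn.allM
    | apply Dfn.bex
    | apply Dfn.ball
    | apply Dfn.and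
    | apply Dfn.or
    | apply Dfn.iff
    | apply Dfn.memPair
    | apply Dfn.eqPair
    | apply Dfn.mem
    | apply Dfn.eq
    | apply Dfn.subset
    | apply Dfn.neg
    | apply Dfn.imp) : p := h


theorem coe_toSet (x : ZFSet.{u}) : ∀ y, y ∈ x.toSet ↔ y ∈ x := fun _ => Iff.rfl

section inM
variable {M : ZFSet.{u}} [hM : TM M]

theorem M_upair {x y : ZFSet.{u}} (hx : x ∈ M) (hy : y ∈ M) : ({x, y} : ZFSet.{u}) ∈ M :=
  hM.out.2.2.1 x hx y hy

theorem M_sUnion {x : ZFSet.{u}} (hx : x ∈ M) : (⋃₀ x : ZFSet.{u}) ∈ M :=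
  hM.out.2.2.2.1 x hx

theorem M_single {x : ZFSet.{u}} (hx : x ∈ M) : ({x} : ZFSet.{u}) ∈ M := by
  have := M_upair hx hx
  rwa [show ({x, x} : ZFSet.{u}) = {x} by ext; simp] at this

theorem M_pair {x y : ZFSet.{u}} (hx : x ∈ M) (hy : y ∈ M) : ZFSet.pair x y ∈ M :=
  M_upair (M_single hx) (M_upair hx hy)

theorem M_union {x y : ZFSet.{u}} (hx : x ∈ M) (hy : y ∈ M) : x ∪ y ∈ M := by
  have := M_sUnion (M_upair hx hy)
  rwa [show (⋃₀ ({x, y} : ZFSet.{u}) : ZFSet.{u}) = x ∪ y by ext; simp [ZFSet.mem_union]] at this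

theorem M_of_pair {x y p : ZFSet.{u}} (hp : p ∈ M) (h : ZFSet.pair x y ∈ p) : x ∈ M ∧ y ∈ M := by
  have h1 := M_trans hp h
  have h2 : ({x, y} : ZFSet.{u}) ∈ M := M_trans h1 (by simp [ZFSet.pair])
  exact ⟨M_trans h2 (by simp), M_trans h2 (by simp)⟩

theorem M_of_pair' {x y : ZFSet.{u}} (hp : ZFSet.pair x y ∈ M) : x ∈ M ∧ y ∈ M := by
  have h2 : ({x, y} : ZFSet.{u}) ∈ M := M_trans hp (by simp [ZFSet.pair])
  exact ⟨M_trans h2 (by simp), M_trans h2 (by simp)⟩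

/-- Separation in `M`. -/
theorem M_sep {a : ZFSet.{u}} (ha : a ∈ M) {Q : ZFSet.{u} → Prop}
    (hQ : MD M (fun _ v => Q (v 0))) : ZFSet.sep Q a ∈ M := by
  obtain ⟨φ, w, hw, hφ⟩ := hQ
  obtain ⟨b, hb, h⟩ := hM.out.2.2.2.2.1 φ (mrg (fun _ => ∅) w)
    (by intro n; unfold mrg; split_ifs; exacts [M_empty, hw _]) a ha
  convert hb
  ext x
  rw [h, ZFSet.mem_sep]
  refine and_congr_right fun hx => ?_
  have hxM := M_trans ha hx
  refine (hφ M.toSet rfl (vcons x fun _ => ∅) ?_).trans ?_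
  · rintro (_ | n); exacts [hxM, M_empty (M := M)]
  · have : mrg (vcons x fun _ => ∅) w = Function.update (mrg (fun _ => ∅) w) 0 x := by
      symm; apply mrg_ext
      · rintro (_ | n)
        · simp [vcons]
        · rw [Function.update_of_ne (by omega), mrg_even]; rfl
      · intro n; rw [Function.update_of_ne (by omega), mrg_odd]
    rw [this]

theorem M_inter {x y : ZFSet.{u}} (hx : x ∈ M) (hy : y ∈ M) : x ∩ y ∈ M := by
  have := M_sep hx (Q := fun z => z ∈ y) dfnAuto
  rwa [show ZFSet.sep (fun z => z ∈ y) x = x ∩ y by ext; simp] at this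

theorem M_coll {a : ZFSet.{u}} (ha : a ∈ M) {Q : ZFSet.{u} → ZFSet.{u} → Prop}
    (hQ : MD M (fun _ v => Q (v 0) (v 1))) (h : ∀ x ∈ a, ∃ y ∈ M, Q x y) :
    ∃ b ∈ M, ∀ x ∈ a, ∃ y ∈ b, Q x y := by
  obtain ⟨φ, w, hw, hφ⟩ := hQ
  let σ : ℕ → ℕ := fun n => if n = 0 then 0 else if n = 2 then 1 else n + 10
  have hσ : Function.Injective σ := by
    intro a b h; simp only [σ] at h; split_ifs at h <;> omega
  let v0 : ℕ → ZFSet.{u} := fun n => mrg (fun _ => ∅) w (n - 10)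
  have key : ∀ x ∈ M, ∀ y ∈ M, (Q x y ↔
      Sat M.toSet (φ.rename σ) (Function.update (Function.update v0 0 x) 1 y)) := by
    intro x hx y hy
    rw [sat_rename _ _ hσ]
    refine (hφ M.toSet rfl (vcons x (vcons y fun _ => ∅)) ?_).trans ?_
    · rintro (_ | _ | n); exacts [hx, hy, M_empty (M := M)]
    · have : Function.update (Function.update v0 0 x) 1 y ∘ σ =
          mrg (vcons x (vcons y fun _ => ∅)) w := by
        apply mrg_ext
        · rintro (_ | _ | n)
          · simp [vcons, σ]
          · simp [vcons, σ]
          · have : σ (2 * (n + 1 + 1)) = 2 * (n + 2) + 10 := by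
              change (if _ then _ else if _ then _ else _) = _
              rw [if_neg (by omega), if_neg (by omega)]
            simp only [Function.comp, this]
            rw [Function.update_of_ne (by omega), Function.update_of_ne (by omega)]
            simp only [v0, Nat.add_sub_cancel, mrg_even]; rfl
        · intro n
          have : σ (2 * n + 1) = 2 * n + 1 + 10 := by
              change (if _ then _ else if _ then _ else _) = _
              rw [if_neg (by omega), if_neg (by omega)]
          simp only [Function.comp, this]
          rw [Function.update_of_ne (by omega), Function.update_of_ne (by omega)]
          simp only [v0, Nat.add_sub_cancel, mrg_odd]
      rw [this]
  obtain ⟨b, hb, H⟩ := hM.out.2.2.2.2.2.1 (φ.rename σ) v0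
    (by intro n; simp only [v0]; unfold mrg; split_ifs; exacts [M_empty, hw _]) a ha (by
      intro x hx
      obtain ⟨y, hy, hq⟩ := h x hx
      exact ⟨y, hy, (key x (M_trans ha hx) y hy).1 hq⟩)
  refine ⟨b, hb, fun x hx => ?_⟩
  obtain ⟨y, hy, hq⟩ := H x hx
  exact ⟨y, hy, (key x (M_trans ha hx) y (M_trans hb hy)).2 hq⟩

theorem Dfn.subst1 {Q : ZFSet.{u} → Prop} (hQ : MD M (fun _ v => Q (v 0)))
    {t : Set ZFSet.{u} → (ℕ → ZFSet.{u}) → ZFSet.{u}} (ht : MT M t)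
    (hD : ∀ v : ℕ → ZFSet.{u}, (∀ n, v n ∈ M) → t M.toSet v ∈ M) :
    MD M (fun D v => Q (t D v)) := by
  refine Dfn.subst hQ (t := fun n => if n = 0 then t else fun _ v => v 0) ?_ ?_
  · intro n; by_cases h0 : n = 0 <;> simp only [h0, if_true, if_false]; exacts [ht, DTm.var 0]
  · rintro D rfl v hv n; by_cases h0 : n = 0 <;> simp only [h0, if_true, if_false]; exacts [hD v hv, hv 0]

theorem Dfn.subst2 {Q : ZFSet.{u} → ZFSet.{u} → Prop} (hQ : MD M (fun _ v => Q (v 0) (v 1)))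
    {s t : Set ZFSet.{u} → (ℕ → ZFSet.{u}) → ZFSet.{u}} (hs : MT M s) (ht : MT M t)
    (hD : ∀ v : ℕ → ZFSet.{u}, (∀ n, v n ∈ M) → s M.toSet v ∈ M)
    (hD' : ∀ v : ℕ → ZFSet.{u}, (∀ n, v n ∈ M) → t M.toSet v ∈ M) :
    MD M (fun D v => Q (s D v) (t D v)) := by
  refine Dfn.subst hQ (t := fun n => if n = 0 then s else t) ?_ ?_
  · intro n; by_cases h0 : n = 0 <;> simp only [h0, if_true, if_false]; exacts [hs, ht]
  · rintro D rfl v hv n; by_cases h0 : n = 0 <;> simp only [h0, if_true, if_false]; exacts [hD v hv, hD' v hv]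

theorem Dfn.at1 {Q : ZFSet.{u} → Prop} (hQ : MD M (fun _ v => Q (v 0))) (n : ℕ) :
    MD M (fun _ v => Q (v n)) :=
  hQ.subst1 (t := fun _ v => v n) (DTm.var n) (fun v hv => hv n)

theorem Dfn.at2 {Q : ZFSet.{u} → ZFSet.{u} → Prop} (hQ : MD M (fun _ v => Q (v 0) (v 1)))
    (n m : ℕ) : MD M (fun _ v => Q (v n) (v m)) :=
  hQ.subst2 (s := fun _ v => v n) (t := fun _ v => v m) (DTm.var n) (DTm.var m)
    (fun v hv => hv n) (fun v hv => hv m)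

theorem Dfn.at2l {Q : ZFSet.{u} → ZFSet.{u} → Prop} (hQ : MD M (fun _ v => Q (v 0) (v 1)))
    {c : ZFSet.{u}} (hc : c ∈ M) (m : ℕ) : MD M (fun _ v => Q c (v m)) :=
  hQ.subst2 (s := fun _ v => c) (t := fun _ v => v m) (DTm.constM hc) (DTm.var m)
    (fun v hv => hc) (fun v hv => hv m)

theorem Dfn.at2r {Q : ZFSet.{u} → ZFSet.{u} → Prop} (hQ : MD M (fun _ v => Q (v 0) (v 1)))
    {c : ZFSet.{u}} (hc : c ∈ M) (m : ℕ) : MD M (fun _ v => Q (v m) c) :=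
  hQ.subst2 (t := fun _ v => c) (s := fun _ v => v m) (DTm.var m) (DTm.constM hc)
    (fun v hv => hv m) (fun v hv => hc)

/-- Replacement in `M`. -/
theorem M_image {a : ZFSet.{u}} (ha : a ∈ M) {Q : ZFSet.{u} → ZFSet.{u} → Prop}
    (F : ZFSet.{u} → ZFSet.{u}) (hF : ∀ x ∈ a, F x ∈ M)
    (hQ : MD M (fun _ v => Q (v 0) (v 1))) (h : ∀ x ∈ a, ∀ y ∈ M, (Q x y ↔ y = F x)) :
    ∃ b ∈ M, ∀ y, y ∈ b ↔ ∃ x ∈ a, y = F x := by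
  obtain ⟨b, hb, H⟩ := M_coll ha hQ (fun x hx => ⟨F x, hF x hx, (h x hx _ (hF x hx)).2 rfl⟩)
  have hq := hQ.at2 0 1
  refine ⟨ZFSet.sep (fun y => ∃ x ∈ a, Q x y) b, M_sep hb dfnAuto, fun y => ?_⟩
  rw [ZFSet.mem_sep]
  constructor
  · rintro ⟨h1, x, hx, hxy⟩
    exact ⟨x, hx, (h x hx y (M_trans hb h1)).1 hxy⟩
  · rintro ⟨x, hx, rfl⟩
    obtain ⟨y, hy, hxy⟩ := H x hx
    rw [(h x hx y (M_trans hb hy)).1 hxy] at hy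
    exact ⟨hy, x, hx, (h x hx _ (hF x hx)).2 rfl⟩

end inM

/-- The graph of `F` on `d`. -/
def zlam (d : ZFSet.{u}) (F : ZFSet.{u} → ZFSet.{u}) : ZFSet.{u} :=
  ZFSet.range (fun a : {a // a ∈ d} => ZFSet.pair a.1 (F a.1))

theorem mem_zlam {d : ZFSet.{u}} {F : ZFSet.{u} → ZFSet.{u}} {p : ZFSet.{u}} :
    p ∈ zlam d F ↔ ∃ a ∈ d, p = ZFSet.pair a (F a) := by
  unfold zlam
  rw [ZFSet.mem_range]
  constructor
  · rintro ⟨⟨a, ha⟩, rfl⟩; exact ⟨a, ha, rfl⟩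
  · rintro ⟨a, ha, rfl⟩; exact ⟨⟨a, ha⟩, rfl⟩

theorem pair_mem_zlam {d : ZFSet.{u}} {F : ZFSet.{u} → ZFSet.{u}} {a b : ZFSet.{u}} :
    ZFSet.pair a b ∈ zlam d F ↔ a ∈ d ∧ b = F a := by
  rw [mem_zlam]
  constructor
  · rintro ⟨a', ha, h⟩
    obtain ⟨rfl, rfl⟩ := ZFSet.pair_inj.1 h
    exact ⟨ha, rfl⟩
  · rintro ⟨ha, rfl⟩; exact ⟨a, ha, rfl⟩

theorem isZFunc_zlam (d : ZFSet.{u}) (F : ZFSet.{u} → ZFSet.{u}) : IsZFunc d (zlam d F) := by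
  refine ⟨fun p hp => ?_, fun a ha => ⟨F a, pair_mem_zlam.2 ⟨ha, rfl⟩, fun y hy => ?_⟩⟩
  · obtain ⟨a, ha, rfl⟩ := mem_zlam.1 hp
    exact ⟨a, ha, _, rfl⟩
  · exact (pair_mem_zlam.1 hy).2

theorem fapp_of_unique {f a b : ZFSet.{u}} (h : ZFSet.pair a b ∈ f)
    (hu : ∀ y, ZFSet.pair a y ∈ f → y = b) : fapp f a = b := by
  have : ZFSet.sep (fun b => ZFSet.pair a b ∈ f) (⋃₀ (⋃₀ f)) = {b} := by
    ext y
    rw [ZFSet.mem_sep, ZFSet.mem_singleton]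
    constructor
    · rintro ⟨_, h⟩; exact hu y h
    · rintro rfl
      refine ⟨?_, h⟩
      rw [ZFSet.mem_sUnion]
      exact ⟨{a, y}, ZFSet.mem_sUnion.2 ⟨_, h, by simp [ZFSet.pair]⟩, by simp⟩
  unfold fapp
  rw [this, ZFSet.sUnion_singleton]

theorem IsZFunc.fapp_eq_iff {d f a b : ZFSet.{u}} (hf : IsZFunc d f) (ha : a ∈ d) :
    fapp f a = b ↔ ZFSet.pair a b ∈ f := by
  obtain ⟨c, hc, hu⟩ := hf.2 a ha
  have h1 := fapp_of_unique hc hu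
  rw [h1]
  exact ⟨by rintro rfl; exact hc, fun h => (hu b h).symm⟩

theorem IsZFunc.pair_fapp {d f a : ZFSet.{u}} (hf : IsZFunc d f) (ha : a ∈ d) :
    ZFSet.pair a (fapp f a) ∈ f := (hf.fapp_eq_iff ha).1 rfl

theorem fapp_zlam {d : ZFSet.{u}} {F : ZFSet.{u} → ZFSet.{u}} {a : ZFSet.{u}} (ha : a ∈ d) :
    fapp (zlam d F) a = F a :=
  ((isZFunc_zlam d F).fapp_eq_iff ha).2 (pair_mem_zlam.2 ⟨ha, rfl⟩)

theorem IsZFunc.eq_zlam {d f : ZFSet.{u}} (hf : IsZFunc d f) : f = zlam d (fapp f) := by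
  ext p
  rw [mem_zlam]
  constructor
  · intro hp
    obtain ⟨a, ha, b, rfl⟩ := hf.1 p hp
    exact ⟨a, ha, by rw [(hf.fapp_eq_iff ha).2 hp]⟩
  · rintro ⟨a, ha, rfl⟩; exact hf.pair_fapp ha

theorem zfunc_ext {d f g : ZFSet.{u}} (hf : IsZFunc d f) (hg : IsZFunc d g)
    (h : ∀ a ∈ d, fapp f a = fapp g a) : f = g := by
  ext p
  rw [hf.eq_zlam, hg.eq_zlam, mem_zlam, mem_zlam]
  constructor <;> rintro ⟨a, ha, rfl⟩ <;> exact ⟨a, ha, by rw [h a ha]⟩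

section inM
variable {M : ZFSet.{u}} [hM : TM M]

theorem M_fapp {f a : ZFSet.{u}} (hf : f ∈ M) (ha : a ∈ M) : fapp f a ∈ M := by
  have h : MD M (fun _ v => ZFSet.pair a (v 0) ∈ f) := dfnAuto
  exact M_sUnion (M_sep (Q := fun b => ZFSet.pair a b ∈ f) (M_sUnion (M_sUnion hf)) h)

theorem M_lam {d : ZFSet.{u}} (hd : d ∈ M) {Q : ZFSet.{u} → ZFSet.{u} → Prop}
    {F : ZFSet.{u} → ZFSet.{u}} (hF : ∀ x ∈ d, F x ∈ M)
    (hQ : MD M (fun _ v => Q (v 0) (v 1))) (h : ∀ x ∈ d, ∀ y ∈ M, (Q x y ↔ y = F x)) :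
    zlam d F ∈ M := by
  obtain ⟨b, hb, H⟩ := M_image hd (fun x => ZFSet.pair x (F x))
    (fun x hx => M_pair (M_trans hd hx) (hF x hx))
    (Q := fun x p => ∃ y ∈ M, p = ZFSet.pair x y ∧ Q x y)
    (by
      have := hQ.at2 1 0
      exact dfnAuto)
    (by
      intro x hx p hp
      constructor
      · rintro ⟨y, hy, rfl, hq⟩; rw [(h x hx y hy).1 hq]
      · rintro rfl; exact ⟨F x, hF x hx, rfl, (h x hx _ (hF x hx)).2 rfl⟩)
  convert hb
  ext p
  rw [H, mem_zlam]

/-- Term-style version of `M_lam`. -/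
theorem M_lamt {d : ZFSet.{u}} (hd : d ∈ M) {F : ZFSet.{u} → ZFSet.{u}}
    (hF : ∀ x ∈ d, F x ∈ M) (hQ : MT M (fun _ v => F (v 1))) : zlam d F ∈ M :=
  M_lam hd (Q := fun x y => x ∈ d ∧ x = x ∧ y = F x) hF (by
    have h1 : MT M (fun _ v => F (v 0)) := by
      refine ⟨?_, fun D hD v hv => hQ.2 D hD (fun n => v (n - 1)) (fun n => hv _)⟩
      have h3 : MD M (fun _ v => v 0 ∈ F (v 2)) := hQ.1
      exact Dfn.subst h3 (t := fun n _ v => v (if n = 2 then 1 else 0)) (fun n => DTm.var _)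
        (fun D hD v hv n => hv _)
    have h2 := Dfn.eq (DTm.var 1) h1
    exact dfnAuto) (fun x hx y hy => by simp [hx])

theorem M_prod {a b : ZFSet.{u}} (ha : a ∈ M) (hb : b ∈ M) : a.prod b ∈ M := by
  have h1 : ∀ x ∈ a, zlam b (fun y => ZFSet.pair x y) ∈ M := by
    intro x hx
    have hx' := M_trans ha hx
    exact M_lam hb (Q := fun y p => p = ZFSet.pair x y) (fun y hy => M_pair hx' (M_trans hb hy))
      dfnAuto (fun _ _ _ _ => Iff.rfl)
  obtain ⟨c, hc, H⟩ := M_image ha (fun x => ZFSet.sep (fun p => ∃ y ∈ b, p = ZFSet.pair x y)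
      (a.prod b)) (Q := fun x z => (∀ p ∈ z, ∃ y ∈ b, p = ZFSet.pair x y) ∧
        ∀ y ∈ b, ∃ p ∈ z, p = ZFSet.pair x y)
    (by
      intro x hx
      have hx' := M_trans ha hx
      obtain ⟨c, hc, H⟩ := M_image hb (fun y => ZFSet.pair x y) (Q := fun y p => p = ZFSet.pair x y)
        (fun y hy => M_pair hx' (M_trans hb hy)) dfnAuto (fun _ _ _ _ => Iff.rfl)
      convert hc
      ext p
      rw [H, ZFSet.mem_sep]
      refine ⟨fun h => h.2, fun h => ⟨?_, h⟩⟩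
      obtain ⟨y, hy, rfl⟩ := h
      exact ZFSet.pair_mem_prod.2 ⟨hx, hy⟩)
    dfnAuto
    (by
      intro x hx z hz
      constructor
      · rintro ⟨h1, h2⟩
        ext p
        rw [ZFSet.mem_sep]
        constructor
        · intro hp
          obtain ⟨y, hy, rfl⟩ := h1 p hp
          exact ⟨ZFSet.pair_mem_prod.2 ⟨hx, hy⟩, y, hy, rfl⟩
        · rintro ⟨_, y, hy, rfl⟩
          obtain ⟨p, hp, rfl⟩ := h2 y hy
          exact hp
      · rintro rfl
        refine ⟨fun p hp => (ZFSet.mem_sep.1 hp).2, fun y hy => ⟨_, ?_, rfl⟩⟩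
        exact ZFSet.mem_sep.2 ⟨ZFSet.pair_mem_prod.2 ⟨hx, hy⟩, y, hy, rfl⟩)
  convert M_sUnion hc
  ext p
  rw [ZFSet.mem_sUnion]
  constructor
  · intro hp
    obtain ⟨x, hx, y, hy, rfl⟩ := ZFSet.mem_prod.1 hp
    exact ⟨_, (H _).2 ⟨x, hx, rfl⟩, ZFSet.mem_sep.2 ⟨hp, y, hy, rfl⟩⟩
  · rintro ⟨z, hz, hp⟩
    obtain ⟨x, hx, rfl⟩ := (H _).1 hz
    exact (ZFSet.mem_sep.1 hp).1

end inM

/-! ### Mostowski collapse inside `M` -/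

def MosPhi (M x r f : ZFSet.{u}) : Prop :=
  ∀ p ∈ f, ∃ a ∈ x, ∃ z ∈ M, p = ZFSet.pair a z ∧
    (∀ b ∈ x, ZFSet.pair b a ∈ r → ∃ y ∈ z, ZFSet.pair b y ∈ f) ∧
    (∀ y ∈ z, ∃ b ∈ x, ZFSet.pair b a ∈ r ∧ ZFSet.pair b y ∈ f)

section inM
variable {M : ZFSet.{u}} [hM : TM M]

theorem mosPhi_dfn {x r : ZFSet.{u}} (hx : x ∈ M) (hr : r ∈ M) :
    MD M (fun _ v => MosPhi M x r (v 0)) := by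
  unfold MosPhi
  exact dfnAuto

theorem mosPhi_val {x r f : ZFSet.{u}} {G : ZFSet.{u} → ZFSet.{u}}
    (hG : ∀ a ∈ x, ∀ z, z ∈ G a ↔ ∃ b ∈ x, ZFSet.pair b a ∈ r ∧ z = G b)
    (hf : MosPhi M x r f) : ∀ z a, ZFSet.pair a z ∈ f → a ∈ x ∧ z = G a := by
  intro z
  induction z using ZFSet.inductionOn with
  | _ z ih =>
  intro a haz
  obtain ⟨a', ha, z', hz', he, h1, h2⟩ := hf _ haz
  obtain ⟨rfl, rfl⟩ := ZFSet.pair_inj.1 he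
  refine ⟨ha, ?_⟩
  ext w
  rw [hG a ha]
  constructor
  · intro hw
    obtain ⟨b, hb, hba, hbw⟩ := h2 w hw
    exact ⟨b, hb, hba, (ih w hw b hbw).2⟩
  · rintro ⟨b, hb, hba, rfl⟩
    obtain ⟨y, hy, hby⟩ := h1 b hb hba
    rwa [← (ih y hy b hby).2]

theorem mosPhi_sUnion {x r B : ZFSet.{u}} (h : ∀ f ∈ B, MosPhi M x r f) :
    MosPhi M x r (⋃₀ B) := by
  intro p hp
  obtain ⟨f, hf, hpf⟩ := ZFSet.mem_sUnion.1 hp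
  obtain ⟨a, ha, z, hz, rfl, h1, h2⟩ := h f hf p hpf
  refine ⟨a, ha, z, hz, rfl, fun b hb hba => ?_, fun y hy => ?_⟩
  · obtain ⟨y, hy, hby⟩ := h1 b hb hba
    exact ⟨y, hy, ZFSet.mem_sUnion.2 ⟨f, hf, hby⟩⟩
  · obtain ⟨b, hb, hba, hby⟩ := h2 y hy
    exact ⟨b, hb, hba, ZFSet.mem_sUnion.2 ⟨f, hf, hby⟩⟩

/-- From local approximations to a common one. -/
theorem mosPhi_collect {x r : ZFSet.{u}} (hx : x ∈ M) (hr : r ∈ M) {G : ZFSet.{u} → ZFSet.{u}}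
    (hG : ∀ a ∈ x, ∀ z, z ∈ G a ↔ ∃ b ∈ x, ZFSet.pair b a ∈ r ∧ z = G b)
    {y : ZFSet.{u}} (hy : y ∈ M)
    (h : ∀ b ∈ y, ∃ f ∈ M, MosPhi M x r f ∧ ∃ z ∈ M, ZFSet.pair b z ∈ f) :
    ∃ F ∈ M, MosPhi M x r F ∧ ∀ b ∈ y, ZFSet.pair b (G b) ∈ F := by
  have hφ := mosPhi_dfn hx hr
  have hφ1 := hφ.at1 1
  obtain ⟨B, hB, H⟩ := M_coll hy (Q := fun b f => MosPhi M x r f ∧ ∃ z ∈ M, ZFSet.pair b z ∈ f)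
    dfnAuto h
  refine ⟨⋃₀ (ZFSet.sep (fun f => MosPhi M x r f) B), M_sUnion (M_sep hB hφ),
    mosPhi_sUnion fun f hf => (ZFSet.mem_sep.1 hf).2, fun b hb => ?_⟩
  obtain ⟨f, hf, h1, z, hz, hbz⟩ := H b hb
  rw [← (mosPhi_val hG h1 z b hbz).2]
  exact ZFSet.mem_sUnion.2 ⟨f, ZFSet.mem_sep.2 ⟨hf, h1⟩, hbz⟩

theorem mostowski {x r : ZFSet.{u}} (hx : x ∈ M) (hr : r ∈ M) {G : ZFSet.{u} → ZFSet.{u}}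
    (hG : ∀ a ∈ x, ∀ z, z ∈ G a ↔ ∃ b ∈ x, ZFSet.pair b a ∈ r ∧ z = G b) :
    zlam x G ∈ M := by
  have key : ∀ g : ZFSet.{u}, ∀ a ∈ x, G a = g →
      ∃ f ∈ M, MosPhi M x r f ∧ ∃ z ∈ M, ZFSet.pair a z ∈ f := by
    intro g
    induction g using ZFSet.inductionOn with
    | _ g ih =>
    rintro a ha rfl
    have haM := M_trans hx ha
    have hpred : ZFSet.sep (fun b => ZFSet.pair b a ∈ r) x ∈ M := M_sep hx dfnAuto
    obtain ⟨F, hF, hFφ, hFv⟩ := mosPhi_collect hx hr hG hpred (by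
      intro b hb
      obtain ⟨hb, hba⟩ := ZFSet.mem_sep.1 hb
      exact ih (G b) ((hG a ha _).2 ⟨b, hb, hba, rfl⟩) b hb rfl)
    have hz0 : ZFSet.sep (fun y => ∃ b ∈ x, ZFSet.pair b a ∈ r ∧ ZFSet.pair b y ∈ F) (⋃₀ (⋃₀ F))
        ∈ M := M_sep (M_sUnion (M_sUnion hF)) dfnAuto
    have hz : G a ∈ M := by
      convert hz0
      ext w
      rw [ZFSet.mem_sep, hG a ha]
      constructor
      · rintro ⟨b, hb, hba, rfl⟩
        have := hFv b (ZFSet.mem_sep.2 ⟨hb, hba⟩)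
        refine ⟨?_, b, hb, hba, this⟩
        exact ZFSet.mem_sUnion.2 ⟨{b, G b}, ZFSet.mem_sUnion.2 ⟨_, this, by simp [ZFSet.pair]⟩,
          by simp⟩
      · rintro ⟨_, b, hb, hba, h⟩
        exact ⟨b, hb, hba, (mosPhi_val hG hFφ _ _ h).2⟩
    refine ⟨F ∪ {ZFSet.pair a (G a)}, M_union hF (M_single (M_pair haM hz)), ?_, G a, hz,
      by simp [ZFSet.mem_union]⟩
    intro p hp
    rcases ZFSet.mem_union.1 hp with hp | hp
    · obtain ⟨a, ha, z, hz, rfl, h1, h2⟩ := hFφ p hp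
      refine ⟨a, ha, z, hz, rfl, fun b hb hba => ?_, fun y hy => ?_⟩
      · obtain ⟨y, hy, hby⟩ := h1 b hb hba
        exact ⟨y, hy, ZFSet.mem_union.2 (Or.inl hby)⟩
      · obtain ⟨b, hb, hba, hby⟩ := h2 y hy
        exact ⟨b, hb, hba, ZFSet.mem_union.2 (Or.inl hby)⟩
    · rw [ZFSet.mem_singleton] at hp
      subst hp
      refine ⟨a, ha, G a, hz, rfl, fun b hb hba => ?_, fun y hy => ?_⟩
      · exact ⟨G b, (hG a ha _).2 ⟨b, hb, hba, rfl⟩,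
          ZFSet.mem_union.2 (Or.inl (hFv b (ZFSet.mem_sep.2 ⟨hb, hba⟩)))⟩
      · obtain ⟨b, hb, hba, rfl⟩ := (hG a ha _).1 hy
        exact ⟨b, hb, hba, ZFSet.mem_union.2 (Or.inl (hFv b (ZFSet.mem_sep.2 ⟨hb, hba⟩)))⟩
  obtain ⟨F, hF, hFφ, hFv⟩ := mosPhi_collect hx hr hG hx (fun a ha => key _ a ha rfl)
  convert hF
  ext p
  rw [mem_zlam]
  constructor
  · rintro ⟨a, ha, rfl⟩; exact hFv a ha
  · intro hp
    obtain ⟨a, ha, z, hz, rfl, _⟩ := hFφ p hp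
    exact ⟨a, ha, by rw [(mosPhi_val hG hFφ _ _ hp).2]⟩

end inM

/-! ### Cardinality utilities -/

theorem zcard_eq (x : ZFSet.{u}) : zcard x = Cardinal.mk {y // y ∈ x} := rfl

theorem zcard_le_of_inj {x y : ZFSet.{u}} (f : ZFSet.{u} → ZFSet.{u}) (hf : ∀ a ∈ x, f a ∈ y)
    (hi : ∀ a ∈ x, ∀ b ∈ x, f a = f b → a = b) : zcard x ≤ zcard y := by
  rw [zcard_eq, zcard_eq]
  refine Cardinal.mk_le_of_injective (f := fun a => ⟨f a.1, hf a.1 a.2⟩) ?_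
  rintro ⟨a, ha⟩ ⟨b, hb⟩ h
  exact Subtype.ext (hi a ha b hb (Subtype.ext_iff.1 h))

theorem zcard_mono {x y : ZFSet.{u}} (h : x ⊆ y) : zcard x ≤ zcard y :=
  zcard_le_of_inj id (fun _ ha => h ha) (fun _ _ _ _ h => h)

theorem zcard_le_of_surj {x y : ZFSet.{u}} (f : ZFSet.{u} → ZFSet.{u})
    (hf : ∀ b ∈ y, ∃ a ∈ x, f a = b) : zcard y ≤ zcard x := by
  choose! g hg using hf
  refine zcard_le_of_inj g (fun b hb => (hg b hb).1) (fun a ha b hb h => ?_)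
  rw [← (hg a ha).2, ← (hg b hb).2, h]

theorem exists_surj {x y : ZFSet.{u}} (hy : y.Nonempty) (h : zcard y ≤ zcard x) :
    ∃ e : ZFSet.{u} → ZFSet.{u}, (∀ a ∈ x, e a ∈ y) ∧ ∀ b ∈ y, ∃ a ∈ x, e a = b := by
  obtain ⟨y0, hy0⟩ := hy
  rw [zcard_eq, zcard_eq] at h
  obtain ⟨i⟩ := h
  refine ⟨fun a => if h : ∃ b : {b // b ∈ y}, (i b).1 = a then h.choose.1 else y0, ?_, ?_⟩
  · intro a ha
    dsimp only
    split_ifs with h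
    · exact h.choose.2
    · exact hy0
  · intro b hb
    refine ⟨(i ⟨b, hb⟩).1, (i ⟨b, hb⟩).2, ?_⟩
    have h : ∃ b' : {b // b ∈ y}, (i b').1 = (i ⟨b, hb⟩).1 := ⟨_, rfl⟩
    refine (dif_pos h).trans ?_
    have := i.injective (Subtype.ext h.choose_spec)
    rw [this]

theorem exists_bij {x y : ZFSet.{u}} (h : zcard y = zcard x) :
    ∃ e : ZFSet.{u} → ZFSet.{u}, (∀ a ∈ x, e a ∈ y) ∧ (∀ b ∈ y, ∃ a ∈ x, e a = b) ∧
      ∀ a ∈ x, ∀ b ∈ x, e a = e b → a = b := by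
  rw [zcard_eq, zcard_eq, Cardinal.eq] at h
  obtain ⟨i⟩ := h
  refine ⟨fun a => if h : a ∈ x then (i.symm ⟨a, h⟩).1 else ∅, ?_, ?_, ?_⟩
  · intro a ha; simp only [ha, dif_pos]; exact (i.symm _).2
  · intro b hb
    refine ⟨(i ⟨b, hb⟩).1, (i ⟨b, hb⟩).2, ?_⟩
    simp
  · intro a ha b hb h
    simp only [ha, hb, dif_pos] at h
    have := i.symm.injective (Subtype.ext h)
    exact Subtype.ext_iff.1 this

/-- external image -/
def zimg (d : ZFSet.{u}) (F : ZFSet.{u} → ZFSet.{u}) : ZFSet.{u} :=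
  ZFSet.range (fun a : {a // a ∈ d} => F a.1)

theorem mem_zimg {d : ZFSet.{u}} {F : ZFSet.{u} → ZFSet.{u}} {y : ZFSet.{u}} :
    y ∈ zimg d F ↔ ∃ a ∈ d, F a = y := by
  unfold zimg
  rw [ZFSet.mem_range]
  constructor
  · rintro ⟨⟨a, ha⟩, rfl⟩; exact ⟨a, ha, rfl⟩
  · rintro ⟨a, ha, rfl⟩; exact ⟨⟨a, ha⟩, rfl⟩

theorem zcard_zimg_le (d : ZFSet.{u}) (F : ZFSet.{u} → ZFSet.{u}) : zcard (zimg d F) ≤ zcard d :=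
  zcard_le_of_surj F (fun _ hb => mem_zimg.1 hb)

theorem zcard_prod (x y : ZFSet.{u}) : zcard (x.prod y) ≤ zcard x * zcard y := by
  simp only [zcard_eq, ← Cardinal.mk_prod, Cardinal.lift_id]
  have h : ∀ p : {p // p ∈ x.prod y}, ∃ q : {a // a ∈ x} × {b // b ∈ y},
      p.1 = ZFSet.pair q.1.1 q.2.1 := by
    rintro ⟨p, hp⟩
    obtain ⟨a, ha, b, hb, rfl⟩ := ZFSet.mem_prod.1 hp
    exact ⟨⟨⟨a, ha⟩, ⟨b, hb⟩⟩, rfl⟩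
  choose f hf using h
  refine Cardinal.mk_le_of_injective (f := f) fun p q hpq => Subtype.ext ?_
  rw [hf p, hf q, hpq]

theorem zcard_union (x y : ZFSet.{u}) : zcard (x ∪ y) ≤ zcard x + zcard y := by
  have : (x ∪ y).toSet = x.toSet ∪ y.toSet := by
    ext z; exact ZFSet.mem_union
  unfold zcard
  rw [this]
  exact Cardinal.mk_union_le _ _

theorem zcard_sUnion {x : ZFSet.{u}} {c : Cardinal.{u+1}} (hx : zcard x ≤ c)
    (h : ∀ y ∈ x, zcard y ≤ c) : zcard (⋃₀ x : ZFSet.{u}) ≤ c * c := by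
  have : (⋃₀ x : ZFSet.{u}).toSet = ⋃ y : x.toSet, y.1.toSet := by
    ext z
    simp only [Set.mem_iUnion]
    refine (ZFSet.mem_sUnion).trans ?_
    exact ⟨fun ⟨y, hy, hz⟩ => ⟨⟨y, hy⟩, hz⟩, fun ⟨y, hz⟩ => ⟨y.1, y.2, hz⟩⟩
  unfold zcard
  rw [this]
  refine (Cardinal.mk_iUnion_le _).trans ?_
  refine mul_le_mul' hx (ciSup_le' fun y => h y.1 y.2)

theorem zcard_single (x : ZFSet.{u}) : zcard {x} = 1 := by
  have : ({x} : ZFSet.{u}).toSet = {x} := by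
    ext z; exact ZFSet.mem_singleton
  unfold zcard
  rw [this]; simp

theorem insert_eq_union (x y : ZFSet.{u}) : insert x y = y ∪ {x} := by
  ext; simp [ZFSet.mem_union, or_comm]

theorem zcard_insert (x y : ZFSet.{u}) : zcard (insert x y) ≤ zcard y + 1 := by
  rw [insert_eq_union, ← zcard_single x]; exact zcard_union _ _

/-! ### omega -/

theorem mem_omega_iff {x : ZFSet.{u}} :
    x ∈ ZFSet.omega.{u} ↔ ∃ n : ℕ, x = (n : Ordinal.{u}).toZFSet := by
  have h0 : ∀ n : ℕ, ZFSet.mk (PSet.ofNat.{u} n) = (n : Ordinal.{u}).toZFSet := by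
    intro n
    induction n with
    | zero => simp [PSet.ofNat]; rfl
    | succ n ih =>
      rw [Nat.cast_succ, Ordinal.toZFSet_add_one, ← ih]; rfl
  induction x using Quotient.inductionOn with
  | _ x =>
  constructor
  · rintro ⟨⟨n⟩, hn⟩
    exact ⟨n, by rw [← h0]; exact Quotient.sound hn⟩
  · rintro ⟨n, hn⟩
    rw [← h0] at hn
    exact ⟨⟨n⟩, Quotient.exact hn⟩

theorem omega_eq : ZFSet.omega.{u} = Ordinal.omega0.{u}.toZFSet := by
  ext x
  rw [mem_omega_iff, Ordinal.mem_toZFSet_iff]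
  constructor
  · rintro ⟨n, rfl⟩; exact ⟨n, Ordinal.nat_lt_omega0 n, rfl⟩
  · rintro ⟨a, ha, rfl⟩
    obtain ⟨n, rfl⟩ := Ordinal.lt_omega0.1 ha
    exact ⟨n, rfl⟩

theorem omega_ord : ZFSet.IsOrdinal ZFSet.omega.{u} := by
  rw [omega_eq]; exact ZFSet.isOrdinal_toZFSet _

theorem zcard_omega : zcard ZFSet.omega.{u} = Cardinal.aleph0 := by
  have : ZFSet.omega.{u}.toSet = Set.range (fun n : ℕ => (n : Ordinal.{u}).toZFSet) := by
    ext x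
    refine mem_omega_iff.trans ?_
    simp [eq_comm]
  unfold zcard
  rw [this]
  have := Cardinal.mk_range_eq_of_injective (f := fun n : ℕ => (n : Ordinal.{u}).toZFSet) (by
    intro a b h
    have := Ordinal.toZFSet_injective h
    exact_mod_cast this)
  simpa using this

theorem isOrd_iff {x : ZFSet.{u}} : IsOrd x ↔ x.IsOrdinal :=
  ZFSet.isOrdinal_iff_forall_mem_isTransitive.symm

/-! ### External collapse -/

def coll (x : ZFSet.{u}) (R : ZFSet.{u} → ZFSet.{u} → Prop) (hwf : WellFounded R) :
    ZFSet.{u} → ZFSet.{u} :=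
  hwf.fix (fun a ih => ZFSet.range
    (fun b : {b // b ∈ ZFSet.sep (fun b => R b a) x} => ih b.1 (ZFSet.mem_sep.1 b.2).2))

theorem mem_coll {x : ZFSet.{u}} {R : ZFSet.{u} → ZFSet.{u} → Prop} {hwf : WellFounded R}
    {a z : ZFSet.{u}} : z ∈ coll x R hwf a ↔ ∃ b ∈ x, R b a ∧ z = coll x R hwf b := by
  conv_lhs => rw [coll, WellFounded.fix_eq]
  rw [ZFSet.mem_range]
  constructor
  · rintro ⟨⟨b, hb⟩, rfl⟩
    exact ⟨b, (ZFSet.mem_sep.1 hb).1, (ZFSet.mem_sep.1 hb).2, rfl⟩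
  · rintro ⟨b, hb, hR, rfl⟩
    exact ⟨⟨b, ZFSet.mem_sep.2 ⟨hb, hR⟩⟩, rfl⟩

/-! ### Good models, cardinal facts -/

structure Good (κ M U : ZFSet.{u}) : Prop where
  wm : IsWeakModel κ M
  uf : IsMUltrafilter κ M U
  wa : WeaklyAmenable κ M U
  oi : OmegaOneIntersecting U

section good
variable {κ M U : ZFSet.{u}}

theorem Good.inf (h : Good κ M U) : Cardinal.aleph0 ≤ zcard κ := by
  rw [← h.wm.2.2, ← zcard_omega]
  exact zcard_mono (h.wm.1.1 _ h.wm.1.2.1)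

theorem card_succ (hC : IsCard κ) (hi : Cardinal.aleph0 ≤ zcard κ) {α : ZFSet.{u}} (h : α ∈ κ) :
    insert α α ∈ κ := by
  have hκ := isOrd_iff.1 hC.1
  have hα := hκ.mem h
  rcases (isOrdinal_succ hα).mem_trichotomous hκ with h1 | h1 | h1
  · exact h1
  · exfalso
    have h2 := hC.2 α h
    have h3 := zcard_insert α α
    rw [h1] at h3
    have h4 : Cardinal.aleph0 ≤ zcard α := by
      by_contra h5
      push Not at h5
      have := Cardinal.add_lt_aleph0 h5 Cardinal.one_lt_aleph0
      exact absurd (hi.trans h3) (not_le.2 this)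
    rw [Cardinal.add_one_eq h4] at h3
    exact absurd h3 (not_le.2 h2)
  · exfalso
    rcases mem_insert_iff.1 h1 with rfl | h2
    · exact ZFSet.mem_irrefl _ h
    · exact ZFSet.mem_asymm h h2

theorem mem_of_zcard_lt (hC : IsCard κ) {x : ZFSet.{u}} (hx : x.IsOrdinal)
    (h : zcard x < zcard κ) : x ∈ κ := by
  have hκ := isOrd_iff.1 hC.1
  rcases hx.mem_trichotomous hκ with h1 | h1 | h1
  · exact h1
  · subst h1; exact absurd h (lt_irrefl _)
  · exact absurd h (not_lt.2 (zcard_mono (hx.subset_of_mem h1)))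

theorem Good.unc (hC : IsCard κ) (h : Good κ M U) : Cardinal.aleph0 < zcard κ := by
  refine lt_of_le_of_ne h.inf fun he => ?_
  obtain ⟨e, he1, he2⟩ := exists_surj (x := ZFSet.omega) (y := κ) (by
    by_contra hn
    rw [ZFSet.nonempty_def] at hn
    push Not at hn
    have h0 : zcard κ = 0 := by
      rw [zcard_eq, Cardinal.mk_eq_zero_iff]; exact ⟨fun a => hn a.1 a.2⟩
    rw [h0] at he
    exact Cardinal.aleph0_ne_zero he) (by rw [← he, zcard_omega])
  obtain ⟨x, hx⟩ := h.oi (fun n => tailSet κ (insert (e (n : Ordinal.{u}).toZFSet)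
    (e (n : Ordinal.{u}).toZFSet))) (fun n => h.uf.2.1 _ (card_succ hC h.inf
      (he1 _ (mem_omega_iff.2 ⟨n, rfl⟩))))
  obtain ⟨a, ha, hax⟩ := he2 x (ZFSet.mem_sep.1 (hx 0)).1
  obtain ⟨n, rfl⟩ := mem_omega_iff.1 ha
  exact (ZFSet.mem_sep.1 (hx n)).2 (by rw [hax]; exact ZFSet.mem_insert _ _)

theorem Good.omega_mem (hC : IsCard κ) (h : Good κ M U) : ZFSet.omega ∈ κ :=
  mem_of_zcard_lt hC omega_ord (by rw [zcard_omega]; exact h.unc hC)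

theorem Good.tm (h : Good κ M U) : TM M := ⟨h.wm.1⟩

end good

/-! ### Gödel pairing -/

def pfst (p : ZFSet.{u}) : ZFSet.{u} := Classical.epsilon (fun a => ∃ b, p = ZFSet.pair a b)
def psnd (p : ZFSet.{u}) : ZFSet.{u} := Classical.epsilon (fun b => ∃ a, p = ZFSet.pair a b)

theorem pfst_pair (a b : ZFSet.{u}) : pfst (ZFSet.pair a b) = a := by
  obtain ⟨b', h⟩ := Classical.epsilon_spec
    (p := fun a' => ∃ b', ZFSet.pair a b = ZFSet.pair a' b') ⟨a, b, rfl⟩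
  exact (ZFSet.pair_inj.1 h).1.symm

theorem psnd_pair (a b : ZFSet.{u}) : psnd (ZFSet.pair a b) = b := by
  obtain ⟨b', h⟩ := Classical.epsilon_spec
    (p := fun b' => ∃ a', ZFSet.pair a b = ZFSet.pair a' b') ⟨b, a, rfl⟩
  exact (ZFSet.pair_inj.1 h).2.symm

def gdR (p q : ZFSet.{u}) : Prop :=
  Prod.Lex (· ∈ ·) (Prod.Lex (· ∈ ·) (· ∈ ·))
    (pfst p ∪ psnd p, pfst p, psnd p) (pfst q ∪ psnd q, pfst q, psnd q)

theorem gdR_wf : WellFounded gdR.{u} :=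
  InvImage.wf (fun p => (pfst p ∪ psnd p, pfst p, psnd p))
    (WellFounded.prod_lex ZFSet.mem_wf (WellFounded.prod_lex ZFSet.mem_wf ZFSet.mem_wf))

theorem gdR_pair {a b c d : ZFSet.{u}} : gdR (ZFSet.pair a b) (ZFSet.pair c d) ↔
    a ∪ b ∈ c ∪ d ∨ (a ∪ b = c ∪ d ∧ (a ∈ c ∨ a = c ∧ b ∈ d)) := by
  unfold gdR
  simp only [pfst_pair, psnd_pair, Prod.lex_iff]

def gdG (κ : ZFSet.{u}) : ZFSet.{u} → ZFSet.{u} := coll (κ.prod κ) gdR gdR_wf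

theorem union_ord {a b : ZFSet.{u}} (ha : a.IsOrdinal) (hb : b.IsOrdinal) : (a ∪ b).IsOrdinal := by
  rcases ha.subset_total hb with h | h
  · rwa [show a ∪ b = b by ext z; rw [ZFSet.mem_union]; exact ⟨fun h' => h'.elim (fun x => h x) id, Or.inr⟩]
  · rwa [show a ∪ b = a by ext z; rw [ZFSet.mem_union]; exact ⟨fun h' => h'.elim id (fun x => h x), Or.inl⟩]

theorem union_mem {κ a b : ZFSet.{u}} (hκ : κ.IsOrdinal) (ha' : a ∈ κ) (hb' : b ∈ κ) : a ∪ b ∈ κ := by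
  have ha := hκ.mem ha'
  have hb := hκ.mem hb'
  rcases ha.subset_total hb with h | h
  · rwa [show a ∪ b = b by ext z; rw [ZFSet.mem_union]; exact ⟨fun h' => h'.elim (fun x => h x) id, Or.inr⟩]
  · rwa [show a ∪ b = a by ext z; rw [ZFSet.mem_union]; exact ⟨fun h' => h'.elim id (fun x => h x), Or.inl⟩]

section godel
variable {κ : ZFSet.{u}}

theorem gdR_tri (hκ : κ.IsOrdinal) {p q : ZFSet.{u}} (hp : p ∈ κ.prod κ) (hq : q ∈ κ.prod κ) :
    p = q ∨ gdR p q ∨ gdR q p := by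
  obtain ⟨a, ha, b, hb, rfl⟩ := ZFSet.mem_prod.1 hp
  obtain ⟨c, hc, d, hd, rfl⟩ := ZFSet.mem_prod.1 hq
  have ha := hκ.mem ha
  have hb := hκ.mem hb
  have hc := hκ.mem hc
  have hd := hκ.mem hd
  simp only [gdR_pair]
  rcases (union_ord ha hb).mem_trichotomous (union_ord hc hd) with h | h | h
  · exact Or.inr (Or.inl (Or.inl h))
  · rcases ha.mem_trichotomous hc with h' | h' | h'
    · exact Or.inr (Or.inl (Or.inr ⟨h, Or.inl h'⟩))
    · rcases hb.mem_trichotomous hd with h2 | h2 | h2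
      · exact Or.inr (Or.inl (Or.inr ⟨h, Or.inr ⟨h', h2⟩⟩))
      · left; rw [h', h2]
      · exact Or.inr (Or.inr (Or.inr ⟨h.symm, Or.inr ⟨h'.symm, h2⟩⟩))
    · exact Or.inr (Or.inr (Or.inr ⟨h.symm, Or.inl h'⟩))
  · exact Or.inr (Or.inr (Or.inl h))

theorem gdR_trans (hκ : κ.IsOrdinal) {p q r : ZFSet.{u}} (hp : p ∈ κ.prod κ) (hq : q ∈ κ.prod κ)
    (hr : r ∈ κ.prod κ) (h1 : gdR p q) (h2 : gdR q r) : gdR p r := by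
  obtain ⟨a, ha, b, hb, rfl⟩ := ZFSet.mem_prod.1 hp
  obtain ⟨c, hc, d, hd, rfl⟩ := ZFSet.mem_prod.1 hq
  obtain ⟨e, he, f, hf, rfl⟩ := ZFSet.mem_prod.1 hr
  have he := hκ.mem he
  have hf := hκ.mem hf
  have t1 : ∀ {x y}, x ∈ y → y ∈ e ∪ f → x ∈ e ∪ f := (union_ord he hf).mem_trans
  have t2 : ∀ {x y}, x ∈ y → y ∈ e → x ∈ e := he.mem_trans
  have t3 : ∀ {x y}, x ∈ y → y ∈ f → x ∈ f := hf.mem_trans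
  rw [gdR_pair] at h1 h2 ⊢
  rcases h1 with h1 | ⟨h1, h1'⟩
  · left
    rcases h2 with h2 | ⟨h2, _⟩
    · exact t1 h1 h2
    · rwa [← h2]
  · rcases h2 with h2 | ⟨h2, h2'⟩
    · left; rwa [h1]
    · right
      refine ⟨h1.trans h2, ?_⟩
      rcases h1' with h1' | ⟨rfl, h1'⟩
      · left
        rcases h2' with h2' | ⟨rfl, _⟩
        · exact t2 h1' h2'
        · exact h1'
      · rcases h2' with h2' | ⟨rfl, h2'⟩
        · exact Or.inl h2'
        · exact Or.inr ⟨rfl, t3 h1' h2'⟩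

theorem gdG_trans (hκ : κ.IsOrdinal) {p : ZFSet.{u}} (hp : p ∈ κ.prod κ) :
    (gdG κ p).IsTransitive := by
  intro z hz w hw
  obtain ⟨q, hq, hqp, rfl⟩ := mem_coll.1 hz
  obtain ⟨r, hr, hrq, rfl⟩ := mem_coll.1 hw
  exact mem_coll.2 ⟨r, hr, gdR_trans hκ hr hq hp hrq hqp, rfl⟩

theorem gdG_ord (hκ : κ.IsOrdinal) {p : ZFSet.{u}} (hp : p ∈ κ.prod κ) : (gdG κ p).IsOrdinal := by
  refine ZFSet.isOrdinal_iff_forall_mem_isTransitive.2 ⟨gdG_trans hκ hp, fun z hz => ?_⟩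
  obtain ⟨q, hq, hqp, rfl⟩ := mem_coll.1 hz
  exact gdG_trans hκ hq

theorem gdG_inj (hκ : κ.IsOrdinal) {p q : ZFSet.{u}} (hp : p ∈ κ.prod κ) (hq : q ∈ κ.prod κ)
    (h : gdG κ p = gdG κ q) : p = q := by
  rcases gdR_tri hκ hp hq with h1 | h1 | h1
  · exact h1
  · have : gdG κ p ∈ gdG κ q := mem_coll.2 ⟨p, hp, h1, rfl⟩
    rw [h] at this; exact absurd this (ZFSet.mem_irrefl _)
  · have : gdG κ q ∈ gdG κ p := mem_coll.2 ⟨q, hq, h1, rfl⟩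
    rw [h] at this; exact absurd this (ZFSet.mem_irrefl _)

theorem gdG_mem (hC : IsCard κ) (hi : Cardinal.aleph0 ≤ zcard κ) {p : ZFSet.{u}}
    (hp : p ∈ κ.prod κ) : gdG κ p ∈ κ := by
  have hκ := isOrd_iff.1 hC.1
  refine mem_of_zcard_lt hC (gdG_ord hκ hp) ?_
  obtain ⟨c, hc, d, hd, rfl⟩ := ZFSet.mem_prod.1 hp
  have hcd := union_mem hκ hc hd
  have hs := card_succ hC hi hcd
  set σ := insert (c ∪ d) (c ∪ d)
  have h1 : zcard (gdG κ (ZFSet.pair c d)) ≤ zcard (σ.prod σ) := by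
    refine zcard_le_of_surj (gdG κ) fun z hz => ?_
    obtain ⟨q, hq, hqp, rfl⟩ := mem_coll.1 hz
    refine ⟨q, ?_, rfl⟩
    obtain ⟨a, ha, b, hb, rfl⟩ := ZFSet.mem_prod.1 hq
    have ho := hκ.mem hcd
    have hsub : a ∪ b ⊆ c ∪ d := by
      rcases gdR_pair.1 hqp with h | h
      · exact ho.subset_of_mem h
      · rw [h.1]
    have hin : ∀ x, x ∈ κ → x ⊆ a ∪ b → x ∈ σ := fun x hx hxs => by
      rcases ((hκ.mem hx).subset_iff_eq_or_mem ho).1 (fun z hz => hsub (hxs hz)) with h | h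
      · rw [h]; exact ZFSet.mem_insert _ _
      · exact ZFSet.mem_insert_of_mem _ h
    exact ZFSet.pair_mem_prod.2 ⟨hin a ha fun z hz => ZFSet.mem_union.2 (Or.inl hz),
      hin b hb fun z hz => ZFSet.mem_union.2 (Or.inr hz)⟩
  refine (h1.trans (zcard_prod _ _)).trans_lt ?_
  exact Cardinal.mul_lt_of_lt hi (hC.2 _ hs) (hC.2 _ hs)

theorem gdG_in {M : ZFSet.{u}} [TM M] (hκM : κ ∈ M) : zlam (κ.prod κ) (gdG κ) ∈ M := by
  have hP := M_prod hκM hκM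
  have hPP := M_prod hP hP
  refine mostowski hP (r := ZFSet.sep (fun p => ∃ s ∈ κ.prod κ, ∃ t ∈ κ.prod κ,
    p = ZFSet.pair s t ∧ ∃ a ∈ κ, ∃ b ∈ κ, ∃ c ∈ κ, ∃ d ∈ κ, s = ZFSet.pair a b ∧
    t = ZFSet.pair c d ∧ (a ∪ b ∈ c ∪ d ∨ (a ∪ b = c ∪ d ∧ (a ∈ c ∨ a = c ∧ b ∈ d))))
      ((κ.prod κ).prod (κ.prod κ))) (M_sep hPP dfnAuto) ?_
  intro p hp z
  rw [gdG, mem_coll]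
  refine exists_congr fun q => and_congr_right fun hq => and_congr_left fun _ => ?_
  rw [ZFSet.mem_sep]
  obtain ⟨a, ha, b, hb, rfl⟩ := ZFSet.mem_prod.1 hq
  obtain ⟨c, hc, d, hd, rfl⟩ := ZFSet.mem_prod.1 hp
  rw [gdR_pair]
  constructor
  · intro h
    exact ⟨ZFSet.pair_mem_prod.2 ⟨hq, hp⟩, _, hq, _, hp, rfl, a, ha, b, hb, c, hc, d, hd, rfl, rfl, h⟩
  · rintro ⟨_, s, hs, t, ht, h0, a', ha', b', hb', c', hc', d', hd', h1, h2, h⟩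
    obtain ⟨rfl, rfl⟩ := ZFSet.pair_inj.1 h0
    obtain ⟨rfl, rfl⟩ := ZFSet.pair_inj.1 h1
    obtain ⟨rfl, rfl⟩ := ZFSet.pair_inj.1 h2
    exact h

end godel

theorem ramsey_good {κ : ZFSet.{u}} (hR : IsRamseyCard κ) {A : ZFSet.{u}} (hA : A ⊆ κ) :
    ∃ M U, Good κ M U ∧ A ∈ M := by
  obtain ⟨M, h1, h2, U, h3, h4, h5⟩ := hR.2 A hA
  exact ⟨M, U, ⟨h1, h3, h4, h5⟩, h2⟩

theorem ramsey_rel {κ : ZFSet.{u}} (hR : IsRamseyCard κ) {E : ZFSet.{u}} (hE : E ⊆ κ.prod κ) :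
    ∃ M U, Good κ M U ∧ E ∈ M := by
  obtain ⟨M0, U0, hG0, _⟩ := ramsey_good hR (A := κ) (fun _ h => h)
  obtain ⟨M, U, hG, hA⟩ := ramsey_good hR (A := zimg E (gdG κ)) (by
    intro z hz
    obtain ⟨p, hp, rfl⟩ := mem_zimg.1 hz
    exact gdG_mem hR.1 hG0.inf (hE hp))
  refine ⟨M, U, hG, ?_⟩
  haveI := hG.tm
  have hκM := hG.wm.2.1
  have hg := gdG_in hκM
  set g := zlam (κ.prod κ) (gdG κ)
  have := M_sep (Q := fun p => fapp g p ∈ zimg E (gdG κ)) (M_prod hκM hκM) dfnAuto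
  convert this
  ext p
  rw [ZFSet.mem_sep]
  constructor
  · intro hp
    refine ⟨hE hp, ?_⟩
    rw [fapp_zlam (hE hp)]
    exact mem_zimg.2 ⟨p, hp, rfl⟩
  · rintro ⟨hp, h⟩
    rw [fapp_zlam hp] at h
    obtain ⟨q, hq, he⟩ := mem_zimg.1 h
    rw [← gdG_inj (isOrd_iff.1 hR.1.1) (hE hq) hp he]; exact hq

theorem ramsey_hered {κ : ZFSet.{u}} (hR : IsRamseyCard κ) {t T : ZFSet.{u}} (hT : T ∈ t)
    (ht : t.IsTransitive) (hc : zcard t ≤ zcard κ) : ∃ M U, Good κ M U ∧ T ∈ M := by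
  obtain ⟨e, he1, he2⟩ := exists_surj ⟨T, hT⟩ hc
  obtain ⟨M, U, hG, hE⟩ := ramsey_rel hR (E := ZFSet.sep (fun p => ∃ a b, p = ZFSet.pair a b ∧
    e a ∈ e b) (κ.prod κ)) (fun p hp => (ZFSet.mem_sep.1 hp).1)
  refine ⟨M, U, hG, ?_⟩
  haveI := hG.tm
  have := mostowski hG.wm.2.1 hE (G := e) (by
    intro a ha z
    constructor
    · intro hz
      obtain ⟨b, hb, rfl⟩ := he2 z (ht _ (he1 a ha) hz)
      exact ⟨b, hb, ZFSet.mem_sep.2 ⟨ZFSet.pair_mem_prod.2 ⟨hb, ha⟩, b, a, rfl, hz⟩, rfl⟩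
    · rintro ⟨b, hb, h, rfl⟩
      obtain ⟨_, b', a', h0, h⟩ := ZFSet.mem_sep.1 h
      obtain ⟨rfl, rfl⟩ := ZFSet.pair_inj.1 h0
      exact h)
  obtain ⟨a, ha, rfl⟩ := he2 T hT
  have h2 := M_fapp this (M_trans hG.wm.2.1 ha)
  rwa [fapp_zlam ha] at h2

/-! ### Calculus of the ultrafilter -/

def AE (κ U : ZFSet.{u}) (P : ZFSet.{u} → Prop) : Prop := ZFSet.sep P κ ∈ U

theorem AE.congr {κ U : ZFSet.{u}} {P Q : ZFSet.{u} → Prop} (h : ∀ ξ ∈ κ, (P ξ ↔ Q ξ)) :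
    AE κ U P ↔ AE κ U Q := by
  unfold AE
  rw [show ZFSet.sep P κ = ZFSet.sep Q κ by
    ext ξ; simp only [ZFSet.mem_sep]; exact and_congr_right (h ξ)]

section uf
variable {κ M U : ZFSet.{u}} [TM M] {P Q : ZFSet.{u} → Prop}

theorem AE.mono (hG : Good κ M U) (hP : AE κ U P) (hQ : MD M (fun _ v => Q (v 0)))
    (h : ∀ ξ ∈ κ, P ξ → Q ξ) : AE κ U Q :=
  hG.uf.2.2.2.2.1 _ hP _ (M_sep hG.wm.2.1 hQ) (fun _ h => (ZFSet.mem_sep.1 h).1)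
    (fun ξ hξ => ZFSet.mem_sep.2 ⟨(ZFSet.mem_sep.1 hξ).1,
      h _ (ZFSet.mem_sep.1 hξ).1 (ZFSet.mem_sep.1 hξ).2⟩)

theorem AE.and (hG : Good κ M U) (hP : AE κ U P) (hQ : AE κ U Q) :
    AE κ U (fun ξ => P ξ ∧ Q ξ) := by
  have := hG.uf.2.2.2.1 _ hP _ hQ
  unfold AE
  convert this using 1
  ext ξ
  simp only [ZFSet.mem_sep, ZFSet.mem_inter]; tauto

theorem AE.exists (hG : Good κ M U) (hP : AE κ U P) : ∃ ξ ∈ κ, P ξ := by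
  by_contra h
  push Not at h
  apply hG.uf.2.2.1
  have : ZFSet.sep P κ = ∅ := by
    rw [ZFSet.eq_empty]; intro y hy
    exact h y (ZFSet.mem_sep.1 hy).1 (ZFSet.mem_sep.1 hy).2
  rwa [← this]

theorem AE.not (hG : Good κ M U) (hP : MD M (fun _ v => P (v 0))) :
    ¬ AE κ U P ↔ AE κ U (fun ξ => ¬ P ξ) := by
  constructor
  · intro h
    rcases hG.uf.2.2.2.2.2.1 _ (M_sep hG.wm.2.1 hP) (fun _ h => (ZFSet.mem_sep.1 h).1) with h1 | h1
    · exact absurd h1 h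
    · unfold AE
      convert h1 using 1
      ext ξ
      simp only [compl, ZFSet.mem_sep]; tauto
  · intro h h'
    obtain ⟨ξ, _, h1, h2⟩ := (AE.and hG h h').exists hG
    exact h1 h2

theorem AE.omega (hG : Good κ M U) {P : ℕ → ZFSet.{u} → Prop} (h : ∀ n, AE κ U (P n)) :
    ∃ ξ ∈ κ, ∀ n, P n ξ := by
  obtain ⟨x, hx⟩ := hG.oi _ h
  exact ⟨x, (ZFSet.mem_sep.1 (hx 0)).1, fun n => (ZFSet.mem_sep.1 (hx n)).2⟩

theorem AE.gt (hC : IsCard κ) (hG : Good κ M U) {α : ZFSet.{u}} (hα : α ∈ κ) :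
    AE κ U (fun ξ => α ∈ ξ) := by
  have h := hG.uf.2.1 _ (card_succ hC hG.inf hα)
  refine (AE.congr ?_).1 h
  intro ξ hξ
  have hκ := isOrd_iff.1 hC.1
  rw [ZFSet.mem_insert_iff]
  constructor
  · intro h
    push Not at h
    rcases (hκ.mem hα).mem_trichotomous (hκ.mem hξ) with h1 | h1 | h1
    exacts [h1, absurd h1.symm h.1, absurd h1 h.2]
  · rintro h (rfl | h1)
    · exact ZFSet.mem_irrefl _ h
    · exact ZFSet.mem_asymm h h1

theorem AE.all (hC : IsCard κ) (hG : Good κ M U) (h : ∀ ξ ∈ κ, P ξ) : AE κ U P := by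
  have h0 := AE.gt hC hG (hG.omega_mem hC)
  have h1 := AE.mono hG (Q := fun _ => True) h0 dfnAuto (fun _ _ _ => trivial)
  exact (AE.congr (by intro ξ hξ; simp [h ξ hξ])).1 h1

theorem AE.normal (hG : Good κ M U) {f : ZFSet.{u}} (hf : f ∈ M) (hfun : IsZFunc κ f)
    (h : AE κ U (fun ξ => fapp f ξ ∈ ξ)) : ∃ γ ∈ κ, AE κ U (fun ξ => fapp f ξ = γ) :=
  hG.uf.2.2.2.2.2.2 f hf hfun h

/-- Choice inside `M`. -/
theorem M_choice {d D : ZFSet.{u}} (hd : d ∈ M) (hD : D ∈ M) {Q : ZFSet.{u} → ZFSet.{u} → Prop}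
    (hQ : MD M (fun _ v => Q (v 0) (v 1))) :
    ∃ f ∈ M, IsZFunc d f ∧ ∀ β ∈ d, ((∃ x ∈ D, Q β x) → fapp f β ∈ D ∧ Q β (fapp f β)) ∧
      ((¬ ∃ x ∈ D, Q β x) → fapp f β = ∅) := by
  obtain ⟨r, hr, h1, h2, h3, h4, h5⟩ := (TM.out (M := M)).2.2.2.2.2.2 D hD
  let F : ZFSet.{u} → ZFSet.{u} := fun β =>
    ⋃₀ ZFSet.sep (fun x => Q β x ∧ ∀ y ∈ D, Q β y → ZFSet.pair y x ∉ r) D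
  have hQ1 := hQ.at2 2 0
  have hQ3 := hQ.at2 3 0
  have hFt : MT M (fun _ v => F (v 1)) := by
    refine DTm.sUnion (DTm.sep (P := fun D' v x => Q (v 1) x ∧ ∀ y ∈ D, Q (v 1) y →
      ZFSet.pair y x ∉ r) (DTm.constM hD) ?_)
    exact dfnAuto
  have hex : ∀ β, (∃ x ∈ D, Q β x) → F β ∈ D ∧ Q β (F β) := by
    rintro β ⟨x, hx, hq⟩
    obtain ⟨a, ⟨haD, haQ⟩, hmin⟩ := h5 {x | x ∈ D ∧ Q β x} (fun y hy => hy.1) ⟨x, hx, hq⟩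
    have : ZFSet.sep (fun x => Q β x ∧ ∀ y ∈ D, Q β y → ZFSet.pair y x ∉ r) D = {a} := by
      ext y
      rw [ZFSet.mem_sep, ZFSet.mem_singleton]
      constructor
      · rintro ⟨hy, hyQ, hm⟩
        rcases h2 y hy a haD with h | h | h
        · exact h
        · exact absurd h (hmin y ⟨hy, hyQ⟩)
        · exact absurd h (hm a haD haQ)
      · rintro rfl
        exact ⟨haD, haQ, fun z hz hzQ => hmin z ⟨hz, hzQ⟩⟩
    have h6 : F β = a := by
      simp only [F]
      rw [this, ZFSet.sUnion_singleton]
    rw [h6]; exact ⟨haD, haQ⟩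
  have hne : ∀ β, (¬ ∃ x ∈ D, Q β x) → F β = ∅ := by
    intro β h
    rw [ZFSet.eq_empty]
    intro y hy
    obtain ⟨z, hz, _⟩ := ZFSet.mem_sUnion.1 hy
    exact h ⟨z, (ZFSet.mem_sep.1 hz).1, (ZFSet.mem_sep.1 hz).2.1⟩
  have hFM : ∀ β ∈ d, F β ∈ M := by
    intro β _
    by_cases h : ∃ x ∈ D, Q β x
    · exact M_trans hD (hex β h).1
    · rw [hne β h]; exact M_empty
  refine ⟨zlam d F, M_lamt hd hFM hFt, isZFunc_zlam _ _, fun β hβ => ?_⟩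
  rw [fapp_zlam hβ]
  exact ⟨hex β, hne β⟩

/-- Weak amenability for definable families. -/
theorem M_wa (hG : Good κ M U) {I g : ZFSet.{u}} (hI : I ∈ M) (hg : g ∈ M)
    (hgI : ∀ y ∈ I, ∃ ξ ∈ κ, fapp g ξ = y) {Q : ZFSet.{u} → ZFSet.{u} → Prop}
    (hQ : MD M (fun _ v => Q (v 0) (v 1))) :
    ZFSet.sep (fun i => AE κ U (Q i)) I ∈ M := by
  have hκ := hG.wm.2.1
  let F : ZFSet.{u} → ZFSet.{u} := fun i => ZFSet.sep (Q i) κ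
  have hFM : ∀ i ∈ M, F i ∈ M := fun i hi => M_sep hκ (hQ.at2l hi 0)
  have hQ1 := hQ.at2 2 0
  have hQ2 := hQ.at2 1 0
  have hFt : MT M (fun _ v => F (v 1)) :=
    DTm.sep (P := fun D v x => Q (v 1) x) (DTm.constM hκ) hQ1
  have hFt0 : MT M (fun _ v => F (v 0)) :=
    DTm.sep (P := fun D v x => Q (v 0) x) (DTm.constM hκ) hQ2
  have hF' : zlam I F ∈ M := M_lamt hI (fun i hi => hFM i (M_trans hI hi)) hFt
  obtain ⟨X, hX, hXm⟩ := M_image hI (Q := fun i y => y = F i) F (fun i hi => hFM i (M_trans hI hi))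
    (by have := Dfn.eq (DTm.var 1) hFt0; exact this) (fun _ _ _ _ => Iff.rfl)
  set F' := zlam I F with hF'd
  have hs : zlam κ (fun ξ => fapp F' (fapp g ξ)) ∈ M :=
    M_lamt hκ (fun ξ hξ => M_fapp hF' (M_fapp hg (M_trans hκ hξ))) dfnAuto
  have hXU := hG.wa X hX ⟨_, hs, isZFunc_zlam _ _, fun y hy => by
    obtain ⟨i, hi, rfl⟩ := (hXm y).1 hy
    obtain ⟨ξ, hξ, rfl⟩ := hgI i hi
    exact ⟨ξ, hξ, by rw [fapp_zlam hξ, hF'd, fapp_zlam hi]⟩⟩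
  have := M_sep (Q := fun i => fapp F' i ∈ X ∩ U) hI dfnAuto
  convert this using 1
  ext i
  simp only [ZFSet.mem_sep]
  refine and_congr_right fun hi => ?_
  rw [hF'd, fapp_zlam hi, ZFSet.mem_inter, hXm]
  exact ⟨fun h => ⟨⟨i, hi, rfl⟩, h⟩, fun h => h.2⟩

theorem M_id {d : ZFSet.{u}} (hd : d ∈ M) : zlam d (fun ξ => ξ) ∈ M :=
  M_lamt hd (fun _ h => M_trans hd h) dfnAuto

theorem M_waκ (hG : Good κ M U) {Q : ZFSet.{u} → ZFSet.{u} → Prop}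
    (hQ : MD M (fun _ v => Q (v 0) (v 1))) : ZFSet.sep (fun i => AE κ U (Q i)) κ ∈ M :=
  M_wa hG hG.wm.2.1 (M_id hG.wm.2.1) (fun y hy => ⟨y, hy, fapp_zlam hy⟩) hQ

/-- κ-completeness. -/
theorem AE.ball (hC : IsCard κ) (hG : Good κ M U) {α : ZFSet.{u}} (hα : α ∈ κ)
    {Q : ZFSet.{u} → ZFSet.{u} → Prop} (hQ : MD M (fun _ v => Q (v 0) (v 1)))
    (h : ∀ ξ ∈ α, AE κ U (Q ξ)) : AE κ U (fun η => ∀ ξ ∈ α, Q ξ η) := by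
  have hκ := hG.wm.2.1
  have hαM := M_trans hκ hα
  have hq := hQ.at2 0 1
  by_contra hn
  rw [AE.not hG dfnAuto] at hn
  have hq2 := (hQ.at2 1 0).neg
  obtain ⟨f, hf, hff, hfp⟩ := M_choice (Q := fun η ξ => ¬ Q ξ η) hκ hαM hq2
  have h1 : AE κ U (fun ξ => fapp f ξ ∈ ξ) := by
    refine AE.mono hG (AE.and hG hn (AE.gt hC hG hα)) dfnAuto ?_
    rintro η hη ⟨h1, h2⟩
    push Not at h1
    have h3 := ((hfp η hη).1 h1).1
    exact (isOrd_iff.1 hC.1).mem hη |>.mem_trans h3 h2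
  obtain ⟨γ, hγ, h2⟩ := AE.normal hG hf hff h1
  obtain ⟨η, hη, h3, h4⟩ := (AE.and hG hn h2).exists hG
  push Not at h3
  have h5 := (hfp η hη).1 h3
  rw [h4] at h5
  obtain ⟨η', hη', ⟨h6, h7⟩, h8⟩ := (AE.and hG (AE.and hG hn h2) (h γ h5.1)).exists hG
  push Not at h6
  have h9 := ((hfp η' hη').1 h6).2
  rw [h7] at h9
  exact h9 h8

end uf

theorem zcard_powerset (x : ZFSet.{u}) : zcard (ZFSet.powerset x) = 2 ^ zcard x := by
  rw [zcard_eq, zcard_eq, ← Cardinal.mk_set]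
  refine Cardinal.mk_congr ⟨fun y => {z | z.1 ∈ y.1}, fun s => ⟨ZFSet.sep (fun z => ∃ h : z ∈ x,
    (⟨z, h⟩ : {z // z ∈ x}) ∈ s) x, ZFSet.mem_powerset.2 (fun z hz => (ZFSet.mem_sep.1 hz).1)⟩, ?_, ?_⟩
  · rintro ⟨y, hy⟩
    ext z
    simp only [ZFSet.mem_sep, Set.mem_setOf_eq]
    exact ⟨fun h => h.2.2, fun h => ⟨ZFSet.mem_powerset.1 hy h, ZFSet.mem_powerset.1 hy h, h⟩⟩
  · intro s
    ext z
    simp only [ZFSet.mem_sep, Set.mem_setOf_eq]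
    exact ⟨fun h => h.2.2, fun h => ⟨z.2, z.2, h⟩⟩

theorem ramsey_strongLimit {κ : ZFSet.{u}} (hR : IsRamseyCard κ) {α : ZFSet.{u}} (hα : α ∈ κ) :
    2 ^ zcard α ≤ zcard κ := by
  by_contra hlt
  push Not at hlt
  rw [← zcard_powerset] at hlt
  have h' : ∃ h : ZFSet.{u} → ZFSet.{u}, (∀ a ∈ κ, h a ⊆ α) ∧ ∀ a ∈ κ, ∀ b ∈ κ, h a = h b → a = b := by
    have hle := hlt.le
    rw [zcard_eq, zcard_eq] at hle
    obtain ⟨i⟩ := hle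
    refine ⟨fun a => if h : a ∈ κ then (i ⟨a, h⟩).1 else ∅, ?_, ?_⟩
    · intro a ha; simp only [ha, dif_pos]; exact ZFSet.mem_powerset.1 (i ⟨a, ha⟩).2
    · intro a ha b hb h
      simp only [ha, hb, dif_pos] at h
      exact Subtype.ext_iff.1 (i.injective (Subtype.ext h))
  obtain ⟨h, h1, h2⟩ := h'
  have hC := hR.1
  have hκo := isOrd_iff.1 hC.1
  obtain ⟨M, U, hG, hE⟩ := ramsey_rel hR (E := ZFSet.sep (fun p => ∃ ξ η, p = ZFSet.pair ξ η ∧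
    ξ ∈ h η) (κ.prod κ)) (fun p hp => (ZFSet.mem_sep.1 hp).1)
  set E := ZFSet.sep (fun p => ∃ ξ η, p = ZFSet.pair ξ η ∧ ξ ∈ h η) (κ.prod κ) with hEd
  have hEm : ∀ ξ ∈ κ, ∀ η ∈ κ, (ZFSet.pair ξ η ∈ E ↔ ξ ∈ h η) := by
    intro ξ hξ η hη
    rw [hEd, ZFSet.mem_sep]
    constructor
    · rintro ⟨_, a, b, h0, h⟩
      obtain ⟨rfl, rfl⟩ := ZFSet.pair_inj.1 h0
      exact h
    · intro h; exact ⟨ZFSet.pair_mem_prod.2 ⟨hξ, hη⟩, _, _, rfl, h⟩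
  haveI := hG.tm
  have hκM := hG.wm.2.1
  have hαM := M_trans hκM hα
  have hW := M_waκ hG (Q := fun ξ η => ZFSet.pair ξ η ∈ E) dfnAuto
  set W := ZFSet.sep (fun i => AE κ U (fun η => ZFSet.pair i η ∈ E)) κ with hWd
  have hag : AE κ U (fun η => ∀ ξ ∈ α, (ξ ∈ W ↔ ZFSet.pair ξ η ∈ E)) := by
    refine AE.ball hC hG hα dfnAuto fun ξ hξ => ?_
    have hξκ := hκo.mem_trans hξ hα
    have hξM := M_trans hκM hξκ
    by_cases hx : ξ ∈ W
    · exact (AE.congr fun η hη => by simp [hx]).1 (ZFSet.mem_sep.1 hx).2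
    · have : ¬ AE κ U (fun η => ZFSet.pair ξ η ∈ E) := fun h => hx (ZFSet.mem_sep.2 ⟨hξκ, h⟩)
      rw [AE.not hG dfnAuto] at this
      exact (AE.congr fun η hη => by simp [hx]).1 this
  obtain ⟨η0, hη0, hag0⟩ := hag.exists hG
  obtain ⟨η1, hη1, hag1, hlt1⟩ := (AE.and hG hag (AE.gt hC hG hη0)).exists hG
  have : h η0 = h η1 := by
    ext ξ
    constructor <;> intro hξ
    · have hξα := h1 _ hη0 hξ
      have hξκ := hκo.mem_trans hξα hα
      rw [← hEm ξ hξκ _ hη0, ← hag0 ξ hξα, hag1 ξ hξα, hEm ξ hξκ _ hη1] at hξ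
      exact hξ
    · have hξα := h1 _ hη1 hξ
      have hξκ := hκo.mem_trans hξα hα
      rw [← hEm ξ hξκ _ hη1, ← hag1 ξ hξα, hag0 ξ hξα, hEm ξ hξκ _ hη0] at hξ
      exact hξ
  rw [h2 _ hη0 _ hη1 this] at hlt1
  exact ZFSet.mem_irrefl _ hlt1

/-! ### Hereditarily small sets -/

def Hp (B x : ZFSet.{u}) : Prop := ∃ t : ZFSet.{u}, t.IsTransitive ∧ x ∈ t ∧ zcard t ≤ zcard B

theorem insert_trans {x : ZFSet.{u}} (h : x.IsTransitive) : (insert x x : ZFSet.{u}).IsTransitive := by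
  intro y hy z hz
  rcases ZFSet.mem_insert_iff.1 hy with rfl | hy
  · exact ZFSet.mem_insert_of_mem _ hz
  · exact ZFSet.mem_insert_of_mem _ (h y hy hz)

section hp
variable {B : ZFSet.{u}}


theorem zadd (hB : Cardinal.aleph0 ≤ zcard B) {c : Cardinal.{u+1}} (hc : c ≤ zcard B) : c + 1 ≤ zcard B :=
  (add_le_add hc (Cardinal.one_le_aleph0.trans hB)).trans_eq (Cardinal.add_eq_self hB)

theorem Hp_trans (hB : Cardinal.aleph0 ≤ zcard B) {t : ZFSet.{u}} (ht : t.IsTransitive) (hc : zcard t ≤ zcard B) : Hp B t :=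
  ⟨insert t t, insert_trans ht, ZFSet.mem_insert _ _, (zcard_insert _ _).trans (zadd hB hc)⟩

theorem Hp_close (hB : Cardinal.aleph0 ≤ zcard B) {y : ZFSet.{u}} (hc : zcard y ≤ zcard B) (h : ∀ z ∈ y, Hp B z) : Hp B y := by
  choose! t ht using h
  have hT : (⋃₀ zimg y t : ZFSet.{u}).IsTransitive := ZFSet.IsTransitive.sUnion' (by
    intro z hz
    obtain ⟨a, ha, rfl⟩ := mem_zimg.1 hz
    exact (ht a ha).1)
  have hTc : zcard (⋃₀ zimg y t : ZFSet.{u}) ≤ zcard B := by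
    refine (zcard_sUnion ((zcard_zimg_le y t).trans hc) ?_).trans_eq (Cardinal.mul_eq_self hB)
    intro z hz
    obtain ⟨a, ha, rfl⟩ := mem_zimg.1 hz
    exact (ht a ha).2.2
  have hsub : ∀ z ∈ y, z ∈ (⋃₀ zimg y t : ZFSet.{u}) := fun z hz =>
    ZFSet.mem_sUnion.2 ⟨t z, mem_zimg.2 ⟨z, hz, rfl⟩, (ht z hz).2.1⟩
  refine ⟨insert y (⋃₀ zimg y t : ZFSet.{u}), ?_, ZFSet.mem_insert _ _,
    (zcard_insert _ _).trans (zadd hB hTc)⟩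
  intro w hw z hz
  rcases ZFSet.mem_insert_iff.1 hw with rfl | hw
  · exact ZFSet.mem_insert_of_mem _ (hsub z hz)
  · exact ZFSet.mem_insert_of_mem _ (hT w hw hz)

end hp

theorem Hp.down {B x y : ZFSet.{u}} (h : Hp B x) (hy : y ∈ x) : Hp B y := by
  obtain ⟨t, h1, h2, h3⟩ := h
  exact ⟨t, h1, h1 x h2 hy, h3⟩

theorem Hp.card {B x : ZFSet.{u}} (h : Hp B x) : zcard x ≤ zcard B := by
  obtain ⟨t, h1, h2, h3⟩ := h
  exact (zcard_mono (h1 x h2)).trans h3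

/-- decoding -/
def HDec (B : ZFSet.{u}) (p x : ZFSet.{u}) : Prop :=
  ∃ (e : ZFSet.{u} → ZFSet.{u}) (t b : ZFSet.{u}), t.IsTransitive ∧ (∀ a ∈ B, e a ∈ t) ∧
    (∀ y ∈ t, ∃ a ∈ B, e a = y) ∧ b ∈ B ∧ x = e b ∧
    p = ZFSet.pair (ZFSet.sep (fun q => ∃ a c, q = ZFSet.pair a c ∧ e a ∈ e c) (B.prod B)) b

theorem HDec.unique {B p x y : ZFSet.{u}} (h : HDec B p x) (h' : HDec B p y) : x = y := by
  obtain ⟨e, t, b, h1, h2, h3, h4, rfl, rfl⟩ := h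
  obtain ⟨e', t', b', h1', h2', h3', h4', rfl, hp⟩ := h'
  obtain ⟨hE, rfl⟩ := ZFSet.pair_inj.1 hp
  have hE' : ∀ a ∈ B, ∀ c ∈ B, (e a ∈ e c ↔ e' a ∈ e' c) := by
    have key : ∀ e : ZFSet.{u} → ZFSet.{u}, ∀ a ∈ B, ∀ c ∈ B, (e a ∈ e c ↔ ZFSet.pair a c ∈
        ZFSet.sep (fun q => ∃ a c, q = ZFSet.pair a c ∧ e a ∈ e c) (B.prod B)) := by
      intro e a ha c hc
      rw [ZFSet.mem_sep]
      constructor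
      · intro h; exact ⟨ZFSet.pair_mem_prod.2 ⟨ha, hc⟩, a, c, rfl, h⟩
      · rintro ⟨_, a', c', h0, h⟩
        obtain ⟨rfl, rfl⟩ := ZFSet.pair_inj.1 h0
        exact h
    intro a ha c hc
    rw [key e a ha c hc, hE, ← key e' a ha c hc]
  have : ∀ z, ∀ c ∈ B, e c = z → e c = e' c := by
    intro z
    induction z using ZFSet.inductionOn with
    | _ z ih =>
    rintro c hc rfl
    ext w
    constructor
    · intro hw
      obtain ⟨a, ha, rfl⟩ := h3 w (h1 _ (h2 c hc) hw)
      rw [ih _ hw a ha rfl]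
      exact (hE' a ha c hc).1 hw
    · intro hw
      obtain ⟨a, ha, rfl⟩ := h3' w (h1' _ (h2' c hc) hw)
      have h5 := (hE' a ha c hc).2 hw
      rw [← ih _ h5 a ha rfl]
      exact h5
  exact this _ b h4 rfl

def HS (B : ZFSet.{u}) : ZFSet.{u} :=
  ZFSet.sep (Hp B) (zimg ((ZFSet.powerset (B.prod B)).prod B) (fun p => Classical.epsilon (HDec B p)))

theorem mem_HS_aux {B x : ZFSet.{u}} (hx : Hp B x) :
    ∃ p ∈ (ZFSet.powerset (B.prod B)).prod B, HDec B p x := by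
  obtain ⟨t, h1, h2, h3⟩ := hx
  obtain ⟨e, he1, he2⟩ := exists_surj ⟨x, h2⟩ h3
  obtain ⟨b, hb, rfl⟩ := he2 x h2
  exact ⟨_, ZFSet.pair_mem_prod.2 ⟨ZFSet.mem_powerset.2 (fun q hq => (ZFSet.mem_sep.1 hq).1), hb⟩,
    e, t, b, h1, he1, he2, hb, rfl, rfl⟩

theorem mem_HS {B x : ZFSet.{u}} : x ∈ HS B ↔ Hp B x := by
  unfold HS
  rw [ZFSet.mem_sep]
  refine ⟨fun h => h.2, fun h => ⟨?_, h⟩⟩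
  obtain ⟨p, hp, hd⟩ := mem_HS_aux h
  exact mem_zimg.2 ⟨p, hp, (Classical.epsilon_spec (p := HDec B p) ⟨x, hd⟩).unique hd⟩

theorem zcard_HS {B : ZFSet.{u}} (hB : Cardinal.aleph0 ≤ zcard B) : zcard (HS B) ≤ 2 ^ zcard B := by
  have h1 : zcard (HS B) ≤ zcard ((ZFSet.powerset (B.prod B)).prod B) :=
    (zcard_mono (fun x hx => (ZFSet.mem_sep.1 hx).1)).trans (zcard_zimg_le _ _)
  refine h1.trans ((zcard_prod _ _).trans ?_)
  rw [zcard_powerset]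
  have h2 : zcard (B.prod B) ≤ zcard B := (zcard_prod _ _).trans_eq (Cardinal.mul_eq_self hB)
  have h3 : (2 : Cardinal.{u+1}) ^ zcard (B.prod B) ≤ 2 ^ zcard B :=
    Cardinal.power_le_power_left two_ne_zero h2
  have h4 : Cardinal.aleph0 ≤ (2 : Cardinal.{u+1}) ^ zcard B :=
    hB.trans (Cardinal.cantor _).le
  exact (mul_le_mul' h3 (Cardinal.cantor _).le).trans_eq (Cardinal.mul_eq_self h4)

section hs
variable {B : ZFSet.{u}}

theorem HS_sub {x y : ZFSet.{u}} (hB : Cardinal.aleph0 ≤ zcard B) (hx : x ∈ HS B) (h : y ⊆ x) : y ∈ HS B :=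
  mem_HS.2 (Hp_close hB ((zcard_mono h).trans (mem_HS.1 hx).card)
    (fun z hz => (mem_HS.1 hx).down (h hz)))

theorem HS_close {y : ZFSet.{u}} (hB : Cardinal.aleph0 ≤ zcard B) (hc : zcard y ≤ zcard B)
    (h : ∀ z ∈ y, z ∈ HS B) : y ∈ HS B :=
  mem_HS.2 (Hp_close hB hc (fun z hz => mem_HS.1 (h z hz)))

theorem HS_upair {x y : ZFSet.{u}} (hB : Cardinal.aleph0 ≤ zcard B) (hx : x ∈ HS B) (hy : y ∈ HS B) :
    ({x, y} : ZFSet.{u}) ∈ HS B := by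
  refine HS_close hB ?_ ?_
  · refine (zcard_insert _ _).trans (zadd hB ?_)
    rw [zcard_single]; exact Cardinal.one_le_aleph0.trans hB
  · intro z hz
    rcases ZFSet.mem_pair.1 hz with rfl | rfl
    exacts [hx, hy]

theorem HS_pair {x y : ZFSet.{u}} (hB : Cardinal.aleph0 ≤ zcard B) (hx : x ∈ HS B) (hy : y ∈ HS B) :
    ZFSet.pair x y ∈ HS B := by
  refine HS_upair hB ?_ (HS_upair hB hx hy)
  have := HS_upair hB hx hx
  rwa [show ({x, x} : ZFSet.{u}) = {x} by ext; simp] at this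

theorem HS_trans : (HS B).IsTransitive := fun _ hx _ hy =>
  mem_HS.2 ((mem_HS.1 hx).down hy)

theorem HS_prod {x y : ZFSet.{u}} (hB : Cardinal.aleph0 ≤ zcard B) (hx : x ∈ HS B) (hy : y ∈ HS B) :
    x.prod y ∈ HS B := by
  refine HS_close hB ?_ ?_
  · exact (zcard_prod _ _).trans ((mul_le_mul' (mem_HS.1 hx).card (mem_HS.1 hy).card).trans_eq
      (Cardinal.mul_eq_self hB))
  · intro z hz
    obtain ⟨a, ha, b, hb, rfl⟩ := ZFSet.mem_prod.1 hz
    exact HS_pair hB (HS_trans _ hx ha) (HS_trans _ hy hb)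

theorem HS_self (hB : Cardinal.aleph0 ≤ zcard B) (ho : B.IsTransitive) : B ∈ HS B :=
  mem_HS.2 (Hp_trans hB ho le_rfl)

theorem HS_omega (hB : Cardinal.aleph0 ≤ zcard B) : ZFSet.omega ∈ HS B :=
  mem_HS.2 (Hp_trans hB omega_ord.isTransitive (by rw [zcard_omega]; exact hB))

theorem HS_sUnion {x : ZFSet.{u}} (hB : Cardinal.aleph0 ≤ zcard B) (hx : x ∈ HS B) :
    (⋃₀ x : ZFSet.{u}) ∈ HS B := by
  refine HS_close hB ?_ ?_
  · exact (zcard_sUnion (mem_HS.1 hx).card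
      (fun y hy => (mem_HS.1 (HS_trans _ hx hy)).card)).trans_eq (Cardinal.mul_eq_self hB)
  · intro z hz
    obtain ⟨w, hw, hz⟩ := ZFSet.mem_sUnion.1 hz
    exact HS_trans _ (HS_trans _ hx hw) hz

theorem HS_zimg {x : ZFSet.{u}} {F : ZFSet.{u} → ZFSet.{u}} (hB : Cardinal.aleph0 ≤ zcard B)
    (hx : x ∈ HS B) (hF : ∀ a ∈ x, F a ∈ HS B) : zimg x F ∈ HS B := by
  refine HS_close hB ((zcard_zimg_le _ _).trans (mem_HS.1 hx).card) ?_
  intro z hz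
  obtain ⟨a, ha, rfl⟩ := mem_zimg.1 hz
  exact hF a ha

theorem HS_zlam {x : ZFSet.{u}} {F : ZFSet.{u} → ZFSet.{u}} (hB : Cardinal.aleph0 ≤ zcard B)
    (hx : x ∈ HS B) (hF : ∀ a ∈ x, F a ∈ HS B) : zlam x F ∈ HS B := by
  refine HS_sub hB (HS_prod hB hx (HS_zimg hB hx hF)) ?_
  intro p hp
  obtain ⟨a, ha, rfl⟩ := mem_zlam.1 hp
  exact ZFSet.pair_mem_prod.2 ⟨ha, mem_zimg.2 ⟨a, ha, rfl⟩⟩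

/-- Well-ordering in the guise used for transfer. -/
def WOX (x r f : ZFSet.{u}) : Prop :=
  (∀ p ∈ r, ∃ a ∈ x, ∃ b ∈ x, p = ZFSet.pair a b) ∧
  (∀ a ∈ x, ∀ b ∈ x, a = b ∨ ZFSet.pair a b ∈ r ∨ ZFSet.pair b a ∈ r) ∧
  (∀ a ∈ x, ∀ b ∈ x, ∀ c ∈ x,
    ZFSet.pair a b ∈ r → ZFSet.pair b c ∈ r → ZFSet.pair a c ∈ r) ∧
  (∀ a ∈ x, ZFSet.pair a a ∉ r) ∧
  (∀ a ∈ x, ∀ b ∈ x, ZFSet.pair a b ∈ r → fapp f a ∈ fapp f b)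

theorem WOX.wo {x r f : ZFSet.{u}} (h : WOX x r f) : IsWellOrderOn x r := by
  obtain ⟨h1, h2, h3, h4, h5⟩ := h
  refine ⟨h1, h2, h3, h4, fun S hS hne => ?_⟩
  obtain ⟨a, ha, hm⟩ := (InvImage.wf (fapp f) ZFSet.mem_wf).has_min S hne
  exact ⟨a, ha, fun b hb hr => hm b hb (h5 b (hS hb) a (hS ha) hr)⟩

theorem HS_wo {x : ZFSet.{u}} (hB : Cardinal.aleph0 ≤ zcard B) (ho : B.IsOrdinal) (hx : x ∈ HS B) :
    ∃ r ∈ HS B, ∃ f ∈ HS B, WOX x r f := by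
  have h : ∃ g : ZFSet.{u} → ZFSet.{u}, (∀ a ∈ x, g a ∈ B) ∧ ∀ a ∈ x, ∀ b ∈ x, g a = g b → a = b := by
    have hle := (mem_HS.1 hx).card
    rw [zcard_eq, zcard_eq] at hle
    obtain ⟨i⟩ := hle
    refine ⟨fun a => if h : a ∈ x then (i ⟨a, h⟩).1 else ∅, ?_, ?_⟩
    · intro a ha; simp only [ha, dif_pos]; exact (i ⟨a, ha⟩).2
    · intro a ha b hb h
      simp only [ha, hb, dif_pos] at h
      exact Subtype.ext_iff.1 (i.injective (Subtype.ext h))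
  obtain ⟨g, hg1, hg2⟩ := h
  have hr : ∀ a ∈ x, ∀ b ∈ x, (ZFSet.pair a b ∈ ZFSet.sep (fun p => ∃ a b, p = ZFSet.pair a b ∧
      g a ∈ g b) (x.prod x) ↔ g a ∈ g b) := by
    intro a ha b hb
    rw [ZFSet.mem_sep]
    constructor
    · rintro ⟨_, a', b', h0, h⟩
      obtain ⟨rfl, rfl⟩ := ZFSet.pair_inj.1 h0
      exact h
    · intro h; exact ⟨ZFSet.pair_mem_prod.2 ⟨ha, hb⟩, a, b, rfl, h⟩
  have hBs := HS_self hB ho.isTransitive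
  refine ⟨ZFSet.sep (fun p => ∃ a b, p = ZFSet.pair a b ∧ g a ∈ g b) (x.prod x),
    HS_sub hB (HS_prod hB hx hx) (fun p hp => (ZFSet.mem_sep.1 hp).1), zlam x g,
    HS_zlam hB hx (fun a ha => HS_trans _ hBs (hg1 a ha)), ?_, ?_, ?_, ?_, ?_⟩
  · intro p hp
    obtain ⟨a, ha, b, hb, rfl⟩ := ZFSet.mem_prod.1 (ZFSet.mem_sep.1 hp).1
    exact ⟨a, ha, b, hb, rfl⟩
  · intro a ha b hb
    rw [hr a ha b hb, hr b hb a ha]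
    rcases (ho.mem (hg1 a ha)).mem_trichotomous (ho.mem (hg1 b hb)) with h | h | h
    exacts [Or.inr (Or.inl h), Or.inl (hg2 a ha b hb h), Or.inr (Or.inr h)]
  · intro a ha b hb c hc
    rw [hr a ha b hb, hr b hb c hc, hr a ha c hc]
    exact (ho.mem (hg1 c hc)).mem_trans
  · intro a ha
    rw [hr a ha a ha]; exact ZFSet.mem_irrefl _
  · intro a ha b hb
    rw [hr a ha b hb, fapp_zlam ha, fapp_zlam hb]; exact id

end hs

def Fml.enc : Fml → ℕ
  | .mem i j => Nat.pair 0 (Nat.pair i j)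
  | .eq i j => Nat.pair 1 (Nat.pair i j)
  | .impl φ ψ => Nat.pair 2 (Nat.pair φ.enc ψ.enc)
  | .neg φ => Nat.pair 3 φ.enc
  | .all n φ => Nat.pair 4 (Nat.pair n φ.enc)

theorem Fml.enc_inj : Function.Injective Fml.enc := by
  intro a
  induction a with
  | mem i j => intro b h; cases b <;> simp_all [Fml.enc, Nat.pair_eq_pair]
  | eq i j => intro b h; cases b <;> simp_all [Fml.enc, Nat.pair_eq_pair]
  | impl φ ψ h1 h2 =>
    intro b h; cases b <;> simp only [Fml.enc, Nat.pair_eq_pair] at h <;> try omega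
    rw [h1 h.2.1, h2 h.2.2]
  | neg φ h1 =>
    intro b h; cases b <;> simp only [Fml.enc, Nat.pair_eq_pair] at h <;> try omega
    rw [h1 h.2]
  | all n φ h1 =>
    intro b h; cases b <;> simp only [Fml.enc, Nat.pair_eq_pair] at h <;> try omega
    rw [h.2.1, h1 h.2.2]

def lsVal (X : ZFSet.{u}) (l : List {y // y ∈ X}) : ℕ → ZFSet.{u} :=
  fun i => ((l[i]?).map Subtype.val).getD ∅

def lsWit (H X : ZFSet.{u}) (p : Fml × ℕ × List {y // y ∈ X}) : ZFSet.{u} :=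
  Classical.epsilon (fun x => x ∈ H ∧ ¬ Sat H.toSet p.1 (Function.update (lsVal X p.2.2) p.2.1 x))

def lsStep (H : ZFSet.{u}) (t : ZFSet.{u} → ZFSet.{u}) (X : ZFSet.{u}) : ZFSet.{u} :=
  ZFSet.sep (fun z => z ∈ X ∨ ∃ p : Fml × ℕ × List {y // y ∈ X}, lsWit H X p ∈ H ∧ z ∈ t (lsWit H X p)) H

def lsSeq (H : ZFSet.{u}) (t : ZFSet.{u} → ZFSet.{u}) (X : ZFSet.{u}) : ℕ → ZFSet.{u}
  | 0 => X
  | n + 1 => lsStep H t (lsSeq H t X n)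

theorem lsVal_list {X : ZFSet.{u}} (v : ℕ → ZFSet.{u}) (hv : ∀ n, v n ∈ X) (m : ℕ) :
    ∃ l : List {y // y ∈ X}, ∀ i < m, lsVal X l i = v i := by
  refine ⟨List.ofFn (fun i : Fin m => (⟨v i, hv i⟩ : {y // y ∈ X})), fun i hi => ?_⟩
  simp [lsVal, hi]

theorem mem_lsStep {H X z : ZFSet.{u}} {t : ZFSet.{u} → ZFSet.{u}} : z ∈ lsStep H t X ↔ z ∈ H ∧
    (z ∈ X ∨ ∃ p : Fml × ℕ × List {y // y ∈ X}, lsWit H X p ∈ H ∧ z ∈ t (lsWit H X p)) :=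
  ZFSet.mem_sep

theorem lsStep_card {B H X : ZFSet.{u}} {t : ZFSet.{u} → ZFSet.{u}} (hB : Cardinal.aleph0 ≤ zcard B)
    (ht : ∀ y ∈ H, zcard (t y) ≤ zcard B) (hX : zcard X ≤ zcard B) : zcard (lsStep H t X) ≤ zcard B := by
  let ι := Fml × ℕ × List {y // y ∈ X}
  have hι : Cardinal.mk ι ≤ zcard B := by
    have h1 : Cardinal.mk Fml ≤ Cardinal.aleph0 :=
      Cardinal.mk_le_aleph0_iff.2 Fml.enc_inj.countable
    have h2 : Cardinal.mk (List {y // y ∈ X}) ≤ zcard B :=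
      (Cardinal.mk_list_le_max _).trans (max_le hB hX)
    simp only [ι, Cardinal.mk_prod, Cardinal.lift_id]
    have h3 : Cardinal.lift.{u+1} (Cardinal.mk Fml) ≤ zcard B := by
      have := Cardinal.lift_le.{u+1}.2 h1
      rw [Cardinal.lift_aleph0] at this; exact this.trans hB
    have h4 : Cardinal.lift.{u+1} (Cardinal.mk ℕ) ≤ zcard B := by simpa using hB
    refine (mul_le_mul' h3 ?_).trans_eq (Cardinal.mul_eq_self hB)
    refine le_trans ?_ (Cardinal.mul_eq_self hB).le
    simp only [Cardinal.lift_mul, Cardinal.lift_lift, Cardinal.lift_uzero]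
    exact mul_le_mul' (by simpa using h4) h2
  let A : ι → Set ZFSet.{u} := fun p => if lsWit H X p ∈ H then (t (lsWit H X p)).toSet else ∅
  have hA : ∀ p, Cardinal.mk (A p) ≤ zcard B := by
    intro p
    dsimp only [A]
    split_ifs with h
    · exact ht _ h
    · simp
  have hsub : (lsStep H t X).toSet ⊆ X.toSet ∪ ⋃ p, A p := by
    intro z hz
    rcases (ZFSet.mem_sep.1 hz).2 with h | ⟨p, hp, h⟩
    · exact Or.inl h
    · refine Or.inr (Set.mem_iUnion.2 ⟨p, ?_⟩)
      simp only [A, hp, if_true]; exact h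
  refine (Cardinal.mk_le_mk_of_subset hsub).trans ((Cardinal.mk_union_le _ _).trans ?_)
  refine (add_le_add hX ((Cardinal.mk_iUnion_le _).trans
    (mul_le_mul' hι (ciSup_le' hA)))).trans_eq ?_
  rw [Cardinal.mul_eq_self hB, Cardinal.add_eq_self hB]

theorem zcard_iUnion {B X : ZFSet.{u}} {s : ℕ → ZFSet.{u}} (hB : Cardinal.aleph0 ≤ zcard B)
    (h : ∀ n, zcard (s n) ≤ zcard B) (hX : ∀ x ∈ X, ∃ n, x ∈ s n) : zcard X ≤ zcard B := by
  have hsub : X.toSet ⊆ ⋃ n : ULift.{u+1} ℕ, (s n.down).toSet := by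
    intro x hx
    obtain ⟨n, hn⟩ := hX x hx
    exact Set.mem_iUnion.2 ⟨⟨n⟩, hn⟩
  have h1 : zcard X ≤ _ := Cardinal.mk_le_mk_of_subset hsub
  have h2 := Cardinal.mk_iUnion_le (fun n : ULift.{u+1} ℕ => (s n.down).toSet)
  have h3 : Cardinal.mk (ULift.{u+1} ℕ) ≤ zcard B := by
    rw [Cardinal.mk_uLift, Cardinal.mk_nat, Cardinal.lift_aleph0]; exact hB
  have h4 : (⨆ n : ULift.{u+1} ℕ, Cardinal.mk (s n.down).toSet) ≤ zcard B :=
    ciSup_le' fun n => h n.down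
  exact (h1.trans h2).trans ((mul_le_mul' h3 h4).trans_eq (Cardinal.mul_eq_self hB))

theorem mono_chain {s : ℕ → ZFSet.{u}} (h : ∀ n, s n ⊆ s (n + 1)) {m n : ℕ} (hmn : m ≤ n) :
    s m ⊆ s n := by
  induction hmn with
  | refl => exact fun _ h => h
  | step _ ih => exact fun _ hx => h _ (ih hx)

theorem chain_bound {s : ℕ → ZFSet.{u}} (h : ∀ n, s n ⊆ s (n + 1)) (v : ℕ → ZFSet.{u})
    (hv : ∀ i, ∃ n, v i ∈ s n) (m : ℕ) : ∃ n, ∀ i < m, v i ∈ s n := by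
  induction m with
  | zero => exact ⟨0, by simp⟩
  | succ m ih =>
    obtain ⟨n, hn⟩ := ih
    obtain ⟨k, hk⟩ := hv m
    refine ⟨max n k, fun i hi => ?_⟩
    rcases Nat.lt_succ_iff_lt_or_eq.1 hi with h' | rfl
    · exact mono_chain h (le_max_left _ _) (hn i h')
    · exact mono_chain h (le_max_right _ _) hk

theorem HS_LS {B a : ZFSet.{u}} (hB : Cardinal.aleph0 ≤ zcard B) (ho : B.IsTransitive)
    (ha : a ∈ HS B) : ∃ X ∈ HS B, X.IsTransitive ∧ a ∈ X ∧ B ⊆ X ∧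
      ElemSub X.toSet (HS B).toSet ∧ ∃ b ∈ HS B, IsBij b B X := by
  have hT : ∀ y ∈ HS B, ∃ t : ZFSet.{u}, t.IsTransitive ∧ y ∈ t ∧ zcard t ≤ zcard B :=
    fun y hy => mem_HS.1 hy
  choose! t ht1 ht2 ht3 using hT
  set H := HS B with hH
  have htH : ∀ y ∈ H, t y ⊆ H := fun y hy =>
    HS_trans _ (mem_HS.2 (Hp_trans hB (ht1 y hy) (ht3 y hy)))
  have hBH : B ⊆ H := HS_trans _ (HS_self hB ho)
  let s := lsSeq H t (t a ∪ B)
  have hsH : ∀ n, s n ⊆ H := by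
    intro n
    cases n with
    | zero =>
      intro z hz
      rcases ZFSet.mem_union.1 hz with h | h
      exacts [htH a ha h, hBH h]
    | succ n => intro z hz; exact (mem_lsStep.1 hz).1
  have hmono : ∀ n, s n ⊆ s (n + 1) := fun n z hz =>
    mem_lsStep.2 ⟨hsH n hz, Or.inl hz⟩
  have htr : ∀ n, (s n).IsTransitive := by
    intro n
    induction n with
    | zero => exact (ht1 a ha).union ho
    | succ n ih =>
      intro z hz w hw
      obtain ⟨hzH, h⟩ := mem_lsStep.1 hz
      refine mem_lsStep.2 ⟨HS_trans _ hzH hw, ?_⟩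
      rcases h with h | ⟨p, hp, h⟩
      · exact Or.inl (ih _ h hw)
      · exact Or.inr ⟨p, hp, ht1 _ hp _ h hw⟩
  have hcard : ∀ n, zcard (s n) ≤ zcard B := by
    intro n
    induction n with
    | zero =>
      exact (zcard_union _ _).trans ((add_le_add (ht3 a ha) le_rfl).trans_eq (Cardinal.add_eq_self hB))
    | succ n ih => exact lsStep_card hB ht3 ih
  let X := ZFSet.sep (fun z => ∃ n, z ∈ s n) H
  have hX : ∀ z, z ∈ X ↔ ∃ n, z ∈ s n := fun z =>
    ZFSet.mem_sep.trans ⟨fun h => h.2, fun h => ⟨hsH _ h.choose_spec, h⟩⟩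
  have hXc : zcard X ≤ zcard B := zcard_iUnion hB hcard (fun x hx => (hX x).1 hx)
  have hXt : X.IsTransitive := by
    intro z hz w hw
    obtain ⟨n, hn⟩ := (hX z).1 hz
    exact (hX w).2 ⟨n, htr n _ hn hw⟩
  have hBX : B ⊆ X := fun z hz => (hX z).2 ⟨0, ZFSet.mem_union.2 (Or.inr hz)⟩
  have hXH : X ∈ H := mem_HS.2 (Hp_trans hB hXt hXc)
  refine ⟨X, hXH, hXt, (hX a).2 ⟨0, ZFSet.mem_union.2 (Or.inl (ht2 a ha))⟩, hBX, ?_, ?_⟩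
  · refine elemSub_of_tv (fun z hz => (ZFSet.mem_sep.1 hz).1) ?_
    rintro φ v hv n ⟨x, hx, hxs⟩
    obtain ⟨m, hm⟩ := sat_support.{u} φ
    obtain ⟨k, hk⟩ := chain_bound hmono v (fun i => (hX _).1 (hv i)) m
    have hne : ∃ y, y ∈ s k := by
      obtain ⟨j, hj⟩ := (hX _).1 (hv 0)
      exact ⟨a, mono_chain hmono (Nat.zero_le k) (ZFSet.mem_union.2 (Or.inl (ht2 a ha)))⟩
    obtain ⟨y0, hy0⟩ := hne
    obtain ⟨l, hl⟩ := lsVal_list (X := s k) (fun i => if i < m then v i else y0)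
      (fun i => by split_ifs with h; exacts [hk i h, hy0]) m
    have key : ∀ z, Sat H.toSet φ (Function.update v n z) ↔
        Sat H.toSet φ (Function.update (lsVal (s k) l) n z) := by
      intro z
      refine hm _ _ _ (fun i hi => ?_)
      by_cases hin : i = n
      · subst hin; simp
      · simp [hin, hl i hi, hi]
    have hw := Classical.epsilon_spec (p := fun x => x ∈ H ∧
      ¬ Sat H.toSet φ (Function.update (lsVal (s k) l) n x)) ⟨x, hx, fun h => hxs ((key x).2 h)⟩
    refine ⟨lsWit H (s k) (φ, n, l), (hX _).2 ⟨k + 1, ?_⟩, fun h => hw.2 ((key _).1 h)⟩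
    exact mem_lsStep.2 ⟨hw.1, Or.inr ⟨(φ, n, l), hw.1, ht2 _ hw.1⟩⟩
  · obtain ⟨e, he1, he2, he3⟩ := exists_bij (x := B) (y := X) (le_antisymm hXc (zcard_mono hBX))
    refine ⟨zlam B e, HS_zlam hB (HS_self hB ho) (fun b hb => HS_trans _ hXH (he1 b hb)),
      isZFunc_zlam _ _, ⟨?_, ?_⟩, ?_⟩
    · intro b hb; rw [fapp_zlam hb]; exact he1 b hb
    · intro y hy
      obtain ⟨b, hb, h⟩ := he2 y hy
      exact ⟨b, hb, by rw [fapp_zlam hb, h]⟩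
    · intro b hb c hc h
      rw [fapp_zlam hb, fapp_zlam hc] at h
      exact he3 b hb c hc h

theorem HS_coll {B a : ZFSet.{u}} {Q : ZFSet.{u} → ZFSet.{u} → Prop} (hB : Cardinal.aleph0 ≤ zcard B)
    (ha : a ∈ HS B) (h : ∀ x ∈ a, ∃ y ∈ HS B, Q x y) : ∃ b ∈ HS B, ∀ x ∈ a, ∃ y ∈ b, Q x y := by
  choose! F hF using h
  exact ⟨zimg a F, HS_zimg hB ha (fun x hx => (hF x hx).1),
    fun x hx => ⟨F x, mem_zimg.2 ⟨x, hx, rfl⟩, (hF x hx).2⟩⟩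

/-- the set-up for the ultraproduct -/
structure UP (κ M U Rf : ZFSet.{u}) : Prop where
  card : IsCard κ
  good : Good κ M U
  mem : Rf ∈ M
  func : IsZFunc κ Rf
  val : ∀ α ∈ κ, fapp Rf α = HS (α ∪ ZFSet.omega)

def upF (κ M Rf : ZFSet.{u}) : ZFSet.{u} :=
  ZFSet.sep (fun f => IsZFunc κ f ∧ ∀ α ∈ κ, fapp f α ∈ fapp Rf α) M

theorem inf_union (α : ZFSet.{u}) : Cardinal.aleph0 ≤ zcard (α ∪ ZFSet.omega) := by
  rw [← zcard_omega.{u}]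
  exact zcard_mono (fun x hx => ZFSet.mem_union.2 (Or.inr hx))

theorem AE.wf {κ M U : ZFSet.{u}} [TM M] (hG : Good κ M U) :
    WellFounded (fun f g : ZFSet.{u} => AE κ U (fun ξ => fapp f ξ ∈ fapp g ξ)) := by
  rw [wellFounded_iff_isEmpty_descending_chain]
  refine ⟨fun ⟨s, hs⟩ => ?_⟩
  obtain ⟨ξ, _, h⟩ := AE.omega hG hs
  exact (wellFounded_iff_isEmpty_descending_chain.1 ZFSet.mem_wf).false ⟨fun n => fapp (s n) ξ, h⟩

def upE (κ U f g : ZFSet.{u}) : Prop := AE κ U (fun ξ => fapp f ξ ∈ fapp g ξ)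

def upPi (κ M U Rf : ZFSet.{u}) : ZFSet.{u} → ZFSet.{u} :=
  if h : WellFounded (upE κ U) then coll (upF κ M Rf) (upE κ U) h else id

def upM (κ M U Rf : ZFSet.{u}) : ZFSet.{u} := zimg (upF κ M Rf) (upPi κ M U Rf)

/-- uniform class of structures -/
def UC : Set (Set ZFSet.{u}) := {D | (∀ x ∈ D, ∀ y ∈ x, y ∈ D) ∧ ∅ ∈ D}

instance ctxUC : Ctx UC.{u} {∅} where
  trans := fun D hD => hD.1
  sub := by rintro D hD x rfl; exact hD.2
  ne := rfl

abbrev UD (P : Set ZFSet.{u} → (ℕ → ZFSet.{u}) → Prop) : Prop := Dfn UC.{u} {∅} P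

section up
variable {κ M U Rf : ZFSet.{u}} [hM : TM M]

theorem up_zf {f : ZFSet.{u}} (hf : f ∈ upF κ M Rf) : f ∈ M := (ZFSet.mem_sep.1 hf).1

theorem up_val {f ξ : ZFSet.{u}} (hf : f ∈ upF κ M Rf) (hξ : ξ ∈ κ) : fapp f ξ ∈ fapp Rf ξ :=
  (ZFSet.mem_sep.1 hf).2.2 ξ hξ

theorem UP.wf (h : UP κ M U Rf) : WellFounded (upE κ U) := AE.wf h.good

theorem UP.mem_pi (h : UP κ M U Rf) {z f : ZFSet.{u}} : z ∈ upPi κ M U Rf f ↔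
    ∃ g ∈ upF κ M Rf, AE κ U (fun ξ => fapp g ξ ∈ fapp f ξ) ∧ z = upPi κ M U Rf g := by
  unfold upPi
  rw [dif_pos h.wf]
  exact mem_coll

theorem UP.R_trans (h : UP κ M U Rf) {ξ : ZFSet.{u}} (hξ : ξ ∈ κ) : (fapp Rf ξ).IsTransitive := by
  rw [h.val ξ hξ]; exact HS_trans

theorem UP.R_empty (h : UP κ M U Rf) {ξ : ZFSet.{u}} (hξ : ξ ∈ κ) : ∅ ∈ fapp Rf ξ := by
  rw [h.val ξ hξ]; exact HS_trans _ (HS_omega (inf_union _)) empty_mem_omega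

theorem UP.R_uc (h : UP κ M U Rf) {ξ : ZFSet.{u}} (hξ : ξ ∈ κ) : (fapp Rf ξ).toSet ∈ UC :=
  ⟨fun x hx y hy => h.R_trans hξ x hx hy, h.R_empty hξ⟩

theorem UP.choice (h : UP κ M U Rf) {Q : ZFSet.{u} → ZFSet.{u} → Prop}
    (hQ : MD M (fun _ v => Q (v 0) (v 1))) (hex : AE κ U (fun ξ => ∃ x ∈ fapp Rf ξ, Q ξ x)) :
    ∃ f ∈ upF κ M Rf, AE κ U (fun ξ => Q ξ (fapp f ξ)) := by
  have hRM := h.mem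
  have hκ := h.good.wm.2.1
  obtain ⟨f, hf, hfun, hc⟩ := M_choice (d := κ) (D := (⋃₀ (⋃₀ (⋃₀ Rf : ZFSet.{u}) : ZFSet.{u}) : ZFSet.{u}))
    hκ (M_sUnion (M_sUnion (M_sUnion hRM))) (Q := fun ξ x => x ∈ fapp Rf ξ ∧ Q ξ x) dfnAuto
  have hD : ∀ ξ ∈ κ, ∀ x ∈ fapp Rf ξ,
      x ∈ (⋃₀ (⋃₀ (⋃₀ Rf : ZFSet.{u}) : ZFSet.{u}) : ZFSet.{u}) := by
    intro ξ hξ x hx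
    refine ZFSet.mem_sUnion.2 ⟨_, ZFSet.mem_sUnion.2 ⟨{ξ, fapp Rf ξ}, ZFSet.mem_sUnion.2
      ⟨_, h.func.pair_fapp hξ, ?_⟩, ?_⟩, hx⟩
    · simp [ZFSet.pair]
    · simp
  refine ⟨f, ZFSet.mem_sep.2 ⟨hf, hfun, fun ξ hξ => ?_⟩, ?_⟩
  · by_cases hx : ∃ x ∈ fapp Rf ξ, Q ξ x
    · obtain ⟨x, hx, hq⟩ := hx
      exact ((hc ξ hξ).1 ⟨x, hD ξ hξ x hx, hx, hq⟩).2.1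
    · rw [(hc ξ hξ).2 (by rintro ⟨x, _, hx'⟩; exact hx ⟨x, hx'⟩)]
      exact h.R_empty hξ
  · refine AE.mono h.good hex ?_ ?_
    · exact (Dfn.subst2 hQ (DTm.var 0) (DTm.fapp (DTm.constM hf) (DTm.var 0)) (by
        rintro v hv; exact hv 0) (by rintro v hv; exact M_fapp hf (hv 0)))
    · rintro ξ hξ ⟨x, hx, hq⟩
      exact ((hc ξ hξ).1 ⟨x, hD ξ hξ x hx, hx, hq⟩).2.2

theorem UP.fn (h : UP κ M U Rf) {F : ZFSet.{u} → ZFSet.{u}} (hF : MT M (fun _ v => F (v 0)))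
    (hex : AE κ U (fun ξ => F ξ ∈ fapp Rf ξ)) :
    ∃ f ∈ upF κ M Rf, AE κ U (fun ξ => fapp f ξ = F ξ) := by
  have hRM := h.mem
  refine h.choice (Q := fun ξ x => x = F ξ) ?_ ?_
  · exact Dfn.eq (DTm.var 1) hF
  · refine (AE.congr ?_).1 hex
    intro ξ hξ; simp

theorem UP.pi_eq_aux (h : UP κ M U Rf) (f : ZFSet.{u}) : ∀ g : ZFSet.{u}, f ∈ upF κ M Rf →
    g ∈ upF κ M Rf → (upPi κ M U Rf f = upPi κ M U Rf g ↔ AE κ U (fun ξ => fapp f ξ = fapp g ξ)) := by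
  have hG := h.good
  refine h.wf.induction (C := fun f => ∀ g : ZFSet.{u}, f ∈ upF κ M Rf →
    g ∈ upF κ M Rf → (upPi κ M U Rf f = upPi κ M U Rf g ↔
      AE κ U (fun ξ => fapp f ξ = fapp g ξ))) f ?_
  intro f ih g hf hg
  have hfM := up_zf hf
  have hgM := up_zf hg
  constructor
  · intro heq
    by_contra hne
    have hne := (AE.not hG (P := fun ξ => fapp f ξ = fapp g ξ) dfnAuto).1 hne
    have hd1 : MD M (fun _ v => ∃ x ∈ fapp f (v 0), x ∉ fapp g (v 0)) := dfnAuto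
    have hor : AE κ U (fun ξ => ∃ x ∈ fapp f ξ, x ∉ fapp g ξ) ∨
        AE κ U (fun ξ => ∃ x ∈ fapp g ξ, x ∉ fapp f ξ) := by
      by_contra hc
      push Not at hc
      have h1 := (AE.not hG (P := fun ξ => ∃ x ∈ fapp f ξ, x ∉ fapp g ξ) dfnAuto).1 hc.1
      have h2 := (AE.not hG (P := fun ξ => ∃ x ∈ fapp g ξ, x ∉ fapp f ξ) dfnAuto).1 hc.2
      obtain ⟨ξ, _, ⟨h3, h4⟩, h5⟩ := ((h1.and hG h2).and hG hne).exists hG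
      apply h5
      ext x
      push Not at h3 h4
      exact ⟨h3 x, h4 x⟩
    rcases hor with h1 | h1
    · obtain ⟨k, hk, hk1⟩ := h.choice (Q := fun ξ x => x ∈ fapp f ξ ∧ x ∉ fapp g ξ) dfnAuto
        (by
          refine (AE.congr ?_).1 h1
          intro ξ hξ
          exact ⟨fun ⟨x, hx, hx'⟩ => ⟨x, h.R_trans hξ _ (up_val hf hξ) hx, hx, hx'⟩,
            fun ⟨x, _, hx, hx'⟩ => ⟨x, hx, hx'⟩⟩)
      have hkM := up_zf hk
      have hkf : AE κ U (fun ξ => fapp k ξ ∈ fapp f ξ) :=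
        AE.mono hG hk1 dfnAuto (fun _ _ h => h.1)
      have := h.mem_pi.2 ⟨k, hk, hkf, rfl⟩
      rw [heq] at this
      obtain ⟨k', hk', hk2, hk3⟩ := h.mem_pi.1 this
      have h5 := (ih k hkf _ hk hk').1 hk3
      obtain ⟨ξ, _, ⟨h6, h7⟩, h8⟩ := ((hk1.and hG hk2).and hG h5).exists hG
      rw [← h8] at h7
      exact h6.2 h7
    · obtain ⟨k, hk, hk1⟩ := h.choice (Q := fun ξ x => x ∈ fapp g ξ ∧ x ∉ fapp f ξ) dfnAuto
        (by
          refine (AE.congr ?_).1 h1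
          intro ξ hξ
          exact ⟨fun ⟨x, hx, hx'⟩ => ⟨x, h.R_trans hξ _ (up_val hg hξ) hx, hx, hx'⟩,
            fun ⟨x, _, hx, hx'⟩ => ⟨x, hx, hx'⟩⟩)
      have hkM := up_zf hk
      have hkf : AE κ U (fun ξ => fapp k ξ ∈ fapp g ξ) :=
        AE.mono hG hk1 dfnAuto (fun _ _ h => h.1)
      have := h.mem_pi.2 ⟨k, hk, hkf, rfl⟩
      rw [← heq] at this
      obtain ⟨k', hk', hk2, hk3⟩ := h.mem_pi.1 this
      have h5 := (ih k' hk2 _ hk' hk).1 hk3.symm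
      obtain ⟨ξ, _, ⟨h6, h7⟩, h8⟩ := ((hk1.and hG hk2).and hG h5).exists hG
      rw [h8] at h7
      exact h6.2 h7
  · intro hae
    ext z
    rw [h.mem_pi, h.mem_pi]
    constructor
    · rintro ⟨k, hk, h1, h2⟩
      have hkM := up_zf hk
      exact ⟨k, hk, AE.mono hG (h1.and hG hae) dfnAuto (fun ξ _ h => h.2 ▸ h.1), h2⟩
    · rintro ⟨k, hk, h1, h2⟩
      have hkM := up_zf hk
      exact ⟨k, hk, AE.mono hG (h1.and hG hae) dfnAuto (fun ξ _ h => h.2.symm ▸ h.1), h2⟩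

theorem UP.pi_eq (h : UP κ M U Rf) {f g : ZFSet.{u}} (hf : f ∈ upF κ M Rf)
    (hg : g ∈ upF κ M Rf) : (upPi κ M U Rf f = upPi κ M U Rf g ↔
      AE κ U (fun ξ => fapp f ξ = fapp g ξ)) := h.pi_eq_aux f g hf hg

theorem UP.pi_mem (h : UP κ M U Rf) {f g : ZFSet.{u}} (hf : f ∈ upF κ M Rf)
    (hg : g ∈ upF κ M Rf) : (upPi κ M U Rf f ∈ upPi κ M U Rf g ↔
      AE κ U (fun ξ => fapp f ξ ∈ fapp g ξ)) := by
  have hfM := up_zf hf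
  have hgM := up_zf hg
  rw [h.mem_pi]
  constructor
  · rintro ⟨k, hk, h1, h2⟩
    have h3 := (h.pi_eq hf hk).1 h2
    exact AE.mono h.good (h1.and h.good h3) dfnAuto (fun ξ _ h => h.2.symm ▸ h.1)
  · intro h1; exact ⟨f, hf, h1, rfl⟩

theorem mem_upM {x : ZFSet.{u}} : x ∈ upM κ M U Rf ↔ ∃ f ∈ upF κ M Rf, upPi κ M U Rf f = x :=
  mem_zimg

theorem UP.upM_trans (h : UP κ M U Rf) : (upM κ M U Rf).IsTransitive := by
  intro x hx y hy
  obtain ⟨f, hf, rfl⟩ := mem_upM.1 hx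
  obtain ⟨g, hg, _, rfl⟩ := h.mem_pi.1 hy
  exact mem_upM.2 ⟨g, hg, rfl⟩

theorem AE.imp (hG : Good κ M U) {P Q : ZFSet.{u} → Prop} (hP : MD M (fun _ v => P (v 0)))
    (hQ : MD M (fun _ v => Q (v 0))) :
    AE κ U (fun ξ => P ξ → Q ξ) ↔ (AE κ U P → AE κ U Q) := by
  constructor
  · intro h1 h2; exact AE.mono hG (h1.and hG h2) hQ (fun _ _ h => h.1 h.2)
  · intro h1
    by_cases h2 : AE κ U P
    · exact AE.mono hG (h1 h2) (hP.imp hQ) (fun _ _ h _ => h)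
    · exact AE.mono hG ((AE.not hG hP).1 h2) (hP.imp hQ) (fun _ _ h h' => absurd h' h)

theorem UP.sat_md (h : UP κ M U Rf) (φ : Fml) {F : ℕ → ZFSet.{u}} (hF : ∀ n, F n ∈ upF κ M Rf) :
    MD M (fun _ v => Sat (fapp Rf (v 0)).toSet φ (fun n => fapp (F n) (v 0))) :=
  Dfn.satIn (DTm.fapp (DTm.constM h.mem) (DTm.var 0)) φ (t := fun n _ v => fapp (F n) (v 0))
    (fun n => DTm.fapp (DTm.constM (up_zf (hF n))) (DTm.var 0))

theorem UP.los (h : UP κ M U Rf) (φ : Fml) : ∀ {F : ℕ → ZFSet.{u}}, (∀ n, F n ∈ upF κ M Rf) →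
    (Sat (upM κ M U Rf).toSet φ (fun n => upPi κ M U Rf (F n)) ↔
      AE κ U (fun ξ => Sat (fapp Rf ξ).toSet φ (fun n => fapp (F n) ξ))) := by
  induction φ with
  | mem i j => intro F hF; exact h.pi_mem (hF i) (hF j)
  | eq i j => intro F hF; exact h.pi_eq (hF i) (hF j)
  | impl φ ψ h1 h2 =>
    intro F hF
    simp only [Sat]
    rw [AE.imp h.good (P := fun ξ => Sat (fapp Rf ξ).toSet φ (fun n => fapp (F n) ξ))
      (h.sat_md φ hF) (h.sat_md ψ hF), h1 hF, h2 hF]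
  | neg φ h1 =>
    intro F hF
    simp only [Sat]
    rw [← AE.not h.good (P := fun ξ => Sat (fapp Rf ξ).toSet φ (fun n => fapp (F n) ξ))
      (h.sat_md φ hF), h1 hF]
  | all n φ h1 =>
    intro F hF
    have hup : ∀ f ∈ upF κ M Rf, ∀ m, Function.update F n f m ∈ upF κ M Rf := by
      intro f hf m
      by_cases hm : m = n
      · subst hm; simpa using hf
      · simpa [hm] using hF m
    have e1 : ∀ f, Function.update (fun m => upPi κ M U Rf (F m)) n (upPi κ M U Rf f) =
        fun m => upPi κ M U Rf (Function.update F n f m) := by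
      intro f; funext m
      by_cases hm : m = n
      · subst hm; simp
      · simp [hm]
    have e2 : ∀ f ξ, Function.update (fun m => fapp (F m) ξ) n (fapp f ξ) =
        fun m => fapp (Function.update F n f m) ξ := by
      intro f ξ; funext m
      by_cases hm : m = n
      · subst hm; simp
      · simp [hm]
    have hall := h.sat_md (.all n φ) hF
    have hdx : MD M (fun _ v => ¬ Sat (fapp Rf (v 0)).toSet φ
        (Function.update (fun m => fapp (F m) (v 0)) n (v 1))) := by
      refine ((Dfn.satIn (DTm.fapp (DTm.constM h.mem) (DTm.var 0)) φ
        (t := fun m _ v => if m = n then v 1 else fapp (F m) (v 0)) (fun m => ?_)).neg).congr ?_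
      · by_cases hm : m = n
        · simp only [hm, if_true]; exact DTm.var 1
        · simp only [hm, if_false]; exact DTm.fapp (DTm.constM (up_zf (hF m))) (DTm.var 0)
      · intro D hD v hv
        have : (Function.update (fun m => fapp (F m) (v 0)) n (v 1)) =
            fun m => if m = n then v 1 else fapp (F m) (v 0) := by
          funext m; by_cases hm : m = n
          · subst hm; simp
          · simp [hm]
        rw [this]
    constructor
    · intro H
      by_contra hc
      have hc := (AE.not h.good (P := fun ξ => Sat (fapp Rf ξ).toSet (.all n φ)
        (fun m => fapp (F m) ξ)) hall).1 hc
      obtain ⟨f, hf, hae⟩ := h.choice (Q := fun ξ x => ¬ Sat (fapp Rf ξ).toSet φ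
        (Function.update (fun m => fapp (F m) ξ) n x)) hdx (by
          refine (AE.congr ?_).1 hc
          intro ξ hξ
          simp only [Sat]; push Not; exact Iff.rfl)
      have := H _ (mem_upM.2 ⟨f, hf, rfl⟩)
      rw [e1, h1 (hup f hf)] at this
      obtain ⟨ξ, _, h3, h4⟩ := (hae.and h.good this).exists h.good
      rw [e2] at h3
      exact h3 h4
    · intro H x hx
      obtain ⟨f, hf, rfl⟩ := mem_upM.1 hx
      rw [e1, h1 (hup f hf)]
      refine AE.mono h.good H (h.sat_md φ (hup f hf)) ?_
      intro ξ hξ hs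
      have := hs (fapp f ξ) (up_val hf hξ)
      rwa [e2] at this
end up

theorem dfnAutoU {p : Prop} (h : p := by
  repeat' first
    | assumption
    | exact DTm.dom
    | exact DTm.var _
    | apply DTm.fapp
    | apply DTm.union
    | apply DTm.inter
    | apply DTm.sUnion
    | apply DTm.sep
    | exact Dfn.prop _
    | apply Dfn.bex
    | apply Dfn.ball
    | apply Dfn.ex
    | apply Dfn.all
    | apply Dfn.and
    | apply Dfn.or
    | apply Dfn.iff
    | apply Dfn.memPair
    | apply Dfn.eqPair
    | apply Dfn.eqUpair
    | apply Dfn.mem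
    | apply Dfn.eq
    | apply Dfn.subset
    | apply Dfn.neg
    | apply Dfn.imp) : p := h

/-- transfer from the `HS B` to `D` -/
def Tfer (D : ZFSet.{u}) : Prop := ∀ P : Set ZFSet.{u} → (ℕ → ZFSet.{u}) → Prop, UD P →
  (∀ B : ZFSet.{u}, Cardinal.aleph0 ≤ zcard B → B.IsOrdinal → ∀ v : ℕ → ZFSet.{u},
    (∀ n, v n ∈ HS B) → P (HS B).toSet v) →
  ∀ v : ℕ → ZFSet.{u}, (∀ n, v n ∈ D) → P D.toSet v

theorem upd_ite (v : ℕ → ZFSet.{u}) (n : ℕ) (x : ZFSet.{u}) :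
    Function.update v n x = fun m => if m = n then x else v m := by
  funext m; by_cases hm : m = n
  · subst hm; simp
  · simp [hm]

theorem Tfer.tm {D : ZFSet.{u}} (h : Tfer D) (ht : D.IsTransitive) (ho : ZFSet.omega ∈ D) :
    IsTransModel D := by
  refine ⟨ht, ho, ?_, ?_, ?_, ?_, ?_⟩
  · intro x hx y hy
    obtain ⟨z, hz, e⟩ := h (fun D v => ∃ z ∈ D, z = {v 0, v 1}) dfnAutoU
      (fun B hB hBo v hv => ⟨_, HS_upair hB (hv 0) (hv 1), rfl⟩) (fun n => if n = 0 then x else y)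
      (by intro n; split_ifs <;> assumption)
    subst e; exact hz
  · intro x hx
    obtain ⟨z, hz, e⟩ := h (fun D v => ∃ z ∈ D, z = (⋃₀ (v 0) : ZFSet.{u})) dfnAutoU
      (fun B hB hBo v hv => ⟨_, HS_sUnion hB (hv 0), rfl⟩) (fun n => x) (fun n => hx)
    subst e; exact hz
  · intro φ v hv a ha
    have hd : UD (fun D v => ∃ b ∈ D, ∀ x ∈ D, (x ∈ b ↔ x ∈ v 0 ∧
        Sat D φ (Function.update (fun n => v (n + 1)) 0 x))) := by
      have hs : UD (fun D v => Sat D φ (Function.update (fun n => v (n + 1 + 1 + 1)) 0 (v 0))) := by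
        refine (Dfn.sat φ (fun m _ v => if m = 0 then v 0 else v (m + 1 + 1 + 1)) ?_).congr ?_
        · intro m; by_cases hm : m = 0
          · simp only [hm, if_true]; exact DTm.var 0
          · simp only [hm, if_false]; exact DTm.var _
        · intro D hD v hv; simp only [upd_ite]
      exact dfnAutoU
    obtain ⟨b, hb, h1⟩ := h _ hd (fun B hB hBo v hv => ⟨ZFSet.sep (fun x => Sat (HS B).toSet φ
      (Function.update (fun n => v (n + 1)) 0 x)) (v 0), HS_sub hB (hv 0)
        (fun x hx => (ZFSet.mem_sep.1 hx).1), fun x _ => ZFSet.mem_sep⟩) (vcons a v)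
      (by intro n; cases n; exacts [ha, hv _])
    refine ⟨b, hb, fun x => ⟨fun hx => (h1 x (ht b hb hx)).1 hx, fun hx =>
      (h1 x (ht a ha hx.1)).2 hx⟩⟩
  · intro φ v hv a ha hex
    have hd : UD (fun D v => (∀ x ∈ v 0, ∃ y ∈ D, Sat D φ (Function.update (Function.update
          (fun n => v (n + 1)) 0 x) 1 y)) → ∃ b ∈ D, ∀ x ∈ v 0, ∃ y ∈ b,
        Sat D φ (Function.update (Function.update (fun n => v (n + 1)) 0 x) 1 y)) := by
      have hs : ∀ k, UD (fun D v => Sat D φ (Function.update (Function.update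
          (fun n => v (n + k)) 0 (v 1)) 1 (v 0))) := by
        intro k
        refine (Dfn.sat φ (fun m _ v => if m = 1 then v 0 else if m = 0 then v 1 else v (m + k)) ?_).congr ?_
        · intro m; by_cases hm : m = 1
          · simp only [hm, if_true]; exact DTm.var 0
          · by_cases hm' : m = 0
            · simp only [hm', if_true]; exact DTm.var 1
            · simp only [hm, hm', if_false]; exact DTm.var _
        · intro D hD v hv; simp only [upd_ite]
      have h3 := hs 3
      have h4 := hs 4
      refine Dfn.imp (Dfn.ball (DTm.var 0) (Dfn.ex ?_)) (Dfn.ex (Dfn.ball (DTm.var 1)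
        (Dfn.bex (DTm.var 1) ?_)))
      · exact h3
      · exact h4
    obtain ⟨b, hb, h1⟩ := h _ hd (fun B hB hBo v hv hx => HS_coll hB (hv 0) hx) (vcons a v)
      (by intro n; cases n; exacts [ha, hv _]) hex
    exact ⟨b, hb, h1⟩
  · intro x hx
    have hd : UD (fun D v => ∃ r ∈ D, ∃ f ∈ D, WOX (v 0) r f) := by
      refine Dfn.ex (Dfn.ex ?_)
      unfold WOX
      exact dfnAutoU
    obtain ⟨r, hr, f, hf, h1⟩ := h _ hd (fun B hB hBo v hv => HS_wo hB hBo (hv 0)) (fun _ => x)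
      (fun _ => hx)
    exact ⟨r, hr, h1.wo⟩

section up2
variable {κ M U Rf : ZFSet.{u}} [hM : TM M]

theorem UP.zero (h : UP κ M U Rf) : zlam κ (fun _ => ∅) ∈ upF κ M Rf := by
  refine ZFSet.mem_sep.2 ⟨M_lamt h.good.wm.2.1 (fun _ _ => M_empty) dfnAuto, isZFunc_zlam _ _,
    fun α hα => ?_⟩
  rw [fapp_zlam hα]; exact h.R_empty hα

theorem UP.pi_zero (h : UP κ M U Rf) : upPi κ M U Rf (zlam κ (fun _ => ∅)) = ∅ := by
  rw [ZFSet.eq_empty]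
  intro y hy
  obtain ⟨g, hg, h1, _⟩ := h.mem_pi.1 hy
  obtain ⟨ξ, hξ, h2⟩ := h1.exists h.good
  rw [fapp_zlam hξ] at h2
  exact ZFSet.notMem_empty _ h2

theorem UP.upM_uc (h : UP κ M U Rf) : (upM κ M U Rf).toSet ∈ UC :=
  ⟨fun x hx y hy => h.upM_trans x hx hy, mem_upM.2 ⟨_, h.zero, h.pi_zero⟩⟩

theorem UP.losU (h : UP κ M U Rf) {P : Set ZFSet.{u} → (ℕ → ZFSet.{u}) → Prop} (hP : UD P)
    {F : ℕ → ZFSet.{u}} (hF : ∀ n, F n ∈ upF κ M Rf) :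
    P (upM κ M U Rf).toSet (fun n => upPi κ M U Rf (F n)) ↔
      AE κ U (fun ξ => P (fapp Rf ξ).toSet (fun n => fapp (F n) ξ)) := by
  obtain ⟨φ, w, hw, hφ⟩ := hP
  have hw' : w = fun _ => ∅ := funext hw
  subst hw'
  rw [hφ _ h.upM_uc _ (fun n => mem_upM.2 ⟨_, hF n, rfl⟩)]
  have e : mrg (fun n => upPi κ M U Rf (F n)) (fun _ => ∅) = fun n => upPi κ M U Rf
      (mrg F (fun _ => zlam κ (fun _ => ∅)) n) := by
    funext n; unfold mrg; split_ifs
    · rfl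
    · rw [h.pi_zero]
  rw [e, h.los φ]
  · refine AE.congr fun ξ hξ => ?_
    rw [hφ _ (h.R_uc hξ) _ (fun n => up_val (hF n) hξ)]
    have e : mrg (fun n => fapp (F n) ξ) (fun _ => ∅) = fun n => fapp
        (mrg F (fun _ => zlam κ (fun _ => ∅)) n) ξ := by
      funext n; unfold mrg; split_ifs
      · rfl
      · rw [fapp_zlam hξ]
    rw [e]
  · intro n; unfold mrg; split_ifs
    · exact hF _
    · exact h.zero

theorem UP.kord (h : UP κ M U Rf) : κ.IsOrdinal := isOrd_iff.1 h.card.1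

theorem UP.tfer (h : UP κ M U Rf) : Tfer (upM κ M U Rf) := by
  intro P hP hH v hv
  have : ∀ n, ∃ f ∈ upF κ M Rf, upPi κ M U Rf f = v n := fun n => mem_upM.1 (hv n)
  choose F hF1 hF2 using this
  have e : v = fun n => upPi κ M U Rf (F n) := by funext n; rw [hF2]
  rw [e, h.losU hP hF1]
  refine AE.all h.card h.good ?_
  intro ξ hξ
  have hr := h.val ξ hξ
  rw [hr]
  refine hH _ (inf_union _) (union_ord (h.kord.mem hξ) omega_ord) _ ?_
  intro n; rw [← hr]; exact up_val (hF1 n) hξ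

theorem UP.gtR (h : UP κ M U Rf) {γ : ZFSet.{u}} (hγ : γ ∈ κ) :
    AE κ U (fun α => γ ∈ fapp Rf α) := by
  have hRM := h.mem
  have hγM := M_trans h.good.wm.2.1 hγ
  refine AE.mono h.good (AE.gt h.card h.good hγ) dfnAuto ?_
  intro α hα hm
  rw [h.val α hα]
  refine HS_trans _ (HS_self (inf_union _) (union_ord (h.kord.mem hα) omega_ord).isTransitive) ?_
  exact ZFSet.mem_union.2 (Or.inl hm)

theorem UP.const (h : UP κ M U Rf) {γ : ZFSet.{u}} (hγ : γ ∈ κ) :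
    ∃ f ∈ upF κ M Rf, AE κ U (fun α => fapp f α = γ) := by
  have hγM := M_trans h.good.wm.2.1 hγ
  exact h.fn (F := fun _ => γ) dfnAuto (h.gtR hγ)

theorem UP.pi_const (h : UP κ M U Rf) {γ : ZFSet.{u}} : γ ∈ κ → ∀ f ∈ upF κ M Rf,
    AE κ U (fun α => fapp f α = γ) → upPi κ M U Rf f = γ := by
  have hG := h.good
  have hκM := hG.wm.2.1
  induction γ using ZFSet.inductionOn with
  | _ γ ih =>
  intro hγ f hf hae
  have hfM := up_zf hf
  have hγM := M_trans hκM hγ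
  ext y
  rw [h.mem_pi]
  constructor
  · rintro ⟨g, hg, h1, rfl⟩
    have hgM := up_zf hg
    have h2 : AE κ U (fun α => fapp g α ∈ α) := by
      refine AE.mono hG ((h1.and hG hae).and hG (AE.gt h.card hG hγ)) dfnAuto ?_
      rintro α hα ⟨⟨h3, h4⟩, h5⟩
      rw [h4] at h3
      exact (h.kord.mem hα).isTransitive _ h5 h3
    obtain ⟨δ, hδ, h3⟩ := AE.normal hG hgM (ZFSet.mem_sep.1 hg).2.1 h2
    obtain ⟨α, _, ⟨h4, h5⟩, h6⟩ := ((h1.and hG hae).and hG h3).exists hG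
    have : δ ∈ γ := by rw [← h6, ← h5]; exact h4
    rw [ih δ this hδ g hg h3]; exact this
  · intro hy
    have hyκ := h.kord.isTransitive _ hγ hy
    have hyM := M_trans hκM hyκ
    obtain ⟨g, hg, h1⟩ := h.const hyκ
    have hgM := up_zf hg
    refine ⟨g, hg, ?_, (ih y hy hyκ g hg h1).symm⟩
    refine AE.mono hG (h1.and hG hae) dfnAuto ?_
    rintro α hα ⟨h2, h3⟩
    rw [h2, h3]; exact hy

theorem UP.pi_sub (h : UP κ M U Rf) {x f : ZFSet.{u}} (hxM : x ∈ M) (hx : x ⊆ κ)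
    (hf : f ∈ upF κ M Rf) (hae : AE κ U (fun α => fapp f α = x ∩ α)) : upPi κ M U Rf f = x := by
  have hG := h.good
  have hκM := hG.wm.2.1
  have hfM := up_zf hf
  ext y
  rw [h.mem_pi]
  constructor
  · rintro ⟨g, hg, h1, rfl⟩
    have hgM := up_zf hg
    have h2 : AE κ U (fun α => fapp g α ∈ α) := by
      refine AE.mono hG (h1.and hG hae) dfnAuto ?_
      rintro α hα ⟨h3, h4⟩
      rw [h4] at h3
      exact (ZFSet.mem_inter.1 h3).2
    obtain ⟨δ, hδ, h3⟩ := AE.normal hG hgM (ZFSet.mem_sep.1 hg).2.1 h2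
    obtain ⟨α, _, ⟨h4, h5⟩, h6⟩ := ((h1.and hG hae).and hG h3).exists hG
    rw [h.pi_const hδ g hg h3]
    rw [h5, h6] at h4
    exact (ZFSet.mem_inter.1 h4).1
  · intro hy
    have hyκ := hx hy
    have hyM := M_trans hκM hyκ
    obtain ⟨g, hg, h1⟩ := h.const hyκ
    have hgM := up_zf hg
    refine ⟨g, hg, ?_, (h.pi_const hyκ g hg h1).symm⟩
    refine AE.mono hG ((h1.and hG hae).and hG (AE.gt h.card hG hyκ)) dfnAuto ?_
    rintro α hα ⟨⟨h2, h3⟩, h4⟩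
    rw [h2, h3]; exact ZFSet.mem_inter.2 ⟨hy, h4⟩

theorem UP.sub_mem (h : UP κ M U Rf) {x : ZFSet.{u}} (hxM : x ∈ M) (hx : x ⊆ κ) :
    x ∈ upM κ M U Rf := by
  have hRM := h.mem
  obtain ⟨f, hf, h1⟩ := h.fn (F := fun α => x ∩ α) dfnAuto (by
    refine AE.all h.card h.good ?_
    intro α hα
    rw [h.val α hα]
    refine HS_sub (inf_union _) (HS_self (inf_union _)
      (union_ord (h.kord.mem hα) omega_ord).isTransitive) ?_
    intro z hz
    exact ZFSet.mem_union.2 (Or.inl (ZFSet.mem_inter.1 hz).2))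
  exact mem_upM.2 ⟨f, hf, h.pi_sub hxM hx hf h1⟩

theorem UP.idf (h : UP κ M U Rf) : ∃ f ∈ upF κ M Rf, AE κ U (fun α => fapp f α = α) ∧
    upPi κ M U Rf f = κ := by
  have hG := h.good
  have hRM := h.mem
  have hκM := hG.wm.2.1
  obtain ⟨f, hf, h1⟩ := h.fn (F := fun α => α) dfnAuto (by
    refine AE.mono hG (AE.gt h.card hG (hG.omega_mem h.card)) dfnAuto ?_
    intro α hα hm
    rw [h.val α hα]
    refine HS_sub (inf_union _) (HS_self (inf_union _)
      (union_ord (h.kord.mem hα) omega_ord).isTransitive) ?_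
    intro z hz
    exact ZFSet.mem_union.2 (Or.inl hz))
  have hfM := up_zf hf
  refine ⟨f, hf, h1, h.pi_sub hκM (fun _ h => h) hf ?_⟩
  refine AE.mono hG h1 dfnAuto ?_
  intro α hα h2
  rw [h2]; ext z
  rw [ZFSet.mem_inter]
  exact ⟨fun hz => ⟨h.kord.isTransitive _ hα hz, hz⟩, fun hz => hz.2⟩

theorem UP.k_mem (h : UP κ M U Rf) : κ ∈ upM κ M U Rf := h.sub_mem h.good.wm.2.1 (fun _ h => h)

theorem UP.tm (h : UP κ M U Rf) : IsTransModel (upM κ M U Rf) :=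
  h.tfer.tm h.upM_trans (h.upM_trans _ h.k_mem (h.good.omega_mem h.card))

theorem zcard_upM : zcard (upM κ M U Rf) ≤ zcard M :=
  (zcard_zimg_le _ _).trans (zcard_mono (fun _ h => (ZFSet.mem_sep.1 h).1))

end up2

theorem pair_un2 {a b f : ZFSet.{u}} (h : ZFSet.pair a b ∈ f) :
    b ∈ (⋃₀ (⋃₀ f : ZFSet.{u}) : ZFSet.{u}) := by
  refine ZFSet.mem_sUnion.2 ⟨{a, b}, ZFSet.mem_sUnion.2 ⟨_, h, ?_⟩, ?_⟩
  · simp [ZFSet.pair]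
  · simp

theorem isZFunc_iff {d f : ZFSet.{u}} : IsZFunc d f ↔
    (∀ p ∈ f, ∃ a ∈ d, ∃ b ∈ (⋃₀ (⋃₀ f : ZFSet.{u}) : ZFSet.{u}), p = ZFSet.pair a b) ∧
    ∀ a ∈ d, ∃ b ∈ (⋃₀ (⋃₀ f : ZFSet.{u}) : ZFSet.{u}), ZFSet.pair a b ∈ f ∧
      ∀ c ∈ (⋃₀ (⋃₀ f : ZFSet.{u}) : ZFSet.{u}), ZFSet.pair a c ∈ f → c = b := by
  constructor
  · rintro ⟨h1, h2⟩
    refine ⟨fun p hp => ?_, fun a ha => ?_⟩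
    · obtain ⟨a, ha, b, rfl⟩ := h1 p hp
      exact ⟨a, ha, b, pair_un2 hp, rfl⟩
    · obtain ⟨b, hb, hu⟩ := h2 a ha
      exact ⟨b, pair_un2 hb, hb, fun c _ hc => hu c hc⟩
  · rintro ⟨h1, h2⟩
    refine ⟨fun p hp => ?_, fun a ha => ?_⟩
    · obtain ⟨a, ha, b, _, rfl⟩ := h1 p hp
      exact ⟨a, ha, b, rfl⟩
    · obtain ⟨b, _, hb, hu⟩ := h2 a ha
      exact ⟨b, hb, fun c hc => hu c (pair_un2 hc) hc⟩

theorem Dfn.isBij {𝒞 : Set (Set ZFSet.{u})} {C : Set ZFSet.{u}} [hc : Ctx 𝒞 C]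
    {f d y : Set ZFSet.{u} → (ℕ → ZFSet.{u}) → ZFSet.{u}} (hf : DTm 𝒞 C f) (hd : DTm 𝒞 C d)
    (hy : DTm 𝒞 C y) : Dfn 𝒞 C (fun D v => IsBij (f D v) (d D v) (y D v)) := by
  have f1 := hf.shift
  have d1 := hd.shift
  have y1 := hy.shift
  have f2 := f1.shift
  have d2 := d1.shift
  have y2 := y1.shift
  have f3 := f2.shift
  have h : Dfn 𝒞 C (fun D v =>
    ((∀ p ∈ f D v, ∃ a ∈ d D v, ∃ b ∈ (⋃₀ (⋃₀ (f D v) : ZFSet.{u}) : ZFSet.{u}), p = ZFSet.pair a b) ∧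
    ∀ a ∈ d D v, ∃ b ∈ (⋃₀ (⋃₀ (f D v) : ZFSet.{u}) : ZFSet.{u}), ZFSet.pair a b ∈ f D v ∧
      ∀ c ∈ (⋃₀ (⋃₀ (f D v) : ZFSet.{u}) : ZFSet.{u}), ZFSet.pair a c ∈ f D v → c = b) ∧
    ((∀ a ∈ d D v, MPaper.fapp (f D v) a ∈ y D v) ∧
      ∀ b ∈ y D v, ∃ a ∈ d D v, MPaper.fapp (f D v) a = b) ∧
    ∀ a ∈ d D v, ∀ b ∈ d D v, MPaper.fapp (f D v) a = MPaper.fapp (f D v) b → a = b) := dfnAutoU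
  refine h.congr fun D hD v hv => ?_
  unfold IsBij SurjOnto MapsInto InjOnZ
  rw [isZFunc_iff]

theorem dfnAutoB {p : Prop} (h : p := by
  repeat' first
    | assumption
    | exact DTm.dom
    | exact DTm.var _
    | exact DTm.constM (by assumption)
    | apply DTm.fapp
    | apply DTm.union
    | apply DTm.inter
    | apply DTm.sUnion
    | apply DTm.sep
    | apply Dfn.isBij
    | exact Dfn.prop _
    | apply Dfn.exM
    | apply Dfn.allM
    | apply Dfn.bex
    | apply Dfn.ball
    | apply Dfn.and
    | apply Dfn.or
    | apply Dfn.iff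
    | apply Dfn.memPair
    | apply Dfn.eqPair
    | apply Dfn.mem
    | apply Dfn.eq
    | apply Dfn.subset
    | apply Dfn.neg
    | apply Dfn.imp) : p := h

section up3
variable {κ M U Rf : ZFSet.{u}} [hM : TM M]

theorem M_qsurj (hC : IsCard κ) (hi : Cardinal.aleph0 ≤ zcard κ) (hκ : κ ∈ M) :
    ∃ q ∈ M, ∀ p ∈ κ.prod κ, ∃ ξ ∈ κ, fapp q ξ = p := by
  have hg := gdG_in hκ
  have hP := M_prod hκ hκ
  obtain ⟨q, hq, hfun, h⟩ := M_choice hκ hP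
    (Q := fun ξ p => fapp (zlam (κ.prod κ) (gdG κ)) p = ξ) dfnAuto
  refine ⟨q, hq, fun p hp => ⟨gdG κ p, gdG_mem hC hi hp, ?_⟩⟩
  obtain ⟨h1, h2⟩ := (h _ (gdG_mem hC hi hp)).1 ⟨p, hp, fapp_zlam hp⟩
  rw [fapp_zlam h1] at h2
  exact gdG_inj (isOrd_iff.1 hC.1) h1 hp h2

theorem UP.const_pi (h : UP κ M U Rf) {γ : ZFSet.{u}} (hγ : γ ∈ κ) :
    ∃ f ∈ upF κ M Rf, AE κ U (fun α => fapp f α = γ) ∧ upPi κ M U Rf f = γ := by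
  obtain ⟨f, hf, h1⟩ := h.const hγ
  exact ⟨f, hf, h1, h.pi_const hγ f hf h1⟩

theorem UP.mem_const (h : UP κ M U Rf) {γ f : ZFSet.{u}} (hγ : γ ∈ κ) (hf : f ∈ upF κ M Rf) :
    γ ∈ upPi κ M U Rf f ↔ AE κ U (fun α => γ ∈ fapp f α) := by
  have hγM := M_trans h.good.wm.2.1 hγ
  have hfM := up_zf hf
  obtain ⟨c, hc, h1, h2⟩ := h.const_pi hγ
  have hcM := up_zf hc
  conv_lhs => rw [← h2]
  rw [h.pi_mem hc hf]
  constructor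
  · intro h3; exact AE.mono h.good (h3.and h.good h1) dfnAuto (fun _ _ h => h.2 ▸ h.1)
  · intro h3; exact AE.mono h.good (h3.and h.good h1) dfnAuto (fun _ _ h => h.2.symm ▸ h.1)

theorem UP.pair_const (h : UP κ M U Rf) {γ δ f : ZFSet.{u}} (hγ : γ ∈ κ) (hδ : δ ∈ κ)
    (hf : f ∈ upF κ M Rf) :
    ZFSet.pair γ δ ∈ upPi κ M U Rf f ↔ AE κ U (fun α => ZFSet.pair γ δ ∈ fapp f α) := by
  have hγM := M_trans h.good.wm.2.1 hγ
  have hδM := M_trans h.good.wm.2.1 hδ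
  have hfM := up_zf hf
  obtain ⟨c, hc, h1, h2⟩ := h.const_pi hγ
  obtain ⟨d, hd, h3, h4⟩ := h.const_pi hδ
  have hcM := up_zf hc
  have hdM := up_zf hd
  have hl := h.losU (P := fun _ v => ZFSet.pair (v 0) (v 1) ∈ v 2) dfnAutoU
    (F := fun n => if n = 0 then c else if n = 1 then d else f)
    (by intro n; split_ifs <;> assumption)
  simp only [if_true, if_false, one_ne_zero, OfNat.ofNat_ne_zero, OfNat.ofNat_ne_one, h2, h4] at hl
  rw [hl]
  constructor
  · intro h5
    refine AE.mono h.good ((h5.and h.good h1).and h.good h3) dfnAuto ?_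
    rintro α _ ⟨⟨h6, h7⟩, h8⟩
    rwa [h7, h8] at h6
  · intro h5
    refine AE.mono h.good ((h5.and h.good h1).and h.good h3) dfnAuto ?_
    rintro α _ ⟨⟨h6, h7⟩, h8⟩
    rwa [h7, h8]

theorem UP.down1 (h : UP κ M U Rf) {x : ZFSet.{u}} (hx : x ∈ upM κ M U Rf) (hs : x ⊆ κ) : x ∈ M := by
  obtain ⟨f, hf, rfl⟩ := mem_upM.1 hx
  have hfM := up_zf hf
  have := M_waκ h.good (Q := fun γ α => γ ∈ fapp f α) dfnAuto
  convert this using 1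
  ext γ
  rw [ZFSet.mem_sep]
  constructor
  · intro hγ; exact ⟨hs hγ, (h.mem_const (hs hγ) hf).1 hγ⟩
  · rintro ⟨h1, h2⟩; exact (h.mem_const h1 hf).2 h2

theorem UP.down2 (h : UP κ M U Rf) {x : ZFSet.{u}} (hx : x ∈ upM κ M U Rf)
    (hs : x ⊆ κ.prod κ) : x ∈ M := by
  obtain ⟨f, hf, rfl⟩ := mem_upM.1 hx
  have hfM := up_zf hf
  have hκM := h.good.wm.2.1
  obtain ⟨q, hq, hqs⟩ := M_qsurj h.card h.good.inf hκM
  have := M_wa h.good (M_prod hκM hκM) hq hqs (Q := fun p α => p ∈ fapp f α) dfnAuto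
  convert this using 1
  ext p
  rw [ZFSet.mem_sep]
  constructor
  · intro hp
    obtain ⟨γ, hγ, δ, hδ, rfl⟩ := ZFSet.mem_prod.1 (hs hp)
    exact ⟨hs hp, (h.pair_const hγ hδ hf).1 hp⟩
  · rintro ⟨h1, h2⟩
    obtain ⟨γ, hγ, δ, hδ, rfl⟩ := ZFSet.mem_prod.1 h1
    exact (h.pair_const hγ hδ hf).2 h2

theorem UP.step (h : UP κ M U Rf) {Es : ZFSet.{u}} (hE : Es ∈ M)
    (hEs : ∀ α ∈ κ, ∀ X, ZFSet.pair α X ∈ Es ↔ X ∈ fapp Rf α ∧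
      ElemSub X.toSet (fapp Rf α).toSet) {a : ZFSet.{u}} (ha : a ∈ upM κ M U Rf) :
    ∃ s ∈ upM κ M U Rf, ∃ b ∈ upM κ M U Rf, a ∈ s ∧ s.IsTransitive ∧
      ElemSub s.toSet (upM κ M U Rf).toSet ∧ IsBij b κ s := by
  have hG := h.good
  have hRM := h.mem
  have hκM := hG.wm.2.1
  obtain ⟨f, hf, rfl⟩ := mem_upM.1 ha
  have hfM := up_zf hf
  have hb1 : MD M (fun _ v => IsBij (v 0) (v 1) (v 2)) :=
    Dfn.isBij (DTm.var 0) (DTm.var 1) (DTm.var 2)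
  obtain ⟨s, hs, hs1⟩ := h.choice (Q := fun α X => ZFSet.pair α X ∈ Es ∧ fapp f α ∈ X ∧
    (∀ x ∈ X, ∀ y ∈ x, y ∈ X) ∧ ∃ b ∈ fapp Rf α, IsBij b α X) dfnAutoB (by
      refine AE.mono hG (AE.gt h.card hG (hG.omega_mem h.card)) dfnAutoB ?_
      intro α hα hω
      have hαo := h.kord.mem hα
      have e : α ∪ ZFSet.omega = α := by
        ext z; rw [ZFSet.mem_union]
        exact ⟨fun hz => hz.elim id (fun hz => hαo.isTransitive _ hω hz), Or.inl⟩
      have hv := h.val α hα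
      have hinf := inf_union α
      rw [e] at hv hinf
      obtain ⟨X, hX, h1, h2, h3, h4, b, h5, h6⟩ := HS_LS hinf hαo.isTransitive
        (a := fapp f α) (by rw [← hv]; exact up_val hf hα)
      rw [← hv] at hX h4 h5
      exact ⟨X, hX, (hEs α hα X).2 ⟨hX, h4⟩, h2, fun x hx y hy => h1 x hx hy, b, h5, h6⟩)
  have hsM := up_zf hs
  have hb2 : MD M (fun _ v => IsBij (v 1) (v 0) (fapp s (v 0))) :=
    Dfn.isBij (DTm.var 1) (DTm.var 0) dfnAutoB
  have hb3 : MD M (fun _ v => IsBij (v 0) (v 1) (fapp s (v 1))) :=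
    Dfn.isBij (DTm.var 0) (DTm.var 1) dfnAutoB
  obtain ⟨b, hb, hb4⟩ := h.choice (Q := fun α b => IsBij b α (fapp s α)) hb2
    (AE.mono hG hs1 dfnAutoB (fun _ _ h => h.2.2.2))
  have hbM := up_zf hb
  obtain ⟨i, hi, hi1, hi2⟩ := h.idf
  have hiM := up_zf hi
  refine ⟨_, mem_upM.2 ⟨s, hs, rfl⟩, _, mem_upM.2 ⟨b, hb, rfl⟩, ?_, ?_, ?_, ?_⟩
  · rw [h.pi_mem hf hs]
    exact AE.mono hG hs1 dfnAutoB (fun _ _ h => h.2.1)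
  · have hl := h.losU (P := fun _ v => ∀ x ∈ v 0, ∀ y ∈ x, y ∈ v 0) dfnAutoU
      (F := fun _ => s) (fun _ => hs)
    exact fun x hx y hy => hl.2 (AE.mono hG hs1 dfnAutoB (fun _ _ h => h.2.2.1)) x hx y hy
  · refine ⟨fun x hx => h.upM_trans _ (mem_upM.2 ⟨s, hs, rfl⟩) hx, fun φ v hv => ?_⟩
    have : ∀ n, ∃ g ∈ upF κ M Rf, AE κ U (fun ξ => fapp g ξ ∈ fapp s ξ) ∧ v n = upPi κ M U Rf g :=
      fun n => h.mem_pi.1 (hv n)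
    choose F hF1 hF2 hF3 using this
    have e : v = fun n => upPi κ M U Rf (F n) := funext hF3
    have hu : UD (fun _ v => Sat (v 0).toSet φ (fun n => v (n + 1))) :=
      Dfn.satIn (DTm.var 0) φ (t := fun n _ v => v (n + 1)) (fun n => DTm.var (n + 1))
    have hl := h.losU hu (F := vcons s F) (by intro n; cases n; exacts [hs, hF1 _])
    have hl' : Sat (upPi κ M U Rf s).toSet φ (fun n => upPi κ M U Rf (F n)) ↔
      AE κ U (fun ξ => Sat (fapp s ξ).toSet φ (fun n => fapp (F n) ξ)) := hl
    have hd1 : MD M (fun _ v => Sat (fapp s (v 0)).toSet φ (fun n => fapp (F n) (v 0))) :=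
      Dfn.satIn (DTm.fapp (DTm.constM hsM) (DTm.var 0)) φ (t := fun n _ v => fapp (F n) (v 0))
        (fun n => DTm.fapp (DTm.constM (up_zf (hF1 n))) (DTm.var 0))
    rw [e, hl', h.los φ hF1]
    by_contra hne
    have hdiff : AE κ U (fun ξ => ¬ (Sat (fapp s ξ).toSet φ (fun n => fapp (F n) ξ) ↔
        Sat (fapp Rf ξ).toSet φ (fun n => fapp (F n) ξ))) := by
      have hsd := h.sat_md φ hF1
      rw [← AE.not hG (P := fun ξ => (Sat (fapp s ξ).toSet φ (fun n => fapp (F n) ξ) ↔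
        Sat (fapp Rf ξ).toSet φ (fun n => fapp (F n) ξ))) (hd1.iff hsd)]
      intro hc
      apply hne
      exact ⟨fun h1 => AE.mono hG (hc.and hG h1) hsd (fun _ _ h => h.1.1 h.2),
        fun h1 => AE.mono hG (hc.and hG h1) hd1 (fun _ _ h => h.1.2 h.2)⟩
    obtain ⟨ξ, hξ, hall⟩ := AE.omega hG (P := fun n ξ => fapp (F n) ξ ∈ fapp s ξ ∧
      ZFSet.pair ξ (fapp s ξ) ∈ Es ∧ ¬ (Sat (fapp s ξ).toSet φ (fun n => fapp (F n) ξ) ↔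
        Sat (fapp Rf ξ).toSet φ (fun n => fapp (F n) ξ))) (fun n =>
        (hF2 n).and hG ((AE.mono (Q := fun ξ => ZFSet.pair ξ (fapp s ξ) ∈ Es) hG hs1 dfnAutoB
          (fun _ _ h => h.1)).and hG hdiff))
    exact (hall 0).2.2 (((hEs ξ hξ _).1 (hall 0).2.1).2.2 φ _ (fun n => (hall n).1))
  · have hl := h.losU (P := fun _ v => IsBij (v 0) (v 1) (v 2))
      (Dfn.isBij (DTm.var 0) (DTm.var 1) (DTm.var 2))
      (F := fun n => if n = 0 then b else if n = 1 then i else s)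
      (by intro n; split_ifs <;> assumption)
    simp only [if_true, if_false, one_ne_zero, OfNat.ofNat_ne_zero, OfNat.ofNat_ne_one, hi2] at hl
    refine hl.2 (AE.mono hG (hb4.and hG hi1) (Dfn.isBij dfnAutoB dfnAutoB dfnAutoB) ?_)
    rintro α _ ⟨h1, h2⟩
    rw [h2]; exact h1

/-- fragments of `U` lie in the ultraproduct -/
theorem UP.frag (h : UP κ M U Rf) {s b : ZFSet.{u}} (hs : s ∈ upM κ M U Rf)
    (hb : b ∈ upM κ M U Rf) (hB : IsBij b κ s) :
    s ∩ U ∈ upM κ M U Rf := by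
  have hG := h.good
  have hκM := hG.wm.2.1
  have hκ' := h.k_mem
  haveI : TM (upM κ M U Rf) := ⟨h.tm⟩
  have hS := M_sep (M_prod hκ' hκ') (Q := fun p => ∃ ξ ∈ κ, ∃ η ∈ κ, p = ZFSet.pair ξ η ∧
    η ∈ fapp b ξ) dfnAuto
  have hSM := h.down2 hS (fun p hp => (ZFSet.mem_sep.1 hp).1)
  have hpS : ∀ ξ ∈ κ, ∀ η ∈ κ, (ZFSet.pair ξ η ∈ ZFSet.sep (fun p => ∃ ξ ∈ κ, ∃ η ∈ κ,
      p = ZFSet.pair ξ η ∧ η ∈ fapp b ξ) (κ.prod κ) ↔ η ∈ fapp b ξ) := by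
    intro ξ hξ η hη
    rw [ZFSet.mem_sep]
    constructor
    · rintro ⟨_, ξ', _, η', _, h0, h1⟩
      obtain ⟨rfl, rfl⟩ := ZFSet.pair_inj.1 h0
      exact h1
    · intro h1; exact ⟨ZFSet.pair_mem_prod.2 ⟨hξ, hη⟩, ξ, hξ, η, hη, rfl, h1⟩
  generalize ZFSet.sep (fun p => ∃ ξ ∈ κ, ∃ η ∈ κ,
      p = ZFSet.pair ξ η ∧ η ∈ fapp b ξ) (κ.prod κ) = S at hS hSM hpS
  have huM := M_waκ hG (Q := fun ξ η => ZFSet.pair ξ η ∈ S) dfnAuto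
  have hu := h.sub_mem huM (fun p hp => (ZFSet.mem_sep.1 hp).1)
  generalize hue : ZFSet.sep (fun ξ => AE κ U (fun η => ZFSet.pair ξ η ∈ S)) κ = w at hu huM
  have := M_sep hs (Q := fun y => y ⊆ κ ∧ ∃ ξ ∈ w, fapp b ξ = y) dfnAuto
  convert this using 1
  ext y
  rw [ZFSet.mem_inter, ZFSet.mem_sep]
  refine and_congr_right fun hy => ?_
  have key : ∀ ξ ∈ κ, fapp b ξ ⊆ κ → (fapp b ξ ∈ U ↔ ξ ∈ w) := by
    intro ξ hξ hsub
    rw [← hue, ZFSet.mem_sep]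
    have : fapp b ξ = ZFSet.sep (fun η => ZFSet.pair ξ η ∈ S) κ := by
      ext η
      rw [ZFSet.mem_sep]
      exact ⟨fun hη => ⟨hsub hη, (hpS ξ hξ η (hsub hη)).2 hη⟩, fun hη => (hpS ξ hξ η hη.1).1 hη.2⟩
    rw [this]
    exact ⟨fun h => ⟨hξ, h⟩, fun h => h.2⟩
  constructor
  · intro hyU
    have hyκ := (hG.uf.1 y hyU).2
    obtain ⟨ξ, hξ, rfl⟩ := hB.2.1.2 y hy
    exact ⟨hyκ, ξ, (key ξ hξ hyκ).1 hyU, rfl⟩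
  · rintro ⟨hyκ, ξ, hξ, rfl⟩
    have : ξ ∈ κ := by rw [← hue] at hξ; exact (ZFSet.mem_sep.1 hξ).1
    exact (key ξ this hyκ).2 hξ

end up3

theorem elem_union {s : ℕ → ZFSet.{u}} {E N : ZFSet.{u}} (hmono : ∀ n, s n ⊆ s (n + 1))
    (hs : ∀ n, ElemSub (s n).toSet E.toSet) (hN : ∀ z, z ∈ N ↔ ∃ n, z ∈ s n) :
    ElemSub N.toSet E.toSet := by
  refine elemSub_of_tv ?_ ?_
  · intro z hz
    obtain ⟨n, hn⟩ := (hN z).1 hz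
    exact (hs n).1 hn
  · rintro φ v hv n ⟨x, hx, hxs⟩
    obtain ⟨m, hm⟩ := sat_support.{u} φ
    obtain ⟨k, hk⟩ := chain_bound hmono v (fun i => (hN _).1 (hv i)) (m + 1)
    let v' : ℕ → ZFSet.{u} := fun i => if i < m + 1 then v i else v 0
    have hv' : ∀ i, v' i ∈ s k := by
      intro i
      by_cases h : i < m + 1
      · simp only [v', if_pos h]; exact hk i h
      · simp only [v', if_neg h]; exact hk 0 (Nat.succ_pos m)
    have key : ∀ D z, Sat D φ (Function.update v n z) ↔ Sat D φ (Function.update v' n z) := by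
      intro D z
      refine hm _ _ _ (fun i hi => ?_)
      by_cases hin : i = n
      · subst hin; simp
      · have : i < m + 1 := by omega
        rw [Function.update_of_ne hin, Function.update_of_ne hin]
        simp only [v', if_pos this]
    have h1 : ¬ Sat E.toSet (.all n φ) v' := fun h => hxs ((key _ x).2 (h x hx))
    rw [← (hs k).2 _ _ hv'] at h1
    have h2 : ∃ y ∈ s k, ¬ Sat (s k).toSet φ (Function.update v' n y) := by
      by_contra hc
      push Not at hc
      exact h1 (fun y hy => hc y hy)
    obtain ⟨y, hy, hys⟩ := h2
    refine ⟨y, (hN y).2 ⟨k, hy⟩, fun h => hys ?_⟩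
    rw [(hs k).2]
    · exact (key _ y).1 h
    · intro i
      by_cases hin : i = n
      · subst hin; rw [Function.update_self]; exact hy
      · rw [Function.update_of_ne hin]; exact hv' i

theorem Tfer.elem {D E : ZFSet.{u}} (h : Tfer E) (hDE : ElemSub D.toSet E.toSet)
    (hD : D.toSet ∈ UC) (hE : E.toSet ∈ UC) : Tfer D := by
  intro P hP hH v hv
  have h1 := h P hP hH v (fun n => hDE.1 (hv n))
  obtain ⟨φ, w, hw, hφ⟩ := hP
  rw [hφ _ hD _ hv]
  rw [hφ _ hE _ (fun n => hDE.1 (hv n))] at h1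
  rw [hDE.2]
  · exact h1
  · intro n
    unfold mrg
    split_ifs
    · exact hv _
    · rw [show w (n / 2) = ∅ from hw _]; exact hD.2

theorem setup {κ : ZFSet.{u}} (hR : IsRamseyCard κ) {A : ZFSet.{u}} (hA : A ⊆ κ) :
    ∃ M U Rf Es, UP κ M U Rf ∧ A ∈ M ∧ Es ∈ M ∧
      ∀ α ∈ κ, ∀ X, ZFSet.pair α X ∈ Es ↔ X ∈ fapp Rf α ∧
      ElemSub X.toSet (fapp Rf α).toSet := by
  obtain ⟨M0, U0, hG0, -⟩ := ramsey_good hR hA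
  have hinf := hG0.inf
  haveI := hG0.tm
  have hω := hG0.omega_mem hR.1
  have hko : κ.IsOrdinal := isOrd_iff.1 hR.1.1
  let R : ZFSet.{u} → ZFSet.{u} := fun α => HS (α ∪ ZFSet.omega)
  have hRH : ∀ α ∈ κ, R α ∈ HS κ := fun α hα => mem_HS.2 (Hp_trans hinf HS_trans
    ((zcard_HS (inf_union α)).trans (ramsey_strongLimit hR (union_mem hko hα hω))))
  have hκ := HS_self hinf hko.isTransitive
  have hAH := HS_sub hinf hκ hA
  have hRf := HS_zlam hinf hκ hRH
  let Es := ZFSet.sep (fun p => ∃ α X, p = ZFSet.pair α X ∧ X ∈ R α ∧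
    ElemSub X.toSet (R α).toSet) (κ.prod (⋃₀ (zimg κ R) : ZFSet.{u}))
  have hEs : Es ∈ HS κ := HS_sub hinf (HS_prod hinf hκ (HS_sUnion hinf (HS_zimg hinf hκ hRH)))
    (fun p hp => (ZFSet.mem_sep.1 hp).1)
  obtain ⟨t, ht1, ht2, ht3⟩ := mem_HS.1 (HS_pair hinf hAH (HS_pair hinf hRf hEs))
  obtain ⟨M, U, hG, hT⟩ := ramsey_hered hR ht2 ht1 ht3
  haveI := hG.tm
  obtain ⟨h1, h2⟩ := M_of_pair' hT
  obtain ⟨h3, h4⟩ := M_of_pair' h2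
  refine ⟨M, U, zlam κ R, Es, ⟨hR.1, hG, h3, isZFunc_zlam _ _, fun α hα => fapp_zlam hα⟩, h1, h4, ?_⟩
  intro α hα X
  rw [fapp_zlam hα]
  constructor
  · intro h
    obtain ⟨-, α', X', e, h5⟩ := ZFSet.mem_sep.1 h
    obtain ⟨rfl, rfl⟩ := ZFSet.pair_inj.1 e
    exact h5
  · intro h
    refine ZFSet.mem_sep.2 ⟨ZFSet.pair_mem_prod.2 ⟨hα, ?_⟩, α, X, rfl, h⟩
    exact ZFSet.mem_sUnion.2 ⟨R α, mem_zimg.2 ⟨α, hα, rfl⟩, h.1⟩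

theorem UP.chain {κ M U Rf : ZFSet.{u}} [hM : TM M] (h : UP κ M U Rf) {Es A : ZFSet.{u}} (hE : Es ∈ M)
    (hEs : ∀ α ∈ κ, ∀ X, ZFSet.pair α X ∈ Es ↔ X ∈ fapp Rf α ∧
      ElemSub X.toSet (fapp Rf α).toSet) (hA : A ∈ upM κ M U Rf) :
    ∃ s b : ℕ → ZFSet.{u}, (∀ n, s n ∈ upM κ M U Rf) ∧ (∀ n, (s n).IsTransitive) ∧
      (∀ n, ElemSub (s n).toSet (upM κ M U Rf).toSet) ∧ (∀ n, IsBij (b n) κ (s n)) ∧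
      A ∈ s 0 ∧ κ ∈ s 0 ∧ ∀ n, s n ∈ s (n + 1) ∧ b n ∈ s (n + 1) ∧ s n ∩ U ∈ s (n + 1) := by
  haveI : TM (upM κ M U Rf) := ⟨h.tm⟩
  have hst := fun a (ha : a ∈ upM κ M U Rf) => h.step hE hEs ha
  choose! S hS B hB h1 h2 h3 h4 using hst
  let nx : ZFSet.{u} → ZFSet.{u} := fun a => ZFSet.pair (S a) (ZFSet.pair (B a) (S a ∩ U))
  let a : ℕ → ZFSet.{u} := fun n => Nat.rec (ZFSet.pair A κ) (fun _ x => nx x) n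
  have ha : ∀ n, a n ∈ upM κ M U Rf := by
    intro n
    induction n with
    | zero => exact M_pair hA h.k_mem
    | succ n ih => exact M_pair (hS _ ih) (M_pair (hB _ ih) (h.frag (hS _ ih) (hB _ ih) (h4 _ ih)))
  have tp : ∀ {t x y : ZFSet.{u}}, t.IsTransitive → ZFSet.pair x y ∈ t → x ∈ t ∧ y ∈ t := by
    intro t x y ht hp
    have := ht _ (ht _ hp (show ({x, y} : ZFSet.{u}) ∈ ZFSet.pair x y by simp [ZFSet.pair]))
    exact ⟨this (by simp), this (by simp)⟩
  have h0 := tp (h2 _ (ha 0)) (h1 _ (ha 0))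
  refine ⟨fun n => S (a n), fun n => B (a n), fun n => hS _ (ha n), fun n => h2 _ (ha n),
    fun n => h3 _ (ha n), fun n => h4 _ (ha n), h0.1, h0.2, fun n => ?_⟩
  have h5 : ZFSet.pair (S (a n)) (ZFSet.pair (B (a n)) (S (a n) ∩ U)) ∈ S (a (n + 1)) :=
    h1 _ (ha (n + 1))
  have h6 := tp (h2 _ (ha (n + 1))) h5
  exact ⟨h6.1, tp (h2 _ (ha (n + 1))) h6.2⟩

theorem UP.ultra {κ M U Rf : ZFSet.{u}} [hM : TM M] (h : UP κ M U Rf) {N : ZFSet.{u}} [hN : TM N]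
    (hNs : N ⊆ upM κ M U Rf) (hκ : κ ∈ N) : IsMUltrafilter κ N (U ∩ N) := by
  have hG := h.good
  have hκM := hG.wm.2.1
  have hκ' := h.k_mem
  haveI : TM (upM κ M U Rf) := ⟨h.tm⟩
  obtain ⟨u1, u2, u3, u4, u5, u6, u7⟩ := hG.uf
  have hd : ∀ B ∈ N, B ⊆ κ → B ∈ M := fun B hB hs => h.down1 (hNs hB) hs
  refine ⟨?_, ?_, ?_, ?_, ?_, ?_, ?_⟩
  · intro A hA
    rw [ZFSet.mem_inter] at hA
    exact ⟨hA.2, (u1 A hA.1).2⟩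
  · intro α hα
    have hαN := M_trans hκ hα
    exact ZFSet.mem_inter.2 ⟨u2 α hα, M_sep hκ (Q := fun ξ => ξ ∉ α) dfnAuto⟩
  · intro h0; exact u3 (ZFSet.mem_inter.1 h0).1
  · intro A hA B hB
    rw [ZFSet.mem_inter] at *
    exact ⟨u4 A hA.1 B hB.1, M_inter hA.2 hB.2⟩
  · intro A hA B hB hs hAB
    rw [ZFSet.mem_inter] at *
    exact ⟨u5 A hA.1 B (hd B hB hs) hs hAB, hB⟩
  · intro B hB hs
    rw [ZFSet.mem_inter, ZFSet.mem_inter]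
    rcases u6 B (hd B hB hs) hs with h1 | h1
    · exact Or.inl ⟨h1, hB⟩
    · exact Or.inr ⟨h1, M_sep hκ (Q := fun ξ => ξ ∉ B) dfnAuto⟩
  · intro f hf hfun hreg
    have hreg' := (ZFSet.mem_inter.1 hreg).1
    have hfu := hNs hf
    have hZ : ZFSet.sep (fun p => p ∈ f) (κ.prod κ) ∈ M :=
      h.down2 (M_sep (M_prod hκ' hκ') dfnAuto) (fun p hp => (ZFSet.mem_sep.1 hp).1)
    generalize hZe : ZFSet.sep (fun p => p ∈ f) (κ.prod κ) = Z at hZ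
    have hpZ : ∀ ξ ∈ κ, ∀ η ∈ κ, ZFSet.pair ξ η ∈ Z ↔ fapp f ξ = η := by
      intro ξ hξ η hη
      rw [hfun.fapp_eq_iff hξ, ← hZe, ZFSet.mem_sep]
      exact ⟨fun h => h.2, fun h => ⟨ZFSet.pair_mem_prod.2 ⟨hξ, hη⟩, h⟩⟩
    obtain ⟨g, hg, hgf, hgc⟩ := M_choice hκM hκM
      (Q := fun ξ η => ZFSet.pair ξ η ∈ Z ∧ η ∈ ξ) dfnAuto
    have hgeq : ∀ ξ ∈ κ, fapp f ξ ∈ ξ → fapp g ξ = fapp f ξ := by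
      intro ξ hξ hr
      have hfκ : fapp f ξ ∈ κ := h.kord.isTransitive _ hξ hr
      obtain ⟨g1, g2, -⟩ := (hgc ξ hξ).1 ⟨fapp f ξ, hfκ, (hpZ ξ hξ _ hfκ).2 rfl, hr⟩
      exact ((hpZ ξ hξ _ g1).1 g2).symm
    obtain ⟨γ, hγ, hγU⟩ := AE.normal hG hg hgf
      (AE.mono (P := fun ξ => fapp f ξ ∈ ξ) hG hreg' dfnAuto
        (fun ξ hξ hr => by rw [hgeq ξ hξ hr]; exact hr))
    have hγN := M_trans hκ hγ
    have hBN : ZFSet.sep (fun ξ => fapp f ξ = γ) κ ∈ N := M_sep hκ dfnAuto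
    refine ⟨γ, hγ, ZFSet.mem_inter.2 ⟨?_, hBN⟩⟩
    have hBs : ZFSet.sep (fun ξ => fapp f ξ = γ) κ ⊆ κ := fun x hx => (ZFSet.mem_sep.1 hx).1
    refine u5 _ (u4 _ hγU _ hreg') _ (hd _ hBN hBs) hBs ?_
    intro ξ hξ
    rw [ZFSet.mem_inter, ZFSet.mem_sep, ZFSet.mem_sep] at hξ
    refine ZFSet.mem_sep.2 ⟨hξ.1.1, ?_⟩
    rw [← hgeq ξ hξ.1.1 hξ.2.2]; exact hξ.1.2

theorem main_thm {κ : ZFSet.{u}} (hR : IsRamseyCard κ) {A : ZFSet.{u}} (hA : A ⊆ κ) :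
    ∃ M, IsWeakModel κ M ∧ OmegaSpecial κ M ∧ A ∈ M ∧
      ∃ U, IsMUltrafilter κ M U ∧ WeaklyAmenable κ M U ∧ OmegaOneIntersecting U := by
  obtain ⟨M, U, Rf, Es, h, hAM, hEM, hEs⟩ := setup hR hA
  haveI := h.good.tm
  have hG := h.good
  haveI : TM (upM κ M U Rf) := ⟨h.tm⟩
  obtain ⟨s, b, h1, h2, h3, h4, h5, h6, h7⟩ := h.chain hEM hEs (h.sub_mem hAM hA)
  let N := ZFSet.sep (fun z => ∃ n, z ∈ s n) (upM κ M U Rf)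
  have hN : ∀ z, z ∈ N ↔ ∃ n, z ∈ s n := fun z =>
    ZFSet.mem_sep.trans ⟨fun h => h.2, fun h => ⟨(h3 _).1 h.choose_spec, h⟩⟩
  have hmono : ∀ n, s n ⊆ s (n + 1) := fun n => h2 (n + 1) _ (h7 n).1
  have hNs : N ⊆ upM κ M U Rf := fun z hz => (ZFSet.mem_sep.1 hz).1
  have hNE : ElemSub N.toSet (upM κ M U Rf).toSet := elem_union hmono h3 hN
  have hNt : N.IsTransitive := by
    intro z hz w hw
    obtain ⟨n, hn⟩ := (hN z).1 hz
    exact (hN w).2 ⟨n, h2 n _ hn hw⟩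
  have hκN : κ ∈ N := (hN _).2 ⟨0, h6⟩
  have hωκ : ZFSet.omega ∈ κ := hG.omega_mem h.card
  have hωN : ZFSet.omega ∈ N := hNt _ hκN hωκ
  have h0N : (∅ : ZFSet.{u}) ∈ N := hNt _ hωN ZFSet.omega_zero
  have hNm : IsTransModel N := (h.tfer.elem hNE ⟨fun x hx y hy => hNt x hx hy, h0N⟩ h.upM_uc).tm hNt hωN
  haveI : TM N := ⟨hNm⟩
  refine ⟨N, ⟨hNm, hκN, le_antisymm ?_ (zcard_mono (hNt _ hκN))⟩, ?_, (hN _).2 ⟨0, h5⟩,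
    U ∩ N, h.ultra hNs hκN, ?_, ?_⟩
  · rw [← hG.wm.2.2]; exact (zcard_mono hNs).trans zcard_upM
  · refine ⟨s, fun n => (hN _).2 ⟨n + 1, (h7 n).1⟩, fun n x hx => hmono n hx, fun n => ?_,
      fun n => ⟨b n, (hN _).2 ⟨n + 1, (h7 n).2.1⟩, h4 n⟩, hN⟩
    refine ⟨fun x hx => (hN x).2 ⟨n, hx⟩, fun φ v hv => ?_⟩
    rw [(h3 n).2 φ v hv, hNE.2 φ v (fun i => (hN _).2 ⟨n, hv i⟩)]
  · intro X hX _
    obtain ⟨n, hn⟩ := (hN X).1 hX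
    have : X ∩ (U ∩ N) = X ∩ (s n ∩ U) := by
      ext y
      simp only [ZFSet.mem_inter]
      exact ⟨fun hy => ⟨hy.1, h2 n _ hn hy.1, hy.2.1⟩,
        fun hy => ⟨hy.1, hy.2.2, (hN y).2 ⟨n, hy.2.1⟩⟩⟩
    rw [this]
    exact M_inter hX ((hN _).2 ⟨n + 1, (h7 n).2.2⟩)
  · intro t ht
    exact hG.oi t (fun n => (ZFSet.mem_inter.1 (ht n)).1)

/-- If `κ` is a Ramsey cardinal, then every `A ⊆ κ` is contained in an
`ω`-special weak `κ`-model `M` for which there is a weakly amenable `ω₁`-intersecting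
`M`-ultrafilter on `κ`. -/
theorem ramsey_omegaSpecial_model (κ : ZFSet) (hκ : IsRamseyCard κ) :
    ∀ A : ZFSet, A ⊆ κ →
      ∃ M : ZFSet, IsWeakModel κ M ∧ OmegaSpecial κ M ∧ A ∈ M ∧
        ∃ U : ZFSet, IsMUltrafilter κ M U ∧ WeaklyAmenable κ M U ∧
          OmegaOneIntersecting U := by
  intro A hA
  exact main_thm hκ hA

end MPaper
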